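/- (The Macdonald–Mehta integral; Opdam, Etingof.) Let W ⊂ O(ℝ^r) be a finite group generated by orthogonal reflections, with set of reflections S. For each s ∈ S let α_s ∈ ℝ^r be a vector orthogonal to the reflecting hyperplane of s with (α_s, α_s) = 2, and set δ(x) = ∏_{s∈S} (α_s, x). Suppose P_1,…,P_r are algebraically independent homogeneous polynomials generating the invariant algebra ℝ[x_1,…,x_r]^W, of degrees d_1,…,d_r. Then for every complex number k with Re(k) ≥ 0: (2π)^{−r/2} ∫_{ℝ^r} e^{−(x,x)/2} |δ(x)|^{2k} dx = ∏_{i=1}^r Γ(1 + k d_i)/Γ(1 + k), where |δ(x)|^{2k} := exp(2k·log|δ(x)|) (interpreted as 0 when δ(x) = 0) and Γ is the Gamma function. -/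

import Mathlib

open MvPolynomial MeasureTheory

noncomputable section

/-- The matrix underlying an element of a subgroup of `GL_r(ℝ)`. -/
def matOfR {r : ℕ} {W : Subgroup (Matrix.GeneralLinearGroup (Fin r) ℝ)} (w : W) :
    Matrix (Fin r) (Fin r) ℝ :=
  ((w : Matrix.GeneralLinearGroup (Fin r) ℝ) : Matrix (Fin r) (Fin r) ℝ)

section
lemma dot_self_nonneg {r : ℕ} (v : Fin r → ℝ) : 0 ≤ v ⬝ᵥ v :=
  Finset.sum_nonneg fun i _ => mul_self_nonneg _

lemma dot_self_pos {r : ℕ} {v : Fin r → ℝ} (h : v ≠ 0) : 0 < v ⬝ᵥ v :=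
  lt_of_le_of_ne (dot_self_nonneg v) fun e => h (dotProduct_self_eq_zero.1 e.symm)

structure RS (r : ℕ) (G : Type) [Group G] where
  ρ : G →* Module.End ℝ (Fin r → ℝ)
  orth : ∀ g x y, ρ g x ⬝ᵥ ρ g y = x ⬝ᵥ y
  inj : Function.Injective ρ
  S : Finset G
  α : G → Fin r → ℝ
  nrm : ∀ s ∈ S, α s ⬝ᵥ α s = 2
  refl : ∀ s ∈ S, ∀ x, ρ s x = x - (α s ⬝ᵥ x) • α s
  conj_mem : ∀ g, ∀ s ∈ S, g * s * g⁻¹ ∈ S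
  gen : Subgroup.closure (S : Set G) = ⊤

namespace RS
variable {r : ℕ} {G : Type} [Group G] (R : RS r G)

lemma rho_mul (g h : G) (x : Fin r → ℝ) : R.ρ (g * h) x = R.ρ g (R.ρ h x) := by
  rw [map_mul]; rfl

lemma rho_one (x : Fin r → ℝ) : R.ρ 1 x = x := by
  rw [map_one]; rfl

lemma rho_inv_self (g : G) (x : Fin r → ℝ) : R.ρ g⁻¹ (R.ρ g x) = x := by
  rw [← rho_mul, inv_mul_cancel, rho_one]

lemma rho_self_inv (g : G) (x : Fin r → ℝ) : R.ρ g (R.ρ g⁻¹ x) = x := by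
  rw [← rho_mul, mul_inv_cancel, rho_one]

lemma dot_inv (g : G) (x y : Fin r → ℝ) : x ⬝ᵥ R.ρ g y = R.ρ g⁻¹ x ⬝ᵥ y := by
  rw [← R.orth g⁻¹ x, rho_inv_self]

lemma s_mul_s {s : G} (hs : s ∈ R.S) : s * s = 1 := by
  apply R.inj
  refine LinearMap.ext fun x => ?_
  rw [rho_mul, rho_one, R.refl s hs, R.refl s hs]
  rw [dotProduct_sub, dotProduct_smul, R.nrm s hs]
  simp only [smul_eq_mul]
  module

lemma s_inv {s : G} (hs : s ∈ R.S) : s⁻¹ = s := inv_eq_of_mul_eq_one_left (R.s_mul_s hs)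

lemma alpha_s_s {s : G} (hs : s ∈ R.S) (x) : R.α s ⬝ᵥ R.ρ s x = - (R.α s ⬝ᵥ x) := by
  rw [R.refl s hs, dotProduct_sub, dotProduct_smul, R.nrm s hs, smul_eq_mul]; ring

lemma alpha_inj {s t : G} (hs : s ∈ R.S) (ht : t ∈ R.S) (h : R.α s = R.α t ∨ R.α s = - R.α t) :
    s = t := by
  apply R.inj
  refine LinearMap.ext fun x => ?_
  rw [R.refl s hs, R.refl t ht]
  rcases h with h | h <;> rw [h]
  simp

lemma conj_alpha (g : G) {s : G} (hs : s ∈ R.S) :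
    R.ρ g (R.α s) = R.α (g * s * g⁻¹) ∨ R.ρ g (R.α s) = - R.α (g * s * g⁻¹) := by
  have h1 := R.conj_mem g s hs
  set t := g * s * g⁻¹ with ht
  have h2 : R.ρ t (R.ρ g (R.α s)) = - R.ρ g (R.α s) := by
    rw [ht, rho_mul, rho_mul, rho_inv_self, R.refl s hs, R.nrm s hs, ← map_neg]
    congr 1; module
  rw [R.refl t h1] at h2
  set c := R.α t ⬝ᵥ R.ρ g (R.α s)
  have h3 : R.ρ g (R.α s) = (c / 2) • R.α t := by
    have : (2:ℝ) • R.ρ g (R.α s) = c • R.α t := by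
      rw [two_smul]; 
      have := sub_eq_iff_eq_add.1 h2
      nth_rewrite 1 [this]; abel
    rw [div_eq_inv_mul, mul_smul, ← this, smul_smul]; norm_num
  have h4 : (c/2) * (c/2) = 1 := by
    have h5 := R.orth g (R.α s) (R.α s)
    rw [h3, R.nrm s hs, dotProduct_smul, smul_dotProduct, R.nrm t h1] at h5
    simp only [smul_eq_mul] at h5
    linarith
  rw [h3]
  rcases mul_self_eq_one_iff.1 h4 with h | h <;> rw [h] <;> simp

/-- sign-invariance of the coefficient forms -/
lemma alpha_rho (g : G) {s : G} (hs : s ∈ R.S) :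
    (∀ x, R.α (g * s * g⁻¹) ⬝ᵥ R.ρ g x = R.α s ⬝ᵥ x) ∨
    (∀ x, R.α (g * s * g⁻¹) ⬝ᵥ R.ρ g x = - (R.α s ⬝ᵥ x)) := by
  rcases R.conj_alpha g hs with h | h
  · left; intro x; rw [← h, R.orth]
  · right; intro x
    have : R.α (g * s * g⁻¹) = - R.ρ g (R.α s) := by rw [h]; simp
    rw [this, neg_dotProduct, R.orth]

def Reg (x : Fin r → ℝ) : Prop := ∀ s ∈ R.S, R.α s ⬝ᵥ x ≠ 0

def sep (x y : Fin r → ℝ) : ℕ := by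
  classical exact (R.S.filter (fun s => (R.α s ⬝ᵥ x) * (R.α s ⬝ᵥ y) < 0)).card

lemma conj_mem' (g : G) {s : G} (hs : s ∈ R.S) : g⁻¹ * s * g ∈ R.S := by
  simpa using R.conj_mem g⁻¹ s hs

lemma reg_rho {x : Fin r → ℝ} (hx : R.Reg x) (g : G) : R.Reg (R.ρ g x) := by
  intro s hs
  have h := R.alpha_rho g (R.conj_mem' g hs)
  have e : g * (g⁻¹ * s * g) * g⁻¹ = s := by group
  rw [e] at h
  have := hx _ (R.conj_mem' g hs)
  rcases h with h | h <;> rw [h] <;> simpa using this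

lemma reg_neg {x : Fin r → ℝ} (hx : R.Reg x) : R.Reg (-x) := by
  intro s hs
  simpa using hx s hs

lemma sep_rho (g : G) (x y) : R.sep (R.ρ g x) (R.ρ g y) = R.sep x y := by
  classical
  unfold sep
  symm
  have key : ∀ s ∈ R.S, (R.α (g * s * g⁻¹) ⬝ᵥ R.ρ g x) * (R.α (g * s * g⁻¹) ⬝ᵥ R.ρ g y)
      = (R.α s ⬝ᵥ x) * (R.α s ⬝ᵥ y) := by
    intro s hs
    rcases R.alpha_rho g hs with h | h <;> rw [h, h]
    ring
  apply Finset.card_bij (fun s _ => g * s * g⁻¹)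
  · intro s hs
    rw [Finset.mem_filter] at hs ⊢
    exact ⟨R.conj_mem g s hs.1, by rw [key s hs.1]; exact hs.2⟩
  · intro s _ t _ h
    simpa using h
  · intro t ht
    rw [Finset.mem_filter] at ht
    refine ⟨g⁻¹ * t * g, ?_, by group⟩
    rw [Finset.mem_filter]
    refine ⟨R.conj_mem' g ht.1, ?_⟩
    rw [← key _ (R.conj_mem' g ht.1)]
    have e : g * (g⁻¹ * t * g) * g⁻¹ = t := by group
    rw [e]; exact ht.2

lemma sep_comm (x y) : R.sep x y = R.sep y x := by
  unfold sep; congr 1; ext s; simp [mul_comm]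

/-- sign-normalized roots -/
def pos (p : Fin r → ℝ) (s : G) : Fin r → ℝ := if 0 < R.α s ⬝ᵥ p then R.α s else - R.α s

lemma pos_eq (p) (s) : R.pos p s = R.α s ∨ R.pos p s = - R.α s := by
  unfold pos; split_ifs <;> simp

lemma pos_pos {p} (hp : R.Reg p) {s} (hs : s ∈ R.S) : 0 < R.pos p s ⬝ᵥ p := by
  unfold pos; split_ifs with h
  · exact h
  · have := hp s hs
    rw [neg_dotProduct]
    rcases lt_or_gt_of_ne this with h1 | h1
    · linarith
    · exact absurd h1 h

lemma pos_nrm (p) {s} (hs : s ∈ R.S) : R.pos p s ⬝ᵥ R.pos p s = 2 := by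
  rcases R.pos_eq p s with h | h <;> rw [h] <;> simp [R.nrm s hs]

lemma pos_refl (p) {s} (hs : s ∈ R.S) (x) :
    R.ρ s x = x - (R.pos p s ⬝ᵥ x) • R.pos p s := by
  rw [R.refl s hs]
  rcases R.pos_eq p s with h | h <;> rw [h]
  simp

lemma pos_sep {p} (hp : R.Reg p) {s} (hs : s ∈ R.S) (y) :
    (R.α s ⬝ᵥ p) * (R.α s ⬝ᵥ y) < 0 ↔ R.pos p s ⬝ᵥ y < 0 := by
  have h1 := R.pos_pos hp hs
  have : (R.α s ⬝ᵥ p) * (R.α s ⬝ᵥ y) = (R.pos p s ⬝ᵥ p) * (R.pos p s ⬝ᵥ y) := by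
    rcases R.pos_eq p s with h | h <;> rw [h]
    simp
  rw [this]
  exact ⟨fun h => by
    by_contra hc
    have := mul_nonneg h1.le (not_lt.1 hc)
    linarith, fun h => mul_neg_of_pos_of_neg h1 h⟩

lemma pos_inj (p) {s t : G} (hs : s ∈ R.S) (ht : t ∈ R.S) (h : R.pos p s = R.pos p t) :
    s = t := by
  apply R.alpha_inj hs ht
  rcases R.pos_eq p s with h1 | h1 <;> rcases R.pos_eq p t with h2 | h2 <;> rw [h1, h2] at h
  · left; exact h
  · right; exact h
  · right; rw [← h, neg_neg]
  · left; exact neg_injective h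

lemma pos_conj (p) (g : G) {s : G} (hs : s ∈ R.S) :
    R.ρ g (R.pos p s) = R.pos p (g * s * g⁻¹) ∨ R.ρ g (R.pos p s) = - R.pos p (g * s * g⁻¹) := by
  rcases R.pos_eq p s with h1 | h1 <;> rcases R.pos_eq p (g * s * g⁻¹) with h2 | h2 <;>
    rcases R.conj_alpha g hs with h3 | h3 <;> rw [h1, h2] <;> simp [h3]

def Simple (p : Fin r → ℝ) (s : G) : Prop := s ∈ R.S ∧ R.sep p (R.ρ s p) = 1

lemma sep_self_refl {p} (hp : R.Reg p) {s} (hs : s ∈ R.S) :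
    (R.α s ⬝ᵥ p) * (R.α s ⬝ᵥ R.ρ s p) < 0 := by
  rw [R.alpha_s_s hs]
  have := mul_self_pos.2 (hp s hs)
  linarith

lemma simple_ne {p} (hp : R.Reg p) {s} (hs : R.Simple p s) {t} (ht : t ∈ R.S) (h : t ≠ s) :
    0 < R.pos p t ⬝ᵥ R.ρ s p := by
  classical
  by_contra hc
  have h0 : R.pos p t ⬝ᵥ R.ρ s p ≠ 0 := by
    have := R.reg_rho hp s t ht
    rcases R.pos_eq p t with h | h <;> rw [h] <;> simpa using this
  have h1 : R.pos p t ⬝ᵥ R.ρ s p < 0 := lt_of_le_of_ne (not_lt.1 hc) h0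
  rw [← R.pos_sep hp ht] at h1
  have h2 := hs.2
  unfold sep at h2
  rw [Finset.card_eq_one] at h2
  obtain ⟨a, ha⟩ := h2
  have m1 : t ∈ ({a} : Finset G) := by rw [← ha]; simp [ht, h1]
  have m2 : s ∈ ({a} : Finset G) := by rw [← ha]; simp [hs.1, R.sep_self_refl hp hs.1]
  simp at m1 m2
  exact h (m1.trans m2.symm)

lemma exists_simple {p y} (hp : R.Reg p) (hy : R.Reg y) (h : R.sep p y ≠ 0) :
    ∃ s, R.Simple p s ∧ (R.α s ⬝ᵥ p) * (R.α s ⬝ᵥ y) < 0 := by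
  classical
  unfold sep at h
  have hne := Finset.card_ne_zero.1 h
  obtain ⟨s, hs, hmin⟩ := Finset.exists_min_image _
    (fun s => toLex ((R.pos p s ⬝ᵥ p) / (-(R.pos p s ⬝ᵥ y)), R.pos p s ⬝ᵥ p)) hne
  rw [Finset.mem_filter] at hs
  obtain ⟨hsS, hsy⟩ := hs
  refine ⟨s, ⟨hsS, ?_⟩, hsy⟩
  by_contra hns
  have hmem : s ∈ R.S.filter (fun t => (R.α t ⬝ᵥ p) * (R.α t ⬝ᵥ R.ρ s p) < 0) := by
    simp [hsS, R.sep_self_refl hp hsS]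
  obtain ⟨t, ht, hts⟩ : ∃ t ∈ R.S.filter (fun t => (R.α t ⬝ᵥ p) * (R.α t ⬝ᵥ R.ρ s p) < 0), t ≠ s := by
    by_contra hcon
    push Not at hcon
    apply hns
    unfold sep
    rw [Finset.card_eq_one]
    exact ⟨s, Finset.eq_singleton_iff_unique_mem.2 ⟨hmem, hcon⟩⟩
  rw [Finset.mem_filter] at ht
  obtain ⟨htS, htp⟩ := ht
  rw [R.pos_sep hp htS] at htp
  rw [R.pos_sep hp hsS] at hsy
  -- the third root
  have hu : s * t * s⁻¹ ∈ R.S := R.conj_mem s t htS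
  set u := s * t * s⁻¹ with hudef
  set c := R.pos p s ⬝ᵥ R.pos p t with hc
  have e1 : R.ρ s (R.pos p t) = R.pos p t - c • R.pos p s := R.pos_refl p hsS _
  have e2 : R.pos p t ⬝ᵥ R.ρ s p = R.ρ s (R.pos p t) ⬝ᵥ p := by
    rw [R.dot_inv, R.s_inv hsS]
  have e3 : R.ρ s (R.pos p t) = - R.pos p u := by
    rcases R.pos_conj p s htS with h1 | h1
    · exfalso
      rw [e2, h1] at htp
      exact absurd (R.pos_pos hp hu) (not_lt.2 htp.le)
    · exact h1
  have e4 : R.pos p u = c • R.pos p s - R.pos p t := by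
    rw [← neg_eq_iff_eq_neg.2 e3, e1]; abel
  have Ps := R.pos_pos hp hsS
  have Pt := R.pos_pos hp htS
  have Pu := R.pos_pos hp hu
  have sumP : R.pos p u ⬝ᵥ p = c * (R.pos p s ⬝ᵥ p) - R.pos p t ⬝ᵥ p := by
    rw [e4, sub_dotProduct, smul_dotProduct, smul_eq_mul]
  have sumY : R.pos p u ⬝ᵥ y = c * (R.pos p s ⬝ᵥ y) - R.pos p t ⬝ᵥ y := by
    rw [e4, sub_dotProduct, smul_dotProduct, smul_eq_mul]
  have hc0 : 0 < c := by
    by_contra hcc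
    nlinarith
  have hc2 : c < 2 := by
    have hne : R.pos p t - R.pos p s ≠ 0 := by
      intro h; exact hts (R.pos_inj p htS hsS (sub_eq_zero.1 h))
    have h0 : 0 < (R.pos p t - R.pos p s) ⬝ᵥ (R.pos p t - R.pos p s) := dot_self_pos hne
    rw [sub_dotProduct, dotProduct_sub, dotProduct_sub, R.pos_nrm p htS, R.pos_nrm p hsS,
      dotProduct_comm (R.pos p t) (R.pos p s), ← hc] at h0
    linarith
  have hmin' : ∀ v ∈ R.S, R.pos p v ⬝ᵥ y < 0 →
      (R.pos p s ⬝ᵥ p) * (-(R.pos p v ⬝ᵥ y)) < (R.pos p v ⬝ᵥ p) * (-(R.pos p s ⬝ᵥ y)) ∨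
      ((R.pos p s ⬝ᵥ p) * (-(R.pos p v ⬝ᵥ y)) = (R.pos p v ⬝ᵥ p) * (-(R.pos p s ⬝ᵥ y)) ∧
       R.pos p s ⬝ᵥ p ≤ R.pos p v ⬝ᵥ p) := by
    intro v hv hvy
    have := hmin v (by rw [Finset.mem_filter, R.pos_sep hp hv]; exact ⟨hv, hvy⟩)
    rw [Prod.Lex.toLex_le_toLex] at this
    have a1 : 0 < -(R.pos p v ⬝ᵥ y) := by linarith
    have a2 : 0 < -(R.pos p s ⬝ᵥ y) := by linarith
    rcases this with h | ⟨h, h'⟩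
    · left; exact (div_lt_div_iff₀ a2 a1).1 h
    · right; exact ⟨(div_eq_div_iff a2.ne' a1.ne').1 h, h'⟩
  have mt := hmin' t htS
  have mu := hmin' u hu
  rw [sumP, sumY] at mu
  rw [sumP] at Pu
  generalize R.pos p s ⬝ᵥ p = ps at *
  generalize R.pos p t ⬝ᵥ p = pt at *
  generalize R.pos p s ⬝ᵥ y = ys at *
  generalize R.pos p t ⬝ᵥ y = yt at *
  clear hmin hmin' hns hmem sumP sumY
  rcases lt_or_ge yt 0 with h1 | h1
  · rcases lt_or_ge (c * ys - yt) 0 with h2 | h2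
    · rcases mt h1 with h3 | ⟨h3, h3'⟩ <;> rcases mu h2 with h4 | ⟨h4, h4'⟩ <;> nlinarith
    · rcases mt h1 with h3 | ⟨h3, h3'⟩ <;> nlinarith
  · have h2 : c * ys - yt < 0 := by nlinarith
    rcases mu h2 with h4 | ⟨h4, h4'⟩ <;> nlinarith

lemma sep_simple_le {p y} (hp : R.Reg p) {s} (hs : R.Simple p s) :
    R.sep p (R.ρ s y) ≤ R.sep p y + 1 := by
  classical
  have e : R.sep p (R.ρ s y) = R.sep (R.ρ s p) y := by
    conv_rhs => rw [← R.sep_rho s, ← R.rho_mul, R.s_mul_s hs.1, R.rho_one]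
  rw [e]
  unfold sep
  calc _ ≤ (insert s (R.S.filter (fun t => (R.α t ⬝ᵥ p) * (R.α t ⬝ᵥ y) < 0))).card := by
        apply Finset.card_le_card
        intro t ht
        rw [Finset.mem_filter] at ht
        rw [Finset.mem_insert, Finset.mem_filter]
        by_cases hts : t = s
        · left; exact hts
        right
        refine ⟨ht.1, ?_⟩
        have h1 := R.simple_ne hp hs ht.1 hts
        have h2 := ht.2
        rw [R.pos_sep hp ht.1]
        rcases R.pos_eq p t with h | h <;> rw [h] at h1 ⊢
        · by_contra hc; nlinarith
        · rw [neg_dotProduct] at h1 ⊢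
          by_contra hc; nlinarith
    _ ≤ _ := Finset.card_insert_le _ _

lemma sep_simple_lt {p y} (hp : R.Reg p) {s} (hs : R.Simple p s)
    (h : (R.α s ⬝ᵥ p) * (R.α s ⬝ᵥ y) < 0) :
    R.sep p (R.ρ s y) < R.sep p y := by
  classical
  have e : R.sep p (R.ρ s y) = R.sep (R.ρ s p) y := by
    conv_rhs => rw [← R.sep_rho s, ← R.rho_mul, R.s_mul_s hs.1, R.rho_one]
  rw [e]
  unfold sep
  apply Finset.card_lt_card
  rw [Finset.ssubset_iff_of_subset]
  · refine ⟨s, by simp [hs.1, h], ?_⟩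
    rw [Finset.mem_filter, R.alpha_s_s hs.1]
    intro hh; linarith [hh.2]
  · intro t ht
    rw [Finset.mem_filter] at ht ⊢
    refine ⟨ht.1, ?_⟩
    by_cases hts : t = s
    · rw [hts]; exact h
    have h1 := R.simple_ne hp hs ht.1 hts
    have h2 := ht.2
    rw [R.pos_sep hp ht.1]
    rcases R.pos_eq p t with h | h <;> rw [h] at h1 ⊢
    · by_contra hc; nlinarith
    · rw [neg_dotProduct] at h1 ⊢
      by_contra hc; nlinarith

lemma exists_sep_zero {p} (hp : R.Reg p) : ∀ n y, R.Reg y → R.sep p y = n →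
    ∃ g, R.sep p (R.ρ g y) = 0 := by
  intro n
  induction n using Nat.strong_induction_on with
  | _ n ih =>
    intro y hy hn
    by_cases h0 : R.sep p y = 0
    · exact ⟨1, by rw [R.rho_one]; exact h0⟩
    obtain ⟨s, hs, h⟩ := R.exists_simple hp hy h0
    have := R.sep_simple_lt hp hs h
    obtain ⟨g, hg⟩ := ih _ (hn ▸ this) (R.ρ s y) (R.reg_rho hy s) rfl
    exact ⟨g * s, by rw [R.rho_mul]; exact hg⟩

lemma exists_long {p} (hp : R.Reg p) : ∃ w, R.sep p (R.ρ w p) = R.S.card := by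
  classical
  obtain ⟨g, hg⟩ := R.exists_sep_zero hp _ (-p) (R.reg_neg hp) rfl
  refine ⟨g, ?_⟩
  unfold sep at hg ⊢
  rw [Finset.card_eq_zero, Finset.filter_eq_empty_iff] at hg
  rw [Finset.filter_true_of_mem]
  intro s hs
  have h1 := hg hs
  have h2 := R.reg_rho hp g s hs
  have h3 := hp s hs
  rw [map_neg, dotProduct_neg, mul_neg] at h1
  have := mul_ne_zero h3 h2
  rcases lt_or_gt_of_ne this with h | h
  · exact h
  · exfalso; apply h1; linarith

lemma sep_le (p y) : R.sep p y ≤ R.S.card := by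
  classical
  unfold sep; exact Finset.card_filter_le _ _

lemma closure_simple [Finite G] {p} (hp : R.Reg p) :
    Subgroup.closure {s | R.Simple p s} = ⊤ := by
  classical
  rw [← top_le_iff, ← R.gen, Subgroup.closure_le]
  intro t ht
  have ht : t ∈ R.S := ht
  set H := Subgroup.closure {s | R.Simple p s} with hH
  let C : Finset G := R.S.filter (fun u => ∃ g ∈ H, g * t * g⁻¹ = u)
  have hC : C.Nonempty := ⟨t, by simp only [C, Finset.mem_filter]; exact ⟨ht, 1, H.one_mem, by simp⟩⟩
  obtain ⟨u, hu, hmin⟩ := Finset.exists_min_image C (fun s => R.pos p s ⬝ᵥ p) hC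
  simp only [C, Finset.mem_filter] at hu
  obtain ⟨huS, g, hg, hgu⟩ := hu
  have huH : u ∈ H := by
    by_contra hcon
    have h0 : R.sep p (R.ρ u p) ≠ 0 := by
      unfold sep
      rw [Finset.card_ne_zero]
      exact ⟨u, by simp [huS, R.sep_self_refl hp huS]⟩
    obtain ⟨σ, hσ, hsσ⟩ := R.exists_simple hp (R.reg_rho hp u) h0
    have hσH : σ ∈ H := Subgroup.subset_closure hσ
    have hne : u ≠ σ := fun h => hcon (h ▸ hσH)
    rw [R.pos_sep hp hσ.1, R.pos_refl p huS, dotProduct_sub, dotProduct_smul, smul_eq_mul] at hsσ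
    have h1 := R.simple_ne hp hσ huS hne
    have Pσ := R.pos_pos hp hσ.1
    have Pu := R.pos_pos hp huS
    have hcpos : 0 < R.pos p σ ⬝ᵥ R.pos p u := by
      by_contra hc; nlinarith
    have e2 : R.pos p u ⬝ᵥ R.ρ σ p = R.ρ σ (R.pos p u) ⬝ᵥ p := by
      rw [R.dot_inv, R.s_inv hσ.1]
    have hvS := R.conj_mem σ u huS
    have e3 : R.ρ σ (R.pos p u) = R.pos p (σ * u * σ⁻¹) := by
      rcases R.pos_conj p σ huS with h | h
      · exact h
      · exfalso
        rw [e2, h, neg_dotProduct] at h1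
        linarith [R.pos_pos hp hvS]
    have e4 := R.pos_refl p hσ.1 (R.pos p u)
    have := hmin (σ * u * σ⁻¹) (by
      simp only [C, Finset.mem_filter]
      refine ⟨hvS, σ * g, H.mul_mem hσH hg, ?_⟩
      rw [← hgu]; group)
    rw [← e3, e4, sub_dotProduct, smul_dotProduct, smul_eq_mul] at this
    nlinarith
  have : t = g⁻¹ * u * g := by rw [← hgu]; group
  show t ∈ H
  rw [this]
  exact H.mul_mem (H.mul_mem (H.inv_mem hg) huH) hg

end RS

end

section
/-! polynomials of degree less than n -/
def UU (r n : ℕ) : Submodule ℝ (MvPolynomial (Fin r) ℝ) :=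
  restrictSupport ℝ {m | m.degree < n}

lemma mem_UU {r n : ℕ} {f : MvPolynomial (Fin r) ℝ} :
    f ∈ UU r n ↔ ∀ m ∈ f.support, m.degree < n := Iff.rfl

lemma UU_mono {r n m : ℕ} (h : n ≤ m) : UU r n ≤ UU r m :=
  restrictSupport_mono _ fun _ hx => lt_of_lt_of_le hx h

lemma UU_zero {r : ℕ} {f : MvPolynomial (Fin r) ℝ} (h : f ∈ UU r 0) : f = 0 := by
  rw [mem_UU] at h
  rw [← support_eq_empty, Finset.eq_empty_iff_forall_notMem]
  intro m hm; exact absurd (h m hm) (Nat.not_lt_zero _)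

lemma hom_mem_UU {r n e : ℕ} {f : MvPolynomial (Fin r) ℝ} (h : f.IsHomogeneous e) (he : e < n) :
    f ∈ UU r n := by
  rw [mem_UU]; intro m hm
  rw [mem_support_iff] at hm
  by_contra hc
  apply hm; apply h.coeff_eq_zero; omega

lemma hom_mul_mem_UU {r n e : ℕ} {f g : MvPolynomial (Fin r) ℝ} (h : f.IsHomogeneous e)
    (hg : g ∈ UU r n) : f * g ∈ UU r (n + e) := by
  classical
  rw [mem_UU] at *
  intro m hm
  have := support_mul f g hm
  rw [Finset.mem_add] at this
  obtain ⟨a, ha, b, hb, rfl⟩ := this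
  have h1 := hg b hb
  have h2 : a.degree = e := by
    by_contra hc
    exact mem_support_iff.1 ha (h.coeff_eq_zero hc)
  rw [map_add]; omega

lemma UU_ind {r n : ℕ} (Q : Submodule ℝ (MvPolynomial (Fin r) ℝ))
    (h : ∀ e < n, ∀ f : MvPolynomial (Fin r) ℝ, f.IsHomogeneous e → f ∈ Q) : UU r n ≤ Q := by
  unfold UU
  rw [restrictSupport_eq_span, Submodule.span_le]
  rintro _ ⟨m, hm, rfl⟩
  exact h m.degree hm _ (isHomogeneous_monomial _ rfl)

lemma mem_UU_succ_iff {r n : ℕ} {f : MvPolynomial (Fin r) ℝ} :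
    f ∈ UU r (n+1) ↔ f.totalDegree ≤ n := by
  rw [mem_UU, totalDegree, Finset.sup_le_iff]
  simp only [Nat.lt_succ_iff]
  rfl

/-- linear form -/
def LF {r : ℕ} (a : Fin r → ℝ) : MvPolynomial (Fin r) ℝ := ∑ i, C (a i) * X i

lemma LF_eval {r : ℕ} (a x : Fin r → ℝ) : eval x (LF a) = a ⬝ᵥ x := by
  simp [LF, dotProduct]

lemma LF_hom {r : ℕ} (a : Fin r → ℝ) : (LF a).IsHomogeneous 1 :=
  IsHomogeneous.sum _ _ _ fun i _ => isHomogeneous_C_mul_X _ _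

lemma LF_ne {r : ℕ} {a : Fin r → ℝ} (h : a ≠ 0) : LF a ≠ 0 := by
  intro h0
  have := LF_eval a a
  rw [h0, map_zero] at this
  exact (dot_self_pos h).ne this

lemma mem_UU_of_LF_mul {r n : ℕ} {a : Fin r → ℝ} (h : a ≠ 0) {f : MvPolynomial (Fin r) ℝ}
    (hf : LF a * f ∈ UU r (n+1)) : f ∈ UU r n := by
  by_cases h0 : f = 0
  · rw [h0]; exact Submodule.zero_mem _
  rw [mem_UU_succ_iff, totalDegree_mul_of_isDomain (LF_ne h) h0,
    (LF_hom a).totalDegree (LF_ne h)] at hf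
  obtain ⟨k, rfl⟩ : ∃ k, n = k + 1 := ⟨n - 1, by omega⟩
  rw [mem_UU_succ_iff]; omega

namespace RS
variable {r : ℕ} {G : Type} [Group G] (R : RS r G)

def act (g : G) : MvPolynomial (Fin r) ℝ →ₐ[ℝ] MvPolynomial (Fin r) ℝ :=
  aeval (fun i => LF (fun j => R.ρ g⁻¹ (Pi.single j 1) i))

lemma rho_apply (g : G) (x : Fin r → ℝ) (i : Fin r) :
    R.ρ g x i = (fun j => R.ρ g (Pi.single j 1) i) ⬝ᵥ x := by
  conv_lhs => rw [← Finset.univ_sum_single x]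
  rw [map_sum, Finset.sum_apply, dotProduct]
  apply Finset.sum_congr rfl
  intro j _
  have : (Pi.single j (x j) : Fin r → ℝ) = x j • Pi.single j (1:ℝ) := by
    ext i; simp [Pi.single_apply]
  rw [this, map_smul]; simp [mul_comm]

lemma eval_act (g : G) (f) (x : Fin r → ℝ) : eval x (R.act g f) = eval (R.ρ g⁻¹ x) f := by
  unfold act
  rw [← coe_aeval_eq_eval, ← coe_aeval_eq_eval]
  have : ((aeval x).comp (aeval (fun i => LF (fun j => R.ρ g⁻¹ (Pi.single j 1) i))) : MvPolynomial (Fin r) ℝ →ₐ[ℝ] ℝ) = aeval (R.ρ g⁻¹ x) := by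
    apply MvPolynomial.algHom_ext
    intro i
    simp only [AlgHom.comp_apply, aeval_X]
    have := LF_eval (fun j => R.ρ g⁻¹ (Pi.single j 1) i) x
    rw [← rho_apply, ← coe_aeval_eq_eval] at this
    exact this
  exact DFunLike.congr_fun this f

lemma act_mul (g h : G) (f) : R.act (g * h) f = R.act g (R.act h f) := by
  apply MvPolynomial.funext; intro x
  rw [eval_act, eval_act, eval_act, mul_inv_rev, rho_mul]

lemma act_one (f) : R.act 1 f = f := by
  apply MvPolynomial.funext; intro x
  rw [eval_act, inv_one, rho_one]

lemma act_hom (g : G) {f : MvPolynomial (Fin r) ℝ} {e : ℕ} (h : f.IsHomogeneous e) : (R.act g f).IsHomogeneous e := by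
  have := h.aeval (n := 1) (fun i => LF (fun j => R.ρ g⁻¹ (Pi.single j 1) i)) (fun i => LF_hom _)
  rwa [one_mul] at this

lemma act_UU (g : G) {f : MvPolynomial (Fin r) ℝ} {n : ℕ} (h : f ∈ UU r n) : R.act g f ∈ UU r n := by
  have : UU r n ≤ (UU r n).comap (R.act g).toLinearMap :=
    UU_ind _ fun e he f hf => hom_mem_UU (R.act_hom g hf) he
  exact this h

lemma alpha_ne {s} (hs : s ∈ R.S) : R.α s ≠ 0 := by
  intro h; have := R.nrm s hs; rw [h] at this; simp at this

lemma demazure {s} (hs : s ∈ R.S) (f : MvPolynomial (Fin r) ℝ) :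
    ∃ D, f - R.act s f = LF (R.α s) * D := by
  let I : Ideal (MvPolynomial (Fin r) ℝ) := Ideal.span {LF (R.α s)}
  have : (Ideal.Quotient.mkₐ ℝ I) = (Ideal.Quotient.mkₐ ℝ I).comp (R.act s) := by
    apply MvPolynomial.algHom_ext
    intro i
    rw [AlgHom.comp_apply, Ideal.Quotient.mkₐ_eq_mk, Ideal.Quotient.eq, Ideal.mem_span_singleton]
    refine ⟨C (R.α s i), ?_⟩
    apply MvPolynomial.funext; intro x
    rw [map_sub, eval_act, R.s_inv hs, R.refl s hs, map_mul, LF_eval]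
    simp
  have h2 := DFunLike.congr_fun this f
  rw [AlgHom.comp_apply, Ideal.Quotient.mkₐ_eq_mk, Ideal.Quotient.eq, Ideal.mem_span_singleton] at h2
  exact h2

lemma demazure_UU {s} (hs : s ∈ R.S) {f : MvPolynomial (Fin r) ℝ} {n : ℕ} (hf : f ∈ UU r (n+1)) :
    ∃ D ∈ UU r n, f - R.act s f = LF (R.α s) * D ∧
      ∀ x, eval x f - eval (R.ρ s x) f = (R.α s ⬝ᵥ x) * eval x D := by
  obtain ⟨D, hD⟩ := R.demazure hs f
  refine ⟨D, mem_UU_of_LF_mul (R.alpha_ne hs) (by rw [← hD]; exact Submodule.sub_mem _ hf (R.act_UU s hf)), hD, ?_⟩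
  intro x
  have := congrArg (eval x) hD
  rwa [map_sub, eval_act, R.s_inv hs, map_mul, LF_eval] at this

/-- generic point with free orbit -/
lemma exists_generic [Finite G] : ∃ p, R.Reg p ∧ ∀ g, R.ρ g p = p → g = 1 := by
  classical
  have : Fintype G := Fintype.ofFinite G
  let K1 : G → Submodule ℝ (Fin r → ℝ) := fun s => LinearMap.ker (dotProductBilin ℝ ℝ (R.α s))
  let K2 : G → Submodule ℝ (Fin r → ℝ) := fun g => LinearMap.ker (R.ρ g - 1)
  let T : Finset (Submodule ℝ (Fin r → ℝ)) := R.S.image K1 ∪ ((Finset.univ.filter (fun g : G => g ≠ 1)).image K2)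
  have hT : ⊤ ∉ T := by
    intro h
    simp only [T, Finset.mem_union, Finset.mem_image, Finset.mem_filter, Finset.mem_univ, true_and] at h
    rcases h with ⟨s, hs, h⟩ | ⟨g, hg, h⟩
    · have : R.α s ∈ K1 s := by rw [h]; trivial
      have h2 : R.α s ⬝ᵥ R.α s = 0 := this
      rw [R.nrm s hs] at h2; norm_num at h2
    · apply hg; apply R.inj
      rw [map_one, ← sub_eq_zero]; exact LinearMap.ker_eq_top.1 h
  have h := Subspace.biUnion_ne_univ_of_top_notMem hT
  rw [Set.ne_univ_iff_exists_notMem] at h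
  obtain ⟨p, hp⟩ := h
  simp only [Set.mem_iUnion, not_exists] at hp
  refine ⟨p, ?_, ?_⟩
  · intro s hs h
    exact hp (K1 s) (by simp only [T, Finset.mem_union, Finset.mem_image]; left; exact ⟨s, hs, rfl⟩) h
  · intro g hg
    by_contra hne
    refine hp (K2 g) (by simp only [T, Finset.mem_union, Finset.mem_image]; right; exact ⟨g, by simpa using hne, rfl⟩) ?_
    show R.ρ g p - p = 0
    rw [hg, sub_self]

lemma ell_le {p} (hp : R.Reg p) {s} (hs : R.Simple p s) (g : G) :
    R.sep p (R.ρ (s * g) p) ≤ R.sep p (R.ρ g p) + 1 := by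
  rw [rho_mul]; exact R.sep_simple_le hp hs

lemma ell_one (p) : R.sep p (R.ρ 1 p) = 0 := by
  classical
  unfold sep
  rw [rho_one, Finset.card_eq_zero, Finset.filter_eq_empty_iff]
  intro s _; exact not_lt.2 (mul_self_nonneg _)

lemma B1 [Finite G] {p} (hp : R.Reg p) : ∀ n, ∀ f ∈ UU r n,
    (∀ g, R.sep p (R.ρ g p) < n → eval (R.ρ g p) f = 0) → ∀ g, eval (R.ρ g p) f = 0 := by
  intro n
  induction n with
  | zero => intro f hf _ g; rw [UU_zero hf, map_zero]
  | succ n ih =>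
    intro f hf h
    have key : ∀ s, R.Simple p s → ∀ g, eval (R.ρ (s * g) p) f = eval (R.ρ g p) f := by
      intro s hs
      obtain ⟨D, hD, -, hD2⟩ := R.demazure_UU hs.1 hf
      have h1 := ih D hD (by
        intro g hg
        have e := hD2 (R.ρ g p)
        rw [h g (by omega), ← rho_mul, h (s * g) (by have := R.ell_le hp hs g; omega)] at e
        have := R.reg_rho hp g s hs.1
        rw [sub_zero, zero_eq_mul] at e
        exact e.resolve_left this)
      intro g
      have e := hD2 (R.ρ g p)
      rw [h1 g, mul_zero, ← rho_mul] at e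
      linarith
    intro g
    have hg : g ∈ Subgroup.closure {s | R.Simple p s} := by rw [R.closure_simple hp]; trivial
    have : ∀ g', eval (R.ρ (g * g') p) f = eval (R.ρ g' p) f := by
      induction hg using Subgroup.closure_induction with
      | mem s hs => exact key s hs
      | one => simp
      | mul x y _ _ hx hy => intro g'; rw [mul_assoc, hx, hy]
      | inv x _ hx => intro g'; rw [← hx (x⁻¹ * g'), mul_inv_cancel_left]
    have h2 := this 1
    rw [mul_one] at h2
    rw [h2]; exact h 1 (by rw [ell_one]; omega)

def Dl (p x : Fin r → ℝ) : ℝ := ∏ s ∈ R.S, R.pos p s ⬝ᵥ x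

lemma Dl_simple {p} (hp : R.Reg p) {s} (hs : R.Simple p s) (x) :
    R.Dl p (R.ρ s x) = - R.Dl p x := by
  classical
  unfold Dl
  rw [← Finset.mul_prod_erase _ _ hs.1, ← Finset.mul_prod_erase _ _ hs.1]
  have e1 : R.pos p s ⬝ᵥ R.ρ s x = - (R.pos p s ⬝ᵥ x) := by
    have := R.alpha_s_s hs.1 x
    rcases R.pos_eq p s with h | h <;> rw [h] <;> simp [this]
  rw [e1, neg_mul]
  congr 2
  refine Finset.prod_bij (fun t _ => s * t * s⁻¹) ?_ ?_ ?_ ?_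
  · intro t ht
    rw [Finset.mem_erase] at ht ⊢
    refine ⟨?_, R.conj_mem s t ht.2⟩
    intro h; apply ht.1
    have : t = s⁻¹ * (s * t * s⁻¹) * s := by group
    rw [this, h]; group
  · intro a _ b _ h; simpa using h
  · intro t ht
    rw [Finset.mem_erase] at ht
    refine ⟨s⁻¹ * t * s, ?_, by group⟩
    rw [Finset.mem_erase]
    refine ⟨?_, R.conj_mem' s ht.2⟩
    intro h; apply ht.1
    have : t = s * (s⁻¹ * t * s) * s⁻¹ := by group
    rw [this, h]; group
  · intro t ht
    rw [Finset.mem_erase] at ht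
    have h1 := R.simple_ne hp hs ht.2 ht.1
    rw [R.dot_inv, R.s_inv hs.1] at h1
    rw [R.dot_inv, show R.ρ s⁻¹ = R.ρ s by rw [R.s_inv hs.1]]
    rcases R.pos_conj p s ht.2 with h | h
    · rw [h]
    · exfalso; rw [h, neg_dotProduct] at h1
      linarith [R.pos_pos hp (R.conj_mem s t ht.2)]

lemma Dl_ne {p y} (hy : R.Reg y) : R.Dl p y ≠ 0 := by
  unfold Dl; rw [Finset.prod_ne_zero_iff]
  intro s hs
  have := hy s hs
  rcases R.pos_eq p s with h | h <;> rw [h] <;> simpa using this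

lemma Dl_poly (p) : ∃ f ∈ UU r (R.S.card + 1), ∀ x, eval x f = R.Dl p x := by
  refine ⟨∏ s ∈ R.S, LF (R.pos p s), ?_, ?_⟩
  · apply hom_mem_UU (e := R.S.card) _ (by omega)
    have := IsHomogeneous.prod R.S (fun s => LF (R.pos p s)) (fun _ => 1) (fun s _ => LF_hom _)
    simpa using this
  · intro x; rw [map_prod]; simp only [LF_eval]; rfl

open Classical in
/-- interpolation -/
lemma interp [Finite G] {p} (hp : ∀ g, R.ρ g p = p → g = 1) :
    ∃ n0, ∀ g, ∃ f ∈ UU r n0, ∀ h, eval (R.ρ h p) f = if h = g then 1 else 0 := by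
  classical
  have : Fintype G := Fintype.ofFinite G
  have ex : ∀ g, ∃ f : MvPolynomial (Fin r) ℝ, ∀ h, eval (R.ρ h p) f = if h = g then 1 else 0 := by
    intro g
    let v : G → Fin r → ℝ := fun h => R.ρ g p - R.ρ h p
    have hv : ∀ h, h ≠ g → v h ≠ 0 := by
      intro h hne h0
      apply hne
      have : R.ρ g p = R.ρ h p := sub_eq_zero.1 h0
      have h1 : R.ρ (g⁻¹ * h) p = p := by rw [rho_mul, ← this, rho_inv_self]
      have := hp _ h1
      rw [inv_mul_eq_one] at this; exact this.symm
    refine ⟨∏ h ∈ Finset.univ.erase g, C (v h ⬝ᵥ v h)⁻¹ * (LF (v h) - C (v h ⬝ᵥ R.ρ h p)), ?_⟩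
    intro h
    rw [map_prod]
    split_ifs with hh
    · subst hh
      apply Finset.prod_eq_one
      intro k hk
      have := hv k (Finset.ne_of_mem_erase hk)
      rw [map_mul, map_sub, LF_eval, eval_C, eval_C, ← dotProduct_sub]
      exact inv_mul_cancel₀ (dot_self_pos this).ne'
    · apply Finset.prod_eq_zero (i := h) (by simp [hh])
      rw [map_mul, map_sub, LF_eval, eval_C, eval_C, sub_self, mul_zero]
  choose F hF using ex
  refine ⟨(Finset.univ.sup fun g => (F g).totalDegree) + 1, fun g => ⟨F g, ?_, hF g⟩⟩
  rw [mem_UU_succ_iff]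
  exact Finset.le_sup (f := fun g => (F g).totalDegree) (Finset.mem_univ g)

lemma B2 [Fintype G] {p} (hp : R.Reg p) (hp2 : ∀ g, R.ρ g p = p → g = 1) (n : ℕ) (ψ : G → ℝ)
    (h1 : ∀ f ∈ UU r n, ∑ g, ψ g * eval (R.ρ g p) f = 0)
    (h2 : ∀ g, n ≤ R.sep p (R.ρ g p) → ψ g = 0) : ψ = 0 := by
  classical
  obtain ⟨n0, hn0⟩ := R.interp hp2
  have main : ∀ j n, n0 ≤ n + j → ∀ ψ : G → ℝ, (∀ f ∈ UU r n, ∑ g, ψ g * eval (R.ρ g p) f = 0) →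
    (∀ g, n ≤ R.sep p (R.ρ g p) → ψ g = 0) → ψ = 0 := by
    intro j
    induction j with
    | zero =>
      intro n hn ψ h1 h2
      funext g
      obtain ⟨f, hf, hfe⟩ := hn0 g
      have := h1 f (UU_mono (by omega) hf)
      simpa [hfe] using this
    | succ j ih =>
      intro n hn ψ h1 h2
      have key : ∀ s, R.Simple p s → ∀ g, ψ (s * g) = - ψ g := by
        intro s hs
        have hss : s * s = 1 := R.s_mul_s hs.1
        have hr : ∀ g, R.α s ⬝ᵥ R.ρ g p ≠ 0 := fun g => R.reg_rho hp g s hs.1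
        have h3 := ih (n+1) (by omega) (fun g => (ψ g + ψ (s * g)) / (R.α s ⬝ᵥ R.ρ g p)) (by
          intro f hf
          obtain ⟨D, hD, -, hD2⟩ := R.demazure_UU hs.1 hf
          rw [← h1 D hD]
          have e1 : ∀ g, ψ g * eval (R.ρ g p) D = ψ g * eval (R.ρ g p) f / (R.α s ⬝ᵥ R.ρ g p)
              - ψ g * eval (R.ρ (s * g) p) f / (R.α s ⬝ᵥ R.ρ g p) := by
            intro g
            have := hD2 (R.ρ g p)
            rw [rho_mul]
            field_simp [hr g]
            linear_combination (-ψ g) * this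
          have e2 : ∑ g, ψ g * eval (R.ρ (s * g) p) f / (R.α s ⬝ᵥ R.ρ g p)
              = ∑ g, -(ψ (s * g) * eval (R.ρ g p) f / (R.α s ⬝ᵥ R.ρ g p)) := by
            rw [← Equiv.sum_comp (Equiv.mulLeft s)]
            apply Finset.sum_congr rfl
            intro g _
            simp only [Equiv.coe_mulLeft]
            rw [← mul_assoc, hss, one_mul, R.rho_mul s g, R.alpha_s_s hs.1, div_neg]
          simp_rw [e1]
          rw [Finset.sum_sub_distrib, e2, ← Finset.sum_sub_distrib]
          apply Finset.sum_congr rfl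
          intro g _
          ring) (by
          intro g hg
          have := R.ell_le hp hs (s * g)
          rw [← mul_assoc, hss, one_mul] at this
          rw [h2 g (by omega), h2 (s * g) (by omega)]; simp)
        intro g
        have := congrFun h3 g
        simp only [Pi.zero_apply, div_eq_zero_iff, hr g, or_false] at this
        linarith
      have const : ∀ g, ψ g * R.Dl p (R.ρ g p) = ψ 1 * R.Dl p (R.ρ 1 p) := by
        intro g
        have hg : g ∈ Subgroup.closure {s | R.Simple p s} := by rw [R.closure_simple hp]; trivial
        have : ∀ g', ψ (g * g') * R.Dl p (R.ρ (g * g') p) = ψ g' * R.Dl p (R.ρ g' p) := by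
          induction hg using Subgroup.closure_induction with
          | mem s hs => intro g'; rw [key s hs, rho_mul, R.Dl_simple hp hs]; ring
          | one => simp
          | mul x y _ _ hx hy => intro g'; rw [mul_assoc, hx, hy]
          | inv x _ hx => intro g'; rw [← hx (x⁻¹ * g'), mul_inv_cancel_left]
        have h2 := this 1
        rwa [mul_one] at h2
      have hc : ψ 1 * R.Dl p (R.ρ 1 p) = 0 := by
        rcases le_or_gt n R.S.card with h | h
        · obtain ⟨w, hw⟩ := R.exists_long hp
          rw [← const w, h2 w (by omega), zero_mul]
        · obtain ⟨f, hf, hfe⟩ := R.Dl_poly p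
          have := h1 f (UU_mono (by omega) hf)
          simp_rw [hfe, const] at this
          rw [Finset.sum_const, smul_eq_zero] at this
          rcases this with h | h
          · simp at h
          · exact h
      funext g
      have := const g
      rw [hc] at this
      exact (mul_eq_zero.1 this).resolve_right (R.Dl_ne (R.reg_rho hp g))
  exact main n0 n (by omega) ψ h1 h2

lemma B3 [Fintype G] {p} (hp : R.Reg p) (hp2 : ∀ g, R.ρ g p = p → g = 1) (n : ℕ) (c : G → ℝ) :
    ∃ f ∈ UU r n, ∀ g, R.sep p (R.ρ g p) < n → eval (R.ρ g p) f = c g := by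
  classical
  let T : UU r n →ₗ[ℝ] (G → ℝ) :=
    { toFun := fun f g => if R.sep p (R.ρ g p) < n then eval (R.ρ g p) f.1 else 0
      map_add' := by intros; ext; simp only [Submodule.coe_add, map_add, Pi.add_apply]; split_ifs <;> simp
      map_smul' := by intros; ext; simp only [SetLike.val_smul, smul_eval, Pi.smul_apply, smul_eq_mul, RingHom.id_apply]; split_ifs <;> simp }
  have key : ∀ (φ : (G → ℝ) →ₗ[ℝ] ℝ) (v : G → ℝ),
      φ (fun g => if R.sep p (R.ρ g p) < n then v g else 0)
        = ∑ g, (if R.sep p (R.ρ g p) < n then φ (Pi.single g 1) else 0) * v g := by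
    intro φ v
    conv_lhs => rw [← Finset.univ_sum_single (fun g => if R.sep p (R.ρ g p) < n then v g else 0), map_sum]
    apply Finset.sum_congr rfl
    intro g _
    split_ifs with h
    · have : (Pi.single g (v g) : G → ℝ) = v g • Pi.single g (1:ℝ) := by
        ext i; simp [Pi.single_apply]
      rw [this, map_smul, smul_eq_mul, mul_comm]
    · simp
  have hc : (fun g => if R.sep p (R.ρ g p) < n then c g else 0) ∈ LinearMap.range T := by
    by_contra hne
    obtain ⟨φ, hφ, hle⟩ := Submodule.exists_le_ker_of_notMem hne
    have h0 : (fun g => if R.sep p (R.ρ g p) < n then φ (Pi.single g 1) else 0) = 0 := by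
      apply R.B2 hp hp2 n
      · intro f hf
        have h1 : φ (T ⟨f, hf⟩) = 0 := hle ⟨_, rfl⟩
        rw [← key φ (fun g => eval (R.ρ g p) f)]
        exact h1
      · intro g hg
        simp [not_lt.2 hg]
    apply hφ
    rw [key]
    apply Finset.sum_eq_zero
    intro g _
    have := congrFun h0 g
    simp only [Pi.zero_apply] at this
    rw [this, zero_mul]
  obtain ⟨f, hf⟩ := hc
  refine ⟨f.1, f.2, fun g hg => ?_⟩
  have := congrFun hf g
  simpa [T, hg] using this

end RS

end

section
def wt {r : ℕ} (d : Fin r → ℕ) (m : Fin r →₀ ℕ) : ℕ := ∑ i, m i * d i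

/-- the basic invariant data -/
structure RInv {r : ℕ} {G : Type} [Group G] (R : RS r G) where
  P : Fin r → MvPolynomial (Fin r) ℝ
  d : Fin r → ℕ
  alg : AlgebraicIndependent ℝ P
  hom : ∀ i, (P i).IsHomogeneous (d i)
  inv : ∀ f : MvPolynomial (Fin r) ℝ, f ∈ Algebra.adjoin ℝ (Set.range P) ↔ ∀ g, R.act g f = f

namespace RInv
variable {r : ℕ} {G : Type} [Group G] {R : RS r G} (I : RInv R)

lemma d_pos (i) : 1 ≤ I.d i := by
  by_contra h
  have h0 : I.d i = 0 := by omega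
  have h1 := I.hom i
  rw [h0, ← totalDegree_zero_iff_isHomogeneous, totalDegree_eq_zero_iff_eq_C] at h1
  have h2 := I.alg
  rw [algebraicIndependent_iff_injective_aeval] at h2
  have : aeval I.P (X i : MvPolynomial (Fin r) ℝ) = aeval I.P (C (coeff 0 (I.P i)) : MvPolynomial (Fin r) ℝ) := by
    rw [aeval_X, aeval_C, h1]; simp
  have h3 := h2 this
  have := congrArg totalDegree h3
  simp at this

lemma act_P (g i) : R.act g (I.P i) = I.P i :=
  (I.inv _).1 (Algebra.subset_adjoin ⟨i, rfl⟩) g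

lemma act_aeval (g) (F : MvPolynomial (Fin r) ℝ) : R.act g (aeval I.P F) = aeval I.P F := by
  refine (I.inv _).1 ?_ g
  rw [Algebra.adjoin_range_eq_range_aeval]
  exact ⟨F, rfl⟩

lemma Pm_hom (m : Fin r →₀ ℕ) : (aeval I.P (monomial m (1:ℝ))).IsHomogeneous (wt I.d m) := by
  rw [aeval_monomial, map_one, one_mul, Finsupp.prod_fintype _ _ (by simp)]
  unfold wt
  simp_rw [mul_comm (m _)]
  exact IsHomogeneous.prod _ _ _ fun i _ => (I.hom i).pow _

lemma inv_mem {f : MvPolynomial (Fin r) ℝ} (hf : ∀ g, R.act g f = f) {n : ℕ} (hn : f ∈ UU r n) :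
    f ∈ Submodule.span ℝ ((fun m => aeval I.P (monomial m (1:ℝ))) '' {m | wt I.d m < n}) := by
  have h1 := (I.inv f).2 hf
  rw [Algebra.adjoin_range_eq_range_aeval] at h1
  obtain ⟨F, hF⟩ := h1
  have hF : aeval I.P F = f := hF
  have e1 : f = ∑ j ∈ Finset.range n, homogeneousComponent j f := by
    ext m
    rw [coeff_sum]
    simp_rw [coeff_homogeneousComponent]
    rw [Finset.sum_ite_eq]
    split_ifs with h
    · rfl
    · by_contra hc
      exact h (Finset.mem_range.2 (mem_UU.1 hn m (mem_support_iff.2 hc)))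
  rw [e1]
  apply Submodule.sum_mem
  intro j hj
  rw [Finset.mem_range] at hj
  have : aeval I.P F = ∑ m ∈ F.support, coeff m F • aeval I.P (monomial m (1:ℝ)) := by
    conv_lhs => rw [F.as_sum]
    rw [map_sum]
    apply Finset.sum_congr rfl
    intro m _
    rw [← map_smul, smul_monomial, smul_eq_mul, mul_one]
  rw [← hF, this, map_sum]
  apply Submodule.sum_mem
  intro m _
  rw [map_smul]
  apply Submodule.smul_mem
  rw [homogeneousComponent_of_mem (I.Pm_hom m)]
  split_ifs with h
  · apply Submodule.subset_span
    refine ⟨m, ?_, rfl⟩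
    show wt I.d m < n
    omega
  · exact Submodule.zero_mem _

/-- M n = Σ P_i U(n+1-d_i) + U n -/
def MM (n : ℕ) : Submodule ℝ (MvPolynomial (Fin r) ℝ) :=
  (⨆ i, (UU r (n + 1 - I.d i)).map (LinearMap.mulLeft ℝ (I.P i))) ⊔ UU r n

lemma MM_le {n} {Q : Submodule ℝ (MvPolynomial (Fin r) ℝ)}
    (h1 : ∀ i, ∀ f ∈ UU r (n + 1 - I.d i), I.P i * f ∈ Q) (h2 : UU r n ≤ Q) : I.MM n ≤ Q := by
  apply sup_le _ h2
  apply iSup_le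
  intro i
  rw [Submodule.map_le_iff_le_comap]
  exact h1 i

lemma mem_MM1 {n} (i) {f} (hf : f ∈ UU r (n + 1 - I.d i)) : I.P i * f ∈ I.MM n :=
  le_sup_left (a := ⨆ i, (UU r (n + 1 - I.d i)).map (LinearMap.mulLeft ℝ (I.P i)))
    (Submodule.mem_iSup_of_mem i ⟨f, hf, rfl⟩)

lemma mem_MM2 {n} {f} (hf : f ∈ UU r n) : f ∈ I.MM n :=
  le_sup_right (a := ⨆ i, (UU r (n + 1 - I.d i)).map (LinearMap.mulLeft ℝ (I.P i))) hf

lemma act_MM (g) {n f} (hf : f ∈ I.MM n) : R.act g f ∈ I.MM n := by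
  have : I.MM n ≤ (I.MM n).comap (R.act g).toLinearMap := by
    apply I.MM_le
    · intro i f hf
      show R.act g (I.P i * f) ∈ I.MM n
      rw [map_mul, I.act_P]
      exact I.mem_MM1 i (R.act_UU g hf)
    · intro f hf
      exact I.mem_MM2 (R.act_UU g hf)
  exact this hf

lemma LF_MM (a) {n f} (hf : f ∈ I.MM n) : LF a * f ∈ I.MM (n+1) := by
  have : I.MM n ≤ (I.MM (n+1)).comap (LinearMap.mulLeft ℝ (LF a)) := by
    apply I.MM_le
    · intro i f hf
      show LF a * (I.P i * f) ∈ I.MM (n+1)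
      rw [mul_left_comm]
      apply I.mem_MM1
      by_cases h : n + 1 - I.d i = 0
      · rw [h] at hf; rw [UU_zero hf, mul_zero]; exact Submodule.zero_mem _
      · have := hom_mul_mem_UU (LF_hom a) hf
        convert this using 2; omega
    · intro f hf
      exact I.mem_MM2 (hom_mul_mem_UU (LF_hom a) hf)
  exact this hf

lemma Pm_MM {n} (hn : 1 ≤ n) {m} (hm : wt I.d m < n + 1) : aeval I.P (monomial m (1:ℝ)) ∈ I.MM n := by
  by_cases h0 : m = 0
  · rw [h0]
    apply I.mem_MM2
    apply hom_mem_UU (e := 0) _ (by omega)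
    simpa using isHomogeneous_one (Fin r) ℝ
  · obtain ⟨i, hi⟩ : ∃ i, m i ≠ 0 := by
      by_contra hc; push Not at hc; exact h0 (Finsupp.ext hc)
    have e : m = Finsupp.single i 1 + (m - Finsupp.single i 1) := by
      rw [add_tsub_cancel_of_le]; rw [Finsupp.single_le_iff]; omega
    have hw : wt I.d m = I.d i + wt I.d (m - Finsupp.single i 1) := by
      conv_lhs => rw [e]
      unfold wt
      simp [add_mul, Finset.sum_add_distrib, Finsupp.single_apply]
    have : aeval I.P (monomial m (1:ℝ)) = I.P i * aeval I.P (monomial (m - Finsupp.single i 1) (1:ℝ)) := by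
      conv_lhs => rw [e, ← mul_one (1:ℝ), ← monomial_mul, map_mul]
      congr 1
      exact aeval_X _ _
    rw [this]
    apply I.mem_MM1
    exact hom_mem_UU (I.Pm_hom _) (by omega)

lemma claimC [Fintype G] {p} (hp : R.Reg p) : ∀ n, ∀ f ∈ UU r (n+1), (∀ g, eval (R.ρ g p) f = 0) →
    f ∈ I.MM n := by
  intro n
  induction n with
  | zero =>
    intro f hf h
    rw [mem_UU_succ_iff, Nat.le_zero, totalDegree_eq_zero_iff_eq_C] at hf
    have := h 1
    rw [hf, eval_C] at this
    rw [hf, this, map_zero]; exact Submodule.zero_mem _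
  | succ n ih =>
    intro f hf h
    have key : ∀ g, f - R.act g f ∈ I.MM (n+1) := by
      intro g
      have hg : g ∈ Subgroup.closure {s | R.Simple p s} := by rw [R.closure_simple hp]; trivial
      induction hg using Subgroup.closure_induction with
      | mem s hs =>
        obtain ⟨D, hD, hD1, hD2⟩ := R.demazure_UU hs.1 hf
        rw [hD1]
        apply I.LF_MM
        apply ih D hD
        intro g
        have := hD2 (R.ρ g p)
        rw [h, ← R.rho_mul, h, sub_zero, zero_eq_mul] at this
        exact this.resolve_left (R.reg_rho hp g s hs.1)
      | one => rw [R.act_one, sub_self]; exact Submodule.zero_mem _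
      | mul x y _ _ hx hy =>
        have : f - R.act (x * y) f = (f - R.act x f) + R.act x (f - R.act y f) := by
          rw [R.act_mul, map_sub]; ring
        rw [this]
        exact Submodule.add_mem _ hx (I.act_MM x hy)
      | inv x _ hx =>
        have : f - R.act x⁻¹ f = - R.act x⁻¹ (f - R.act x f) := by
          rw [map_sub, ← R.act_mul, inv_mul_cancel, R.act_one]; ring
        rw [this]
        exact Submodule.neg_mem _ (I.act_MM _ hx)
    have avg : ∑ g, R.act g f ∈ I.MM (n+1) := by
      have h1 := I.inv_mem (f := ∑ g, R.act g f) (n := n+2) (by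
        intro g
        rw [map_sum]
        simp_rw [← R.act_mul]
        exact Fintype.sum_equiv (Equiv.mulLeft g) _ _ (fun x => rfl))
        (Submodule.sum_mem _ fun g _ => R.act_UU g hf)
      refine Submodule.span_le.2 ?_ h1
      rintro _ ⟨m, hm, rfl⟩
      exact I.Pm_MM (by omega) hm
    have e : (Fintype.card G : ℝ) • f = ∑ g, (f - R.act g f) + ∑ g, R.act g f := by
      rw [← Finset.sum_add_distrib]; simp [← Nat.cast_smul_eq_nsmul ℝ]
    have h2 : (Fintype.card G : ℝ) • f ∈ I.MM (n+1) := by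
      rw [e]; exact Submodule.add_mem _ (Submodule.sum_mem _ fun g _ => key g) avg
    have h3 : (Fintype.card G : ℝ) ≠ 0 := by simp
    exact (Submodule.smul_mem_iff _ h3).1 h2

/-- The interpolation basis. -/
lemma exists_X [Fintype G] [DecidableEq G] {p} (hp : R.Reg p) (hp2 : ∀ g, R.ρ g p = p → g = 1) :
    ∃ X : G → MvPolynomial (Fin r) ℝ, (∀ g, X g ∈ UU r (R.sep p (R.ρ g p) + 1)) ∧
      ∀ g h, R.sep p (R.ρ h p) ≤ R.sep p (R.ρ g p) →
        eval (R.ρ h p) (X g) = if h = g then 1 else 0 := by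
  have := fun g => R.B3 hp hp2 (R.sep p (R.ρ g p) + 1) (fun h => if h = g then 1 else 0)
  choose X h1 h2 using this
  exact ⟨X, h1, fun g h hh => h2 g h (by omega)⟩

lemma span_X [Fintype G] [DecidableEq G] {p} {X : G → MvPolynomial (Fin r) ℝ}
    (hX : ∀ g h, R.sep p (R.ρ h p) ≤ R.sep p (R.ρ g p) →
        eval (R.ρ h p) (X g) = if h = g then 1 else 0) (f : MvPolynomial (Fin r) ℝ) :
    ∀ n, ∃ h ∈ Submodule.span ℝ (X '' {g | R.sep p (R.ρ g p) < n}),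
      ∀ v, R.sep p (R.ρ v p) < n → eval (R.ρ v p) (f - h) = 0 := by
  intro n
  induction n with
  | zero => exact ⟨0, Submodule.zero_mem _, fun v hv => absurd hv (by omega)⟩
  | succ n ih =>
    obtain ⟨h, h1, h2⟩ := ih
    refine ⟨h + ∑ g ∈ Finset.univ.filter (fun g => R.sep p (R.ρ g p) = n), eval (R.ρ g p) (f - h) • X g, ?_, ?_⟩
    · apply Submodule.add_mem
      · refine Submodule.span_mono ?_ h1
        apply Set.image_mono
        intro g hg
        exact Nat.lt_succ_of_lt hg
      · apply Submodule.sum_mem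
        intro g hg
        apply Submodule.smul_mem
        apply Submodule.subset_span
        refine ⟨g, ?_, rfl⟩
        have := (Finset.mem_filter.1 hg).2
        show R.sep p (R.ρ g p) < n + 1
        omega
    · intro v hv
      rw [← sub_sub, map_sub, map_sum]
      have e : ∀ g ∈ Finset.univ.filter (fun g => R.sep p (R.ρ g p) = n),
          eval (R.ρ v p) (eval (R.ρ g p) (f - h) • X g) = if v = g then eval (R.ρ v p) (f - h) else 0 := by
        intro g hg
        have := (Finset.mem_filter.1 hg).2
        rw [smul_eval, hX g v (by omega)]
        split_ifs with hvg
        · rw [hvg]; simp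
        · simp
      rw [Finset.sum_congr rfl e, Finset.sum_ite_eq]
      split_ifs with hm
      · simp
      · rw [sub_zero]; apply h2
        simp at hm; omega

lemma UU_span [Fintype G] [DecidableEq G] {p} (hp : R.Reg p) {X : G → MvPolynomial (Fin r) ℝ}
    (hX1 : ∀ g, X g ∈ UU r (R.sep p (R.ρ g p) + 1))
    (hX : ∀ g h, R.sep p (R.ρ h p) ≤ R.sep p (R.ρ g p) →
        eval (R.ρ h p) (X g) = if h = g then 1 else 0) : ∀ n,
    UU r n ≤ Submodule.span ℝ ((fun q : (Fin r →₀ ℕ) × G => aeval I.P (monomial q.1 (1:ℝ)) * X q.2) ''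
      {q | wt I.d q.1 + R.sep p (R.ρ q.2 p) < n}) := by
  intro n
  induction n using Nat.strong_induction_on with
  | _ n ih =>
    intro f hf
    rcases n with _ | n
    · rw [UU_zero hf]; exact Submodule.zero_mem _
    obtain ⟨h, h1, h2⟩ := span_X hX f (n+1)
    have h1' : h ∈ UU r (n+1) := by
      refine Submodule.span_le.2 ?_ h1
      rintro _ ⟨g, hg, rfl⟩
      exact UU_mono (by have : R.sep p (R.ρ g p) < n + 1 := hg; omega) (hX1 g)
    have h3 : f - h ∈ I.MM n :=
      I.claimC hp n _ (Submodule.sub_mem _ hf h1') (R.B1 hp (n+1) _ (Submodule.sub_mem _ hf h1') h2)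
    have e : f = (f - h) + h := by ring
    rw [e]
    apply Submodule.add_mem
    · refine I.MM_le ?_ ?_ h3
      · intro i f hf
        have hd := I.d_pos i
        have := ih (n + 1 - I.d i) (by omega) hf
        refine Submodule.span_induction ?_ ?_ ?_ ?_ this
        · rintro _ ⟨⟨m, g⟩, hm, rfl⟩
          apply Submodule.subset_span
          have hm : wt I.d m + R.sep p (R.ρ g p) < n + 1 - I.d i := hm
          refine ⟨(Finsupp.single i 1 + m, g), ?_, ?_⟩
          · show wt I.d (Finsupp.single i 1 + m) + R.sep p (R.ρ g p) < n + 1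
            have : wt I.d (Finsupp.single i 1 + m) = I.d i + wt I.d m := by
              unfold wt
              simp [add_mul, Finset.sum_add_distrib, Finsupp.single_apply]
            omega
          · dsimp only
            rw [← mul_assoc]; congr 1
            conv_lhs => rw [← mul_one (1:ℝ), ← monomial_mul, map_mul]
            congr 1
            exact aeval_X _ _
        · rw [mul_zero]; exact Submodule.zero_mem _
        · intro x y _ _ hx hy; rw [mul_add]; exact Submodule.add_mem _ hx hy
        · intro c x _ hx; rw [mul_smul_comm]; exact Submodule.smul_mem _ _ hx
      · refine (ih n (by omega)).trans (Submodule.span_mono (Set.image_mono ?_))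
        intro q hq
        exact Nat.lt_succ_of_lt hq
    · refine Submodule.span_mono ?_ h1
      rintro _ ⟨g, hg, rfl⟩
      refine ⟨(0, g), ?_, ?_⟩
      · show wt I.d 0 + R.sep p (R.ρ g p) < n + 1
        simpa [wt] using hg
      · simp

end RInv

end

section
open ENNReal in
lemma tsum_pow_wt (t : ℝ≥0∞) : ∀ (r : ℕ) (d : Fin r → ℕ),
    ∑' m : Fin r → ℕ, t ^ (∑ i, m i * d i) = ∏ i, ∑' j : ℕ, t ^ (j * d i) := by
  intro r
  induction r with
  | zero => intro d; simp
  | succ r ih =>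
    intro d
    rw [Fin.prod_univ_succ, ← ih, ← (Fin.consEquiv (fun _ => ℕ)).tsum_eq, ENNReal.tsum_prod',
      ← ENNReal.tsum_mul_right]
    congr 1; funext j
    rw [← ENNReal.tsum_mul_left]
    congr 1; funext m
    simp [Fin.consEquiv, Fin.sum_univ_succ, pow_add]

open ENNReal in
lemma tsum_pow_wt' (t : ℝ≥0∞) (r : ℕ) (d : Fin r → ℕ) :
    ∑' m : Fin r →₀ ℕ, t ^ (wt d m) = ∏ i, (1 - t ^ (d i))⁻¹ := by
  have := tsum_pow_wt t r d
  rw [← Finsupp.equivFunOnFinite.tsum_eq] at this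
  unfold wt
  simp only [Finsupp.equivFunOnFinite_apply] at this
  rw [this]
  apply Finset.prod_congr rfl
  intro i _
  rw [← ENNReal.tsum_geometric]
  congr 1; funext j
  rw [mul_comm, pow_mul]

open ENNReal in
lemma tsum_layer {A B : Type} (u : A → ℕ) (v : B → ℕ) (h : ∀ n, Nonempty ({a // u a < n} ≃ {b // v b < n}))
    (t : ℝ≥0∞) (ht : t < 1) : ∑' a, t ^ u a = ∑' b, t ^ v b := by
  have key : ∀ {A : Type} (u : A → ℕ), ∑' a, t ^ u a = (1 - t) * ∑' n, t ^ n * ∑' _ : {a // u a < n + 1}, (1:ℝ≥0∞) := by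
    intro A u
    have e1 : ∀ w : ℕ, t ^ w = (1 - t) * ∑' n, t ^ n * (if w < n + 1 then 1 else 0) := by
      intro w
      have h1 : ∑' n, t ^ n * (if w < n + 1 then (1:ℝ≥0∞) else 0) = ∑' n, t ^ (n + w) := by
        rw [← (add_left_injective w).tsum_eq]
        · congr 1; funext n; simp
        · intro n hn
          simp at hn
          exact ⟨n - w, by simp; omega⟩
      rw [h1]
      simp_rw [pow_add]
      rw [ENNReal.tsum_mul_right, ENNReal.tsum_geometric, ← mul_assoc, ENNReal.mul_inv_cancel, one_mul]
      · exact (tsub_pos_of_lt ht).ne'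
      · exact (tsub_le_self.trans_lt ENNReal.one_lt_top).ne
    conv_lhs => enter [1, a]; rw [e1]
    rw [ENNReal.tsum_mul_left, ENNReal.tsum_comm]
    congr 2; funext n
    rw [ENNReal.tsum_mul_left]
    congr 1
    refine Eq.trans ?_ (tsum_subtype {a | u a < n + 1} (fun _ => (1:ℝ≥0∞))).symm
    congr 1; funext a
    simp [Set.indicator_apply]
  rw [key, key]
  congr 2; funext n
  congr 1
  obtain ⟨e⟩ := h (n+1)
  exact e.tsum_eq (fun _ => (1:ℝ≥0∞))

namespace RInv
variable {r : ℕ} {G : Type} [Group G] {R : RS r G} (I : RInv R)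

lemma indep_X [Fintype G] [DecidableEq G] {p} {X : G → MvPolynomial (Fin r) ℝ}
    (hX : ∀ g h, R.sep p (R.ρ h p) ≤ R.sep p (R.ρ g p) →
        eval (R.ρ h p) (X g) = if h = g then 1 else 0) (h : G → MvPolynomial (Fin r) ℝ)
    (hh : ∀ v g, R.act v (h g) = h g) (h0 : ∑ g, h g * X g = 0) : h = 0 := by
  let M : Matrix G G (MvPolynomial (Fin r) ℝ) := fun v g => R.act v⁻¹ (X g)
  have hdet : M.det ≠ 0 := by
    intro hd
    have h1 : ((eval p).mapMatrix M).det = 0 := by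
      rw [← RingHom.map_det, hd, map_zero]
    obtain ⟨c, hc, hc2⟩ := Matrix.exists_mulVec_eq_zero_iff.2 h1
    apply hc
    have : ∀ n v, R.sep p (R.ρ v p) = n → c v = 0 := by
      intro n
      induction n using Nat.strong_induction_on with
      | _ n ih =>
        intro v hv
        have h3 : ∑ g, eval p (R.act v⁻¹ (X g)) * c g = 0 := congrFun hc2 v
        simp only [R.eval_act, inv_inv] at h3
        rw [Finset.sum_eq_single v] at h3
        · rw [hX v v le_rfl] at h3; simpa using h3
        · intro g _ hg
          rcases lt_or_ge (R.sep p (R.ρ g p)) n with hl | hl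
          · rw [ih _ hl g rfl, mul_zero]
          · rw [hX g v (by omega), if_neg hg.symm, zero_mul]
        · simp
    funext v; exact this _ v rfl
  refine Matrix.eq_zero_of_mulVec_eq_zero hdet ?_
  funext v
  have := congrArg (R.act v⁻¹) h0
  rw [map_sum, map_zero] at this
  simp only [Matrix.mulVec, dotProduct, Pi.zero_apply, M]
  rw [← this]
  apply Finset.sum_congr rfl
  intro g _
  rw [map_mul, hh, mul_comm]

lemma linInd [Fintype G] [DecidableEq G] {p} {X : G → MvPolynomial (Fin r) ℝ}
    (hX : ∀ g h, R.sep p (R.ρ h p) ≤ R.sep p (R.ρ g p) →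
        eval (R.ρ h p) (X g) = if h = g then 1 else 0) :
    LinearIndependent ℝ (fun q : (Fin r →₀ ℕ) × G => aeval I.P (monomial q.1 (1:ℝ)) * X q.2) := by
  classical
  rw [linearIndependent_iff']
  intro s c hc q hq
  let F : G → MvPolynomial (Fin r) ℝ := fun g => ∑ q ∈ s, if q.2 = g then monomial q.1 (c q) else 0
  have h1 : (fun g => aeval I.P (F g)) = 0 := by
    apply indep_X hX
    · intro v g; exact I.act_aeval v _
    · rw [← hc]
      simp only [F, map_sum, Finset.sum_mul]
      rw [Finset.sum_comm]
      apply Finset.sum_congr rfl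
      intro q _
      rw [Finset.sum_eq_single q.2]
      · have : monomial q.1 (c q) = c q • monomial q.1 (1:ℝ) := by simp [smul_monomial]
        rw [if_pos rfl, this, map_smul, smul_mul_assoc]
      · intro g _ hg; rw [if_neg hg.symm, map_zero, zero_mul]
      · simp
  have h2 := I.alg
  rw [algebraicIndependent_iff_injective_aeval] at h2
  have h3 : F q.2 = 0 := h2 (by rw [map_zero]; exact congrFun h1 q.2)
  have h4 := congrArg (coeff q.1) h3
  simp only [F, coeff_sum, coeff_zero] at h4
  rw [Finset.sum_eq_single q] at h4
  · simpa using h4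
  · intro q' _ hne
    split_ifs with he
    · rw [coeff_monomial, if_neg]
      intro h; exact hne (Prod.ext h he)
    · simp
  · intro h; exact absurd hq h

lemma count [Fintype G] [DecidableEq G] {p} (hp : R.Reg p) (hp2 : ∀ g, R.ρ g p = p → g = 1) (n : ℕ) :
    Nonempty ({m : Fin r →₀ ℕ // wt (fun _ => 1) m < n} ≃
      {q : (Fin r →₀ ℕ) × G // wt I.d q.1 + R.sep p (R.ρ q.2 p) < n}) := by
  obtain ⟨X, hX1, hX⟩ := exists_X hp hp2
  have li := (I.linInd hX).comp (Subtype.val : {q : (Fin r →₀ ℕ) × G // wt I.d q.1 + R.sep p (R.ρ q.2 p) < n} → _) Subtype.val_injective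
  have hs : Submodule.span ℝ (Set.range ((fun q : (Fin r →₀ ℕ) × G => aeval I.P (monomial q.1 (1:ℝ)) * X q.2) ∘ 
      (Subtype.val : {q : (Fin r →₀ ℕ) × G // wt I.d q.1 + R.sep p (R.ρ q.2 p) < n} → _))) = UU r n := by
    apply le_antisymm
    · rw [Submodule.span_le]
      rintro _ ⟨⟨⟨m, g⟩, hq⟩, rfl⟩
      exact UU_mono (by dsimp only at hq; omega) (hom_mul_mem_UU (I.Pm_hom m) (hX1 g))
    · have := I.UU_span hp hX1 hX n
      rw [Set.range_comp]
      refine this.trans (le_of_eq ?_)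
      congr 2
      exact Subtype.range_val.symm
  have b2 := (Module.Basis.span li).map (LinearEquiv.ofEq _ _ hs)
  have b1 : Module.Basis {m : Fin r →₀ ℕ | m.degree < n} ℝ (UU r n) := basisRestrictSupport ℝ _
  have e : ∀ m : Fin r →₀ ℕ, wt (fun _ => 1) m < n ↔ m ∈ {m : Fin r →₀ ℕ | m.degree < n} := by
    intro m
    simp [wt, Finsupp.degree_eq_sum]
  exact ⟨(Equiv.subtypeEquivRight e).trans (b1.indexEquiv b2)⟩

lemma poincare_real [Fintype G] {p} (hp : R.Reg p) (hp2 : ∀ g, R.ρ g p = p → g = 1) (x : ℝ)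
    (h0 : 0 < x) (h1 : x < 1) :
    (∑ g, x ^ (R.sep p (R.ρ g p))) * (1 - x) ^ r = ∏ i, (1 - x ^ (I.d i)) := by
  classical
  have ht : ENNReal.ofReal x < 1 := by rw [← ENNReal.ofReal_one]; exact (ENNReal.ofReal_lt_ofReal_iff one_pos).2 h1
  have := tsum_layer _ _ (I.count hp hp2) (ENNReal.ofReal x) ht
  rw [tsum_pow_wt', ENNReal.tsum_prod'] at this
  simp_rw [pow_add] at this
  simp_rw [ENNReal.tsum_mul_left] at this
  rw [ENNReal.tsum_mul_right, tsum_pow_wt', tsum_fintype] at this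
  have h2 := congrArg ENNReal.toReal this
  have hp : ∀ n, ENNReal.ofReal x ^ n = ENNReal.ofReal (x ^ n) := fun n => (ENNReal.ofReal_pow h0.le n).symm
  have hsub : ∀ n, (1 - ENNReal.ofReal x ^ n)⁻¹.toReal = (1 - x ^ n)⁻¹ := by
    intro n
    rw [hp, ENNReal.toReal_inv, ← ENNReal.ofReal_one, ← ENNReal.ofReal_sub _ (by positivity), ENNReal.toReal_ofReal]
    linarith [pow_le_one₀ (n := n) h0.le h1.le]
  rw [ENNReal.toReal_mul, ENNReal.toReal_prod, ENNReal.toReal_prod, ENNReal.toReal_sum] at h2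
  · simp only [hsub] at h2
    simp only [hp] at h2
    simp_rw [ENNReal.toReal_ofReal (pow_nonneg h0.le _)] at h2
    rw [Finset.prod_const, Finset.card_univ, Fintype.card_fin, pow_one, Finset.prod_inv_distrib] at h2
    have n1 : (1 - x) ^ r ≠ 0 := pow_ne_zero _ (by linarith)
    have n2 : ∏ i, (1 - x ^ I.d i) ≠ 0 := by
      rw [Finset.prod_ne_zero_iff]; intro i _
      have := pow_lt_one₀ h0.le h1 (n := I.d i) (by have := I.d_pos i; omega)
      linarith
    rw [inv_pow] at h2
    field_simp at h2
    linarith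
  · intro g _; rw [hp]; exact ENNReal.ofReal_ne_top

lemma poincare_poly [Fintype G] {p} (hp : R.Reg p) (hp2 : ∀ g, R.ρ g p = p → g = 1) :
    (∑ g, (Polynomial.X : Polynomial ℝ) ^ (R.sep p (R.ρ g p))) * (1 - Polynomial.X) ^ r = ∏ i, (1 - Polynomial.X ^ (I.d i)) := by
  apply Polynomial.eq_of_infinite_eval_eq
  apply Set.Infinite.mono (s := Set.Ioo 0 1)
  · intro x hx
    have := I.poincare_real hp hp2 x hx.1 hx.2
    simp [Polynomial.eval_finsetSum, Polynomial.eval_prod, this]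
  · exact Set.Ioo_infinite one_pos

lemma poincare [Fintype G] {p} (hp : R.Reg p) (hp2 : ∀ g, R.ρ g p = p → g = 1) (q : ℂ) :
    (∑ g, q ^ (R.sep p (R.ρ g p))) * (1 - q) ^ r = ∏ i, (1 - q ^ (I.d i)) := by
  have := congrArg (Polynomial.aeval q) (I.poincare_poly hp hp2)
  simpa using this

lemma sum_d [Fintype G] {p} (hp : R.Reg p) (hp2 : ∀ g, R.ρ g p = p → g = 1) :
    R.S.card + r = ∑ i, I.d i := by
  have h := congrArg Polynomial.natDegree (I.poincare_poly hp hp2)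
  have n1 : ∀ n : ℕ, 1 ≤ n → (1 - Polynomial.X ^ n : Polynomial ℝ).natDegree = n := by
    intro n hn
    rw [← Polynomial.natDegree_neg, neg_sub]
    exact Polynomial.natDegree_X_pow_sub_C (n := n) (r := (1:ℝ))
  have n0 : ∀ n : ℕ, 1 ≤ n → (1 - Polynomial.X ^ n : Polynomial ℝ) ≠ 0 := by
    intro n hn h
    have := n1 n hn
    rw [h] at this; simp at this; omega
  have nz : (∑ g, (Polynomial.X : Polynomial ℝ) ^ (R.sep p (R.ρ g p))).natDegree = R.S.card := by
    apply le_antisymm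
    · apply Polynomial.natDegree_sum_le_of_forall_le
      intro g _
      rw [Polynomial.natDegree_X_pow]; exact R.sep_le _ _
    · obtain ⟨w, hw⟩ := R.exists_long hp
      apply Polynomial.le_natDegree_of_ne_zero
      rw [Polynomial.finsetSum_coeff]
      simp_rw [Polynomial.coeff_X_pow]
      have : (0:ℝ) < ∑ g, if R.S.card = R.sep p (R.ρ g p) then 1 else 0 := by
        apply Finset.sum_pos'
        · intro g _; split_ifs <;> norm_num
        · exact ⟨w, Finset.mem_univ _, by rw [hw]; simp⟩
      exact this.ne'
  have e1 : (1 - Polynomial.X : Polynomial ℝ) = 1 - Polynomial.X ^ 1 := by rw [pow_one]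
  rw [Polynomial.natDegree_prod _ _ (fun i _ => n0 _ (I.d_pos i))] at h
  simp_rw [n1 _ (I.d_pos _)] at h
  rw [Polynomial.natDegree_mul, Polynomial.natDegree_pow, e1, n1 1 le_rfl, mul_one, nz] at h
  · exact h
  · intro h0; rw [h0] at nz
    have := congrArg (Polynomial.eval 1) h0
    simp [Polynomial.eval_finsetSum] at this
  · exact pow_ne_zero _ (by rw [e1]; exact n0 1 le_rfl)

end RInv

lemma RS.sep_eq_of_zero {r : ℕ} {G : Type} [Group G] (R : RS r G) {p y} (hp : R.Reg p) (hy : R.Reg y)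
    (h : R.sep p y = 0) (z) : R.sep p z = R.sep y z := by
  classical
  unfold RS.sep at *
  rw [Finset.card_eq_zero, Finset.filter_eq_empty_iff] at h
  congr 1
  apply Finset.filter_congr
  intro s hs
  have h1 := h hs
  have h2 := hp s hs
  have h3 := hy s hs
  have h4 : 0 < (R.α s ⬝ᵥ p) * (R.α s ⬝ᵥ y) := lt_of_le_of_ne (not_lt.1 h1) (mul_ne_zero h2 h3).symm
  generalize R.α s ⬝ᵥ p = a at *
  generalize R.α s ⬝ᵥ y = b at *
  generalize R.α s ⬝ᵥ z = c at *
  rcases lt_or_gt_of_ne h2 with ha | ha <;> rcases lt_or_gt_of_ne h3 with hb | hb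
  · constructor <;> intro _ <;> by_contra hc <;> nlinarith
  · nlinarith
  · nlinarith
  · constructor <;> intro _ <;> by_contra hc <;> nlinarith

/-- Chamber independence of the length generating function. -/
lemma RS.sum_sep {r : ℕ} {G : Type} [Group G] [Fintype G] (R : RS r G) {p y z} (hp : R.Reg p) (hy : R.Reg y) (hz : R.Reg z)
    (φ : ℕ → ℂ) : ∑ g, φ (R.sep y (R.ρ g z)) = ∑ g, φ (R.sep p (R.ρ g p)) := by
  have key : ∀ y z, R.Reg y → R.Reg z → ∑ g, φ (R.sep y (R.ρ g z)) = ∑ g, φ (R.sep y (R.ρ g y)) := by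
    intro y z hy hz
    obtain ⟨h, hh⟩ := R.exists_sep_zero hy _ z hz rfl
    rw [← Equiv.sum_comp (Equiv.mulRight h)]
    apply Finset.sum_congr rfl
    intro g _
    simp only [Equiv.coe_mulRight]
    congr 1
    rw [R.rho_mul, ← R.sep_rho g⁻¹, R.rho_inv_self, R.sep_comm, ← R.sep_eq_of_zero hy (R.reg_rho hz h) hh,
      ← R.sep_rho g, R.rho_self_inv, R.sep_comm]
  have sw : ∀ y z, ∑ g, φ (R.sep y (R.ρ g z)) = ∑ g, φ (R.sep z (R.ρ g y)) := by
    intro y z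
    rw [← Equiv.sum_comp (Equiv.inv G)]
    apply Finset.sum_congr rfl
    intro g _
    congr 1
    rw [← R.sep_rho g]
    simp only [Equiv.inv_apply]
    rw [R.rho_self_inv, R.sep_comm]
  rw [key y z hy hz, ← key y p hy hp, sw, key p y hp hy]

end

section
lemma diff_param {X : Type*} [MeasurableSpace X] {μ : Measure X} {f : ℂ → X → ℂ} {z0 : ℂ} {ρ : ℝ}
    (hρ : 0 < ρ) {bound : X → ℝ}
    (hmeas : ∀ z ∈ Metric.ball z0 ρ, AEStronglyMeasurable (f z) μ)
    (hd : ∀ᵐ x ∂μ, DifferentiableOn ℂ (fun z => f z x) (Metric.ball z0 ρ))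
    (hb : ∀ᵐ x ∂μ, ∀ z ∈ Metric.ball z0 ρ, ‖f z x‖ ≤ bound x)
    (hint : Integrable bound μ) : DifferentiableAt ℂ (fun z => ∫ x, f z x ∂μ) z0 := by
  have hsub : ∀ z ∈ Metric.ball z0 (ρ/2), Metric.closedBall z (ρ/4) ⊆ Metric.ball z0 ρ := by
    intro z hz w hw
    rw [Metric.mem_ball] at hz ⊢
    rw [Metric.mem_closedBall] at hw
    have := dist_triangle w z z0
    linarith
  have hmem0 : z0 ∈ Metric.ball z0 ρ := Metric.mem_ball_self hρ
  refine (hasDerivAt_integral_of_dominated_loc_of_deriv_le (s := Metric.ball z0 (ρ/2))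
    (bound := fun x => bound x / (ρ/4)) (F' := fun z x => deriv (fun w => f w x) z)
    (Metric.ball_mem_nhds _ (by positivity)) ?_ ?_ ?_ ?_ (hint.div_const _) ?_).2.differentiableAt
  · filter_upwards [Metric.ball_mem_nhds z0 hρ] with z hz using hmeas z hz
  · refine hint.mono' (hmeas z0 hmem0) ?_
    filter_upwards [hb] with x hx using hx z0 hmem0
  · set u : ℕ → ℂ := fun n => ((ρ/2 * (1/((n:ℝ)+1)) : ℝ) : ℂ) with hu
    have hun : ∀ n, u n ≠ 0 := by
      intro n; rw [hu]
      simp only [ne_eq, Complex.ofReal_eq_zero]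
      positivity
    have hut : Filter.Tendsto u Filter.atTop (nhdsWithin 0 {0}ᶜ) := by
      rw [tendsto_nhdsWithin_iff]
      refine ⟨?_, Filter.Eventually.of_forall fun n => hun n⟩
      have := (tendsto_one_div_add_atTop_nhds_zero_nat (𝕜 := ℝ)).const_mul (ρ/2)
      rw [mul_zero] at this
      have h2 := (Complex.continuous_ofReal.tendsto 0).comp this
      rw [Complex.ofReal_zero] at h2
      exact h2
    have hub : ∀ n, z0 + u n ∈ Metric.ball z0 ρ := by
      intro n
      rw [Metric.mem_ball, dist_eq_norm, add_sub_cancel_left, hu]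
      simp only [Complex.norm_real]
      rw [Real.norm_of_nonneg (by positivity)]
      have : 1/((n:ℝ)+1) ≤ 1 := by
        rw [div_le_one (by positivity)]; linarith [n.cast_nonneg (α := ℝ)]
      nlinarith
    refine aestronglyMeasurable_of_tendsto_ae (u := Filter.atTop)
      (f := fun (n:ℕ) x => (u n)⁻¹ • (f (z0 + u n) x - f z0 x)) ?_ ?_
    · intro n
      exact ((hmeas _ (hub n)).sub (hmeas _ hmem0)).const_smul (u n)⁻¹
    · filter_upwards [hd] with x hx
      have h1 : HasDerivAt (fun w => f w x) (deriv (fun w => f w x) z0) z0 :=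
        ((hx z0 hmem0).differentiableAt (Metric.ball_mem_nhds z0 hρ)).hasDerivAt
      exact (hasDerivAt_iff_tendsto_slope_zero.1 h1).comp hut
  · filter_upwards [hd, hb] with x hx hbx z hz
    apply Complex.norm_deriv_le_of_forall_mem_sphere_norm_le (by positivity)
    · exact DifferentiableOn.diffContOnCl (by
        rw [closure_ball _ (by positivity)]
        exact hx.mono (hsub z hz))
    · intro w hw
      exact hbx w (hsub z hz (Metric.sphere_subset_closedBall hw))
  · filter_upwards [hd] with x hx z hz
    refine ((hx z ?_).differentiableAt ?_).hasDerivAt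
    · exact Metric.ball_subset_ball (by linarith) hz
    · exact Metric.isOpen_ball.mem_nhds (Metric.ball_subset_ball (by linarith) hz)

lemma int1 (C : ℝ) {b : ℝ} (hb : 0 < b) : Integrable (fun t : ℝ => Real.exp (C * |t| - b * (t * t))) := by
  have h := (integrable_exp_neg_mul_sq (half_pos hb)).const_mul (Real.exp (C^2/(2*b)))
  refine h.mono' (by fun_prop) (Filter.Eventually.of_forall fun t => ?_)
  rw [Real.norm_of_nonneg (Real.exp_pos _).le, ← Real.exp_add, Real.exp_le_exp]
  have h1 : 0 ≤ (b * |t| - C)^2 / (2*b) := by positivity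
  have h2 : (b * |t| - C)^2 / (2*b) = b/2 * |t|^2 - C * |t| + C^2/(2*b) := by field_simp; ring
  rw [sq_abs] at h2
  nlinarith

lemma int_gauss {r : ℕ} (C : ℝ) {b : ℝ} (hb : 0 < b) :
    Integrable (fun y : Fin r → ℝ => Real.exp (C * ∑ i, |y i| - b * (y ⬝ᵥ y))) := by
  have := Integrable.fintype_prod (ι := Fin r) (μ := fun _ => (volume : Measure ℝ)) (f := fun _ t => Real.exp (C * |t| - b * (t * t)))
    (fun _ => int1 C hb)
  refine this.congr (Filter.Eventually.of_forall fun y => ?_)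
  simp only [← Real.exp_sum, Finset.sum_sub_distrib, ← Finset.mul_sum, dotProduct]

lemma int_gauss' {r : ℕ} (C D : ℝ) {b : ℝ} (hb : 0 < b) :
    Integrable (fun y : Fin r → ℝ => Real.exp (D + C * ∑ i, |y i| - b * (y ⬝ᵥ y))) := by
  refine ((int_gauss (r := r) C hb).const_mul (Real.exp D)).congr (Filter.Eventually.of_forall fun y => ?_)
  simp only [← Real.exp_add]; congr 1; ring

lemma gauss_int {r : ℕ} : ∫ y : Fin r → ℝ, Real.exp (-(y ⬝ᵥ y) / 2) = (2 * Real.pi) ^ ((r:ℝ)/2) := by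
  have := integral_fintype_prod_volume_eq_prod (ι := Fin r) (f := fun _ (t:ℝ) => Real.exp (-(1/2) * t^2))
  have h2 : ∀ y : Fin r → ℝ, Real.exp (-(y ⬝ᵥ y) / 2) = ∏ i, Real.exp (-(1/2) * (y i)^2) := by
    intro y
    rw [← Real.exp_sum, ← Finset.mul_sum, dotProduct]
    congr 1
    have : ∀ i, y i * y i = y i ^ 2 := fun i => by ring
    simp only [this]; ring
  simp only [h2]
  rw [this, Finset.prod_const, integral_gaussian]
  rw [Real.sqrt_eq_rpow, ← Real.rpow_natCast, ← Real.rpow_mul (by positivity)]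
  simp only [Finset.card_univ, Fintype.card_fin]
  congr 1 <;> ring

lemma gauss_int_c {r : ℕ} (c : Fin r → ℝ) : ∫ y : Fin r → ℝ, Real.exp (-((y - c) ⬝ᵥ (y - c)) / 2) = (2 * Real.pi) ^ ((r:ℝ)/2) := by
  rw [← gauss_int]
  exact integral_sub_right_eq_self (fun y : Fin r → ℝ => Real.exp (-(y ⬝ᵥ y) / 2)) c

lemma gauss_integrable_c {r : ℕ} (c : Fin r → ℝ) : Integrable fun y : Fin r → ℝ => Real.exp (-((y - c) ⬝ᵥ (y - c)) / 2) := by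
  have h : Integrable fun y : Fin r → ℝ => Real.exp (-(y ⬝ᵥ y) / 2) := by
    refine (int_gauss (r := r) 0 (b := 1/2) (by norm_num)).congr (Filter.Eventually.of_forall fun y => ?_)
    simp only []; congr 1; ring
  exact h.comp_sub_right c

lemma orth_mp {r : ℕ} (f : (Fin r → ℝ) →ₗ[ℝ] (Fin r → ℝ)) (hf : ∀ x y, f x ⬝ᵥ f y = x ⬝ᵥ y) :
    Measure.map f volume = volume ∧ |LinearMap.det f| = 1 := by
  have h1 : (LinearMap.toMatrix' f).transpose * LinearMap.toMatrix' f = 1 := by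
    ext i j
    have h := hf (Pi.single i 1) (Pi.single j 1)
    rw [Matrix.mul_apply]
    simp only [Matrix.transpose_apply, LinearMap.toMatrix'_apply]
    rw [single_one_dotProduct] at h
    rw [Matrix.one_apply]
    have e : ∀ t : Fin r, (fun j' => if j' = t then (1:ℝ) else 0) = Pi.single t 1 := by
      intro t; ext j'; simp [Pi.single_apply]
    first | simp only [e] | skip
    refine Eq.trans h ?_
    simp [Pi.single_apply]
  have h2 : LinearMap.det f * LinearMap.det f = 1 := by
    rw [← LinearMap.det_toMatrix']
    have := congrArg Matrix.det h1
    rwa [Matrix.det_mul, Matrix.det_transpose, Matrix.det_one] at this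
  have h3 : |LinearMap.det f| = 1 := by
    have : |LinearMap.det f| * |LinearMap.det f| = 1 := by rw [← abs_mul, h2, abs_one]
    nlinarith [abs_nonneg (LinearMap.det f)]
  refine ⟨?_, h3⟩
  rw [Real.map_linearMap_volume_pi_eq_smul_volume_pi (by intro h; rw [h] at h2; norm_num at h2), abs_inv, h3]
  simp

lemma orth_integral {r : ℕ} {E : Type*} [NormedAddCommGroup E] [NormedSpace ℝ E] (f : (Fin r → ℝ) →ₗ[ℝ] (Fin r → ℝ)) (hf : ∀ x y, f x ⬝ᵥ f y = x ⬝ᵥ y)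
    (φ : (Fin r → ℝ) → E) : ∫ x, φ (f x) = ∫ x, φ x := by
  have hinj : Function.Injective f := by
    rw [← LinearMap.ker_eq_bot, LinearMap.ker_eq_bot']
    intro x hx
    have := hf x x
    rw [hx, zero_dotProduct] at this
    exact dotProduct_self_eq_zero.1 this.symm
  have hemb : MeasurableEmbedding f := by
    have : Continuous f := f.continuous_of_finiteDimensional
    exact this.measurableEmbedding hinj
  conv_rhs => rw [← (orth_mp f hf).1]
  rw [hemb.integral_map]

lemma ae_ne_zero {r : ℕ} {a : Fin r → ℝ} (ha : a ≠ 0) : ∀ᵐ x : Fin r → ℝ, a ⬝ᵥ x ≠ 0 := by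
  let L : (Fin r → ℝ) →ₗ[ℝ] ℝ := dotProductBilin ℝ ℝ a
  have h := Measure.addHaar_submodule (volume : Measure (Fin r → ℝ)) (LinearMap.ker L) (by
    intro h
    have : a ∈ LinearMap.ker L := by rw [h]; trivial
    have h2 : a ⬝ᵥ a = 0 := this
    exact ha (dotProduct_self_eq_zero.1 h2))
  rw [← compl_mem_ae_iff] at h
  filter_upwards [h] with x hx hx2
  exact hx hx2

end

section
lemma abs_dot_le {r : ℕ} (a y : Fin r → ℝ) : |a ⬝ᵥ y| ≤ (∑ i, |a i|) * ∑ i, |y i| := by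
  rw [dotProduct, Finset.sum_mul]
  refine (Finset.abs_sum_le_sum_abs _ _).trans (Finset.sum_le_sum fun i _ => ?_)
  rw [abs_mul]
  exact mul_le_mul_of_nonneg_left (Finset.single_le_sum (f := fun i => |y i|) (fun j _ => abs_nonneg _) (Finset.mem_univ i)) (abs_nonneg _)

lemma norm_clog_le {w : ℂ} {c : ℝ} (hc : 0 < c) (hw : c ≤ ‖w‖) : ‖Complex.log w‖ ≤ |Real.log c| + ‖w‖ + Real.pi := by
  have h1 : Complex.log w = (Real.log ‖w‖ : ℝ) + (Complex.arg w : ℝ) * Complex.I := rfl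
  rw [h1]
  refine (norm_add_le _ _).trans ?_
  rw [norm_mul, Complex.norm_I, mul_one, Complex.norm_real, Complex.norm_real, Real.norm_eq_abs, Real.norm_eq_abs]
  have h2 := Complex.abs_arg_le_pi w
  have h3 : |Real.log ‖w‖| ≤ |Real.log c| + ‖w‖ := by
    rw [abs_le]
    have := Real.log_le_log hc hw
    have h4 := Real.log_le_self (norm_nonneg w)
    have h5 := neg_abs_le (Real.log c)
    have h6 := norm_nonneg w
    have h7 := abs_nonneg (Real.log c)
    constructor <;> linarith
  linarith

section
variable {r : ℕ} {ι : Type} (S : Finset ι) (β : ι → Fin r → ℝ) (y0 : Fin r → ℝ)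

def ew (τ : ℂ) (s : ι) (y : Fin r → ℝ) : ℂ := τ * ((β s ⬝ᵥ y0 : ℝ) : ℂ) + Complex.I * ((β s ⬝ᵥ y : ℝ) : ℂ)

def erest (k τ : ℂ) (y : Fin r → ℝ) : ℂ :=
  τ ^ 2 * ((y0 ⬝ᵥ y0 : ℝ) : ℂ) / 2 + Complex.I * τ * ((y0 ⬝ᵥ y : ℝ) : ℂ) + 2 * k * ∑ s ∈ S, Complex.log (ew β y0 τ s y)

def eint (k τ : ℂ) (y : Fin r → ℝ) : ℂ := Complex.exp (erest S β y0 k τ y - ((y ⬝ᵥ y / 2 : ℝ) : ℂ))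

lemma ew_re (τ : ℂ) (s : ι) (y) : (ew β y0 τ s y).re = τ.re * (β s ⬝ᵥ y0) := by
  simp [ew]

lemma ew_norm (τ : ℂ) (s : ι) (y) : ‖ew β y0 τ s y‖ ≤ ‖τ‖ * |β s ⬝ᵥ y0| + |β s ⬝ᵥ y| := by
  unfold ew
  refine (norm_add_le _ _).trans ?_
  simp only [norm_mul, Complex.norm_I, one_mul, Complex.norm_real, Real.norm_eq_abs]
  exact le_rfl

lemma eint_meas (k τ : ℂ) : Measurable (eint S β y0 k τ) := by
  have hd : ∀ a : Fin r → ℝ, Continuous fun y : Fin r → ℝ => a ⬝ᵥ y := fun a => by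
    unfold dotProduct; fun_prop
  have hd2 : Continuous fun y : Fin r → ℝ => y ⬝ᵥ y := by
    unfold dotProduct; fun_prop
  have hm : ∀ a : Fin r → ℝ, Measurable fun y : Fin r → ℝ => (((a ⬝ᵥ y : ℝ)) : ℂ) := fun a =>
    (Complex.continuous_ofReal.comp (hd a)).measurable
  have hm2 : Measurable fun y : Fin r → ℝ => ((((y ⬝ᵥ y) / 2 : ℝ)) : ℂ) :=
    (Complex.continuous_ofReal.comp (hd2.div_const 2)).measurable
  unfold eint erest ew
  apply Complex.measurable_exp.comp
  apply Measurable.sub _ hm2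
  apply Measurable.add
  · exact ((hm _).const_mul _).const_add _
  · apply Measurable.const_mul
    apply Finset.measurable_sum
    intro s _
    exact Complex.measurable_log.comp (((hm _).const_mul _).const_add _)

/-- uniform domination -/
lemma eint_bound (hb : ∀ s ∈ S, 0 < β s ⬝ᵥ y0) {t0 : ℝ} (ht0 : 0 < t0) (T K : ℝ) (hT : 0 ≤ T) (hK : 0 ≤ K) :
    ∃ D C : ℝ, ∀ k τ : ℂ, ‖k‖ ≤ K → ‖τ‖ ≤ T → t0 ≤ τ.re → ∀ y, 
      ‖eint S β y0 k τ y‖ ≤ Real.exp (D + C * ∑ i, |y i| - (1/2) * (y ⬝ᵥ y)) := by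
  refine ⟨T^2 * (y0 ⬝ᵥ y0)/2 + 2*K*∑ s ∈ S, (|Real.log (t0 * (β s ⬝ᵥ y0))| + T * |β s ⬝ᵥ y0| + Real.pi),
    T * (∑ i, |y0 i|) + 2*K*∑ s ∈ S, ∑ i, |β s i|, ?_⟩
  intro k τ hk hτ hre y
  unfold eint
  rw [Complex.norm_exp, Real.exp_le_exp, Complex.sub_re, Complex.ofReal_re]
  have h1 := Complex.re_le_norm (erest S β y0 k τ y)
  suffices h : ‖erest S β y0 k τ y‖ ≤ T^2 * (y0 ⬝ᵥ y0)/2 + 2*K*∑ s ∈ S, (|Real.log (t0 * (β s ⬝ᵥ y0))| + T * |β s ⬝ᵥ y0| + Real.pi) + 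
      (T * (∑ i, |y0 i|) + 2*K*∑ s ∈ S, ∑ i, |β s i|) * ∑ i, |y i| by linarith
  set n := ∑ i, |y i| with hn
  have hn0 : 0 ≤ n := Finset.sum_nonneg fun i _ => abs_nonneg _
  have h2 : ‖∑ s ∈ S, Complex.log (ew β y0 τ s y)‖ ≤ ∑ s ∈ S, ((|Real.log (t0 * (β s ⬝ᵥ y0))| + T * |β s ⬝ᵥ y0| + Real.pi) + (∑ i, |β s i|) * n) := by
    refine (norm_sum_le _ _).trans (Finset.sum_le_sum fun s hs => ?_)
    have hbs := hb s hs
    refine (norm_clog_le (c := t0 * (β s ⬝ᵥ y0)) (by positivity) ?_).trans ?_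
    · refine le_trans ?_ (Complex.re_le_norm _)
      rw [ew_re]
      exact mul_le_mul_of_nonneg_right hre hbs.le
    · have h3 := ew_norm β y0 τ s y
      have h4 := abs_dot_le (β s) y
      have h5 : ‖τ‖ * |β s ⬝ᵥ y0| ≤ T * |β s ⬝ᵥ y0| := mul_le_mul_of_nonneg_right hτ (abs_nonneg _)
      linarith
  rw [Finset.sum_add_distrib, ← Finset.sum_mul] at h2
  have h6 : ‖τ ^ 2 * ((y0 ⬝ᵥ y0 : ℝ) : ℂ) / 2‖ ≤ T^2 * (y0 ⬝ᵥ y0)/2 := by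
    rw [norm_div, norm_mul, norm_pow, Complex.norm_real, Real.norm_of_nonneg (dot_self_nonneg _)]
    have : ‖τ‖^2 ≤ T^2 := pow_le_pow_left₀ (norm_nonneg _) hτ 2
    have h7 := dot_self_nonneg y0
    simp only [Complex.norm_ofNat]
    gcongr
  have h7 : ‖Complex.I * τ * ((y0 ⬝ᵥ y : ℝ) : ℂ)‖ ≤ T * ((∑ i, |y0 i|) * n) := by
    rw [norm_mul, norm_mul, Complex.norm_I, one_mul, Complex.norm_real, Real.norm_eq_abs]
    exact mul_le_mul hτ (abs_dot_le _ _) (abs_nonneg _) hT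
  have h8 : ‖2 * k * ∑ s ∈ S, Complex.log (ew β y0 τ s y)‖ ≤ 2 * K * ((∑ s ∈ S, (|Real.log (t0 * (β s ⬝ᵥ y0))| + T * |β s ⬝ᵥ y0| + Real.pi)) + (∑ s ∈ S, ∑ i, |β s i|) * n) := by
    rw [norm_mul, norm_mul, Complex.norm_ofNat]
    exact mul_le_mul (by linarith) h2 (norm_nonneg _) (by positivity)
  have h9 := norm_add₃_le (a := τ ^ 2 * ((y0 ⬝ᵥ y0 : ℝ) : ℂ) / 2) (b := Complex.I * τ * ((y0 ⬝ᵥ y : ℝ) : ℂ)) (c := 2 * k * ∑ s ∈ S, Complex.log (ew β y0 τ s y))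
  unfold erest
  nlinarith

lemma eint_diff_k (hb : ∀ s ∈ S, 0 < β s ⬝ᵥ y0) {τ : ℂ} (hτ : 0 < τ.re) : Differentiable ℂ fun k => ∫ y, eint S β y0 k τ y := by
  intro k
  obtain ⟨D, C, h⟩ := eint_bound S β y0 hb hτ ‖τ‖ (‖k‖ + 1) (norm_nonneg _) (by positivity)
  refine diff_param (ρ := 1) one_pos (fun z _ => (eint_meas S β y0 z τ).aestronglyMeasurable)
    (Filter.Eventually.of_forall fun y => ?_) (Filter.Eventually.of_forall fun y z hz => h z τ ?_ le_rfl le_rfl y) (int_gauss' C D (by norm_num))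
  · unfold eint erest; fun_prop
  · rw [Metric.mem_ball, dist_eq_norm] at hz
    have := norm_le_norm_add_norm_sub' z k
    linarith

lemma eint_diff_tau (hb : ∀ s ∈ S, 0 < β s ⬝ᵥ y0) (k : ℂ) {τ : ℂ} (hτ : 0 < τ.re) : DifferentiableAt ℂ (fun τ => ∫ y, eint S β y0 k τ y) τ := by
  obtain ⟨D, C, h⟩ := eint_bound S β y0 hb (t0 := τ.re/2) (by linarith) (‖τ‖ + τ.re/2) ‖k‖ (by positivity) (norm_nonneg _)
  have hre : ∀ z ∈ Metric.ball τ (τ.re/2), τ.re/2 ≤ z.re := by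
    intro z hz
    rw [Metric.mem_ball, dist_eq_norm] at hz
    have := Complex.abs_re_le_norm (z - τ)
    rw [Complex.sub_re] at this
    have := abs_le.1 (this.trans hz.le)
    linarith [this.1]
  refine diff_param (ρ := τ.re/2) (by linarith) (fun z _ => (eint_meas S β y0 k z).aestronglyMeasurable)
    (Filter.Eventually.of_forall fun y => ?_) (Filter.Eventually.of_forall fun y z hz => h k z le_rfl ?_ (hre z hz) y) (int_gauss' C D (by norm_num))
  · intro z hz
    apply DifferentiableAt.differentiableWithinAt
    unfold eint erest
    apply DifferentiableAt.cexp
    apply DifferentiableAt.sub_const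
    apply DifferentiableAt.add
    · fun_prop
    · apply DifferentiableAt.const_mul
      apply DifferentiableAt.fun_sum
      intro s hs
      apply DifferentiableAt.clog
      · unfold ew; fun_prop
      · left
        rw [ew_re]
        have := hb s hs
        have := hre z hz
        have : 0 < z.re := by linarith
        positivity
  · rw [Metric.mem_ball, dist_eq_norm] at hz
    have := norm_le_norm_add_norm_sub' z τ
    linarith

lemma eint_shift (k τ : ℂ) (σ : ℝ) (y) : eint S β y0 k (τ + Complex.I * σ) y = eint S β y0 k τ (y + σ • y0) := by
  have h1 : ∀ s, ew β y0 (τ + Complex.I * σ) s y = ew β y0 τ s (y + σ • y0) := by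
    intro s
    unfold ew
    rw [dotProduct_add, dotProduct_smul]
    push_cast
    simp only [smul_eq_mul]
    push_cast
    ring
  unfold eint erest
  simp only [h1]
  congr 1
  rw [dotProduct_add, dotProduct_smul, add_dotProduct, dotProduct_add, dotProduct_add, dotProduct_smul, smul_dotProduct, smul_dotProduct, dotProduct_smul,
    dotProduct_comm y y0]
  simp only [smul_eq_mul]
  push_cast
  linear_combination ((σ : ℂ)^2 * ((y0 ⬝ᵥ y0 : ℝ) : ℂ) / 2 + σ * ((y0 ⬝ᵥ y : ℝ) : ℂ)) * Complex.I_sq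

lemma eint_shift_int (k τ : ℂ) (σ : ℝ) : ∫ y, eint S β y0 k (τ + Complex.I * σ) y = ∫ y, eint S β y0 k τ y := by
  simp only [eint_shift]
  exact integral_add_right_eq_self (fun y => eint S β y0 k τ y) _

lemma eint_deriv_zero (hb : ∀ s ∈ S, 0 < β s ⬝ᵥ y0) (k : ℂ) {τ : ℂ} (hτ : 0 < τ.re) : deriv (fun τ => ∫ y, eint S β y0 k τ y) τ = 0 := by
  have h1 := (eint_diff_tau S β y0 hb k hτ).hasDerivAt
  set D := deriv (fun τ => ∫ y, eint S β y0 k τ y) τ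
  have h2 : HasDerivAt (fun σ : ℝ => τ + Complex.I * (σ:ℂ)) Complex.I 0 := by
    have := ((hasDerivAt_id (0:ℝ)).ofReal_comp.const_mul Complex.I).const_add τ
    simpa using this
  have h3 : HasDerivAt (fun σ : ℝ => ∫ y, eint S β y0 k (τ + Complex.I * σ) y) (D * Complex.I) 0 := by
    have h1' : HasDerivAt (fun τ => ∫ y, eint S β y0 k τ y) D (τ + Complex.I * ((0:ℝ):ℂ)) := by simpa using h1
    exact h1'.comp (0:ℝ) h2
  simp only [eint_shift_int] at h3
  have := h3.unique (hasDerivAt_const (0:ℝ) (∫ y, eint S β y0 k τ y))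
  exact (mul_eq_zero.1 this).resolve_right Complex.I_ne_zero

lemma eint_indep (hb : ∀ s ∈ S, 0 < β s ⬝ᵥ y0) (k : ℂ) {τ τ' : ℂ} (hτ : 0 < τ.re) (hτ' : 0 < τ'.re) :
    ∫ y, eint S β y0 k τ y = ∫ y, eint S β y0 k τ' y := by
  have hc : Convex ℝ {z : ℂ | 0 < z.re} := convex_halfSpace_re_gt 0
  have ho : IsOpen {z : ℂ | 0 < z.re} := Complex.isOpen_re_gt 0
  refine hc.is_const_of_fderivWithin_eq_zero (𝕜 := ℂ) (f := fun τ => ∫ y, eint S β y0 k τ y) (fun z hz => (eint_diff_tau S β y0 hb k hz).differentiableWithinAt) ?_ hτ hτ'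
  intro z hz
  rw [fderivWithin_of_isOpen ho hz]
  ext
  rw [fderiv_apply_one_eq_deriv, eint_deriv_zero S β y0 hb k hz]
  rfl

end

end

section
section
variable {r : ℕ} {ι : Type} (S : Finset ι) (β : ι → Fin r → ℝ) (y0 : Fin r → ℝ)

lemma norm_eint (k : ℂ) (τ : ℝ) (y) : ‖eint S β y0 k τ y‖ =
    Real.exp (τ^2 * (y0 ⬝ᵥ y0)/2 + ∑ s ∈ S, (2 * k.re * Real.log ‖ew β y0 τ s y‖ - 2 * k.im * (ew β y0 τ s y).arg) - (y ⬝ᵥ y)/2) := by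
  unfold eint erest
  rw [Complex.norm_exp, Complex.sub_re, Complex.ofReal_re, Complex.add_re, Complex.add_re]
  congr 3
  · have e1 : (τ:ℂ)^2 * ((y0 ⬝ᵥ y0 : ℝ):ℂ)/2 = ((τ^2*(y0 ⬝ᵥ y0)/2 : ℝ) : ℂ) := by push_cast; rfl
    rw [e1, Complex.ofReal_re]
    have e2 : Complex.I * τ * ((y0 ⬝ᵥ y : ℝ):ℂ) = Complex.I * ((τ * (y0 ⬝ᵥ y) : ℝ):ℂ) := by push_cast; ring
    rw [e2, Complex.I_mul_re, Complex.ofReal_im]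
    simp
  · rw [Finset.mul_sum, Complex.re_sum]
    apply Finset.sum_congr rfl
    intro s _
    rw [mul_assoc, Complex.mul_re, Complex.re_ofNat, Complex.im_ofNat, Complex.mul_re, Complex.log_re, Complex.log_im]
    ring

lemma E_neg_bound (hb : ∀ s ∈ S, 0 < β s ⬝ᵥ y0) {κ : ℝ} (hκ : 0 < κ) :
    ‖∫ y, eint S β y0 (-κ) 1 y‖ ≤ 
      Real.exp (κ * (y0 ⬝ᵥ y0)/2 - 2 * κ * ∑ s ∈ S, Real.log (√κ * (β s ⬝ᵥ y0))) * (2*Real.pi)^((r:ℝ)/2) := by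
  have hs : 0 < √κ := Real.sqrt_pos.2 hκ
  rw [eint_indep S β y0 hb (-κ) (τ := 1) (τ' := (√κ : ℝ)) (by simp) (by simpa using hκ)]
  refine (norm_integral_le_integral_norm _).trans ?_
  rw [← gauss_int, ← integral_const_mul]
  refine integral_mono_of_nonneg (Filter.Eventually.of_forall fun y => norm_nonneg _) ?_ (Filter.Eventually.of_forall fun y => ?_)
  · have := gauss_integrable_c (r := r) 0
    simp only [sub_zero] at this
    exact this.const_mul _
  · simp only []
    rw [norm_eint, ← Real.exp_add, Real.exp_le_exp, Real.sq_sqrt hκ.le]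
    have : ∑ s ∈ S, (2 * (-(κ:ℂ)).re * Real.log ‖ew β y0 (√κ:ℝ) s y‖ - 2 * (-(κ:ℂ)).im * (ew β y0 (√κ:ℝ) s y).arg)
        ≤ - (2 * κ * ∑ s ∈ S, Real.log (√κ * (β s ⬝ᵥ y0))) := by
      rw [Finset.mul_sum, ← Finset.sum_neg_distrib]
      apply Finset.sum_le_sum
      intro s hss
      have h1 := hb s hss
      have h2 : Real.log (√κ * (β s ⬝ᵥ y0)) ≤ Real.log ‖ew β y0 (√κ:ℝ) s y‖ := by
        apply Real.log_le_log (by positivity)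
        refine le_trans ?_ (Complex.re_le_norm _)
        rw [ew_re, Complex.ofReal_re]
      simp only [Complex.neg_re, Complex.ofReal_re, Complex.neg_im, Complex.ofReal_im]
      nlinarith
    linarith

lemma E_left_bound (hb : ∀ s ∈ S, 0 < β s ⬝ᵥ y0) : ∃ C c : ℝ, 0 < C ∧ 0 ≤ c ∧ ∀ k : ℂ, k.re ≤ 0 →
    ‖∫ y, eint S β y0 k 1 y‖ ≤ C * Real.exp (c * ‖k‖) := by
  refine ⟨Real.exp ((y0 ⬝ᵥ y0)/2) * (2*Real.pi)^((r:ℝ)/2), ∑ s ∈ S, (2 * |Real.log (β s ⬝ᵥ y0)| + 2 * Real.pi), by positivity, 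
    Finset.sum_nonneg fun s _ => by positivity, ?_⟩
  intro k hk
  refine (norm_integral_le_integral_norm _).trans ?_
  rw [← gauss_int, mul_comm (Real.exp _), mul_assoc, mul_comm, ← integral_const_mul]
  refine integral_mono_of_nonneg (Filter.Eventually.of_forall fun y => norm_nonneg _) ?_ (Filter.Eventually.of_forall fun y => ?_)
  · have := gauss_integrable_c (r := r) 0
    simp only [sub_zero] at this
    exact this.const_mul _
  · simp only []
    have := norm_eint S β y0 k 1 y
    rw [Complex.ofReal_one] at this
    rw [this, ← Real.exp_add, ← Real.exp_add, Real.exp_le_exp]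
    have : ∑ s ∈ S, (2 * k.re * Real.log ‖ew β y0 1 s y‖ - 2 * k.im * (ew β y0 1 s y).arg)
        ≤ (∑ s ∈ S, (2 * |Real.log (β s ⬝ᵥ y0)| + 2 * Real.pi)) * ‖k‖ := by
      rw [Finset.sum_mul]
      apply Finset.sum_le_sum
      intro s hss
      have h1 := hb s hss
      have h2 : Real.log (β s ⬝ᵥ y0) ≤ Real.log ‖ew β y0 1 s y‖ := by
        apply Real.log_le_log (by positivity)
        refine le_trans ?_ (Complex.re_le_norm _)
        rw [ew_re, Complex.one_re, one_mul]
      have h3 : -|Real.log (β s ⬝ᵥ y0)| ≤ Real.log ‖ew β y0 1 s y‖ := (neg_abs_le _).trans h2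
      have h4 : -(k.im * (ew β y0 1 s y).arg) ≤ ‖k‖ * Real.pi := by
        refine (neg_le_abs _).trans ?_
        rw [abs_mul]
        exact mul_le_mul (Complex.abs_im_le_norm k) (Complex.abs_arg_le_pi _) (abs_nonneg _) (norm_nonneg _)
      have h5 : -k.re ≤ ‖k‖ := (neg_le_abs _).trans (Complex.abs_re_le_norm k)
      have h6 : k.re * Real.log ‖ew β y0 1 s y‖ ≤ ‖k‖ * |Real.log (β s ⬝ᵥ y0)| := by
        nlinarith [abs_nonneg (Real.log (β s ⬝ᵥ y0))]
      nlinarith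
    linarith

lemma E_right (hb : ∀ s ∈ S, 0 < β s ⬝ᵥ y0) {k : ℂ} (hk : 0 ≤ k.re) :
    ∫ y, eint S β y0 k 1 y = ∫ y, eint S β y0 k 0 y := by
  have hcon : ∀ᶠ τ : ℝ in nhdsWithin 0 (Set.Ioi 0), ∫ y, eint S β y0 k τ y = ∫ y, eint S β y0 k 1 y := by
    filter_upwards [self_mem_nhdsWithin] with τ hτ
    exact eint_indep S β y0 hb k (by simpa using hτ) (by simp)
  have hlim : Filter.Tendsto (fun τ : ℝ => ∫ y, eint S β y0 k τ y) (nhdsWithin 0 (Set.Ioi 0)) (nhds (∫ y, eint S β y0 k 0 y)) := by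
    refine tendsto_integral_filter_of_dominated_convergence (fun y => Real.exp (((y0 ⬝ᵥ y0)/2 + ∑ s ∈ S, (2 * k.re * |β s ⬝ᵥ y0| + 2 * ‖k‖ * Real.pi)) 
        + (∑ s ∈ S, 2 * k.re * ∑ i, |β s i|) * ∑ i, |y i| - (1/2) * (y ⬝ᵥ y))) ?_ ?_ (int_gauss' _ _ (by norm_num)) ?_
    · exact Filter.Eventually.of_forall fun τ => (eint_meas S β y0 k τ).aestronglyMeasurable
    · filter_upwards [Ioo_mem_nhdsGT (show (0:ℝ) < 1 by norm_num)] with τ hτ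
      refine Filter.Eventually.of_forall fun y => ?_
      rw [norm_eint, Real.exp_le_exp]
      have : ∑ s ∈ S, (2 * k.re * Real.log ‖ew β y0 τ s y‖ - 2 * k.im * (ew β y0 τ s y).arg)
          ≤ (∑ s ∈ S, (2 * k.re * |β s ⬝ᵥ y0| + 2 * ‖k‖ * Real.pi)) + (∑ s ∈ S, 2 * k.re * ∑ i, |β s i|) * ∑ i, |y i| := by
        rw [Finset.sum_mul, ← Finset.sum_add_distrib]
        apply Finset.sum_le_sum
        intro s hss
        have h2 : Real.log ‖ew β y0 τ s y‖ ≤ |β s ⬝ᵥ y0| + (∑ i, |β s i|) * ∑ i, |y i| := by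
          have h1 := ew_norm β y0 τ s y
          rw [Complex.norm_real, Real.norm_of_nonneg hτ.1.le] at h1
          have h3 := abs_dot_le (β s) y
          have h4 := Real.log_le_self (norm_nonneg (ew β y0 τ s y))
          have h5 : τ * |β s ⬝ᵥ y0| ≤ 1 * |β s ⬝ᵥ y0| := mul_le_mul_of_nonneg_right hτ.2.le (abs_nonneg _)
          linarith
        have h4 : -(k.im * (ew β y0 τ s y).arg) ≤ ‖k‖ * Real.pi := by
          refine (neg_le_abs _).trans ?_
          rw [abs_mul]
          exact mul_le_mul (Complex.abs_im_le_norm k) (Complex.abs_arg_le_pi _) (abs_nonneg _) (norm_nonneg _)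
        have h6 := mul_le_mul_of_nonneg_left h2 hk
        nlinarith
      have h7 : τ^2 * (y0 ⬝ᵥ y0) ≤ 1 * (y0 ⬝ᵥ y0) := mul_le_mul_of_nonneg_right (by nlinarith [hτ.1, hτ.2]) (dot_self_nonneg _)
      linarith
    · have hae : ∀ᵐ y : Fin r → ℝ, ∀ s ∈ S, β s ⬝ᵥ y ≠ 0 := by
        rw [Filter.eventually_all_finset]
        intro s hs
        apply ae_ne_zero
        rintro h
        have := hb s hs
        rw [h, zero_dotProduct] at this
        exact lt_irrefl _ this
      filter_upwards [hae] with y hy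
      have hca : ContinuousAt (fun τ : ℝ => eint S β y0 k τ y) 0 := by
        unfold eint erest
        apply ContinuousAt.cexp
        apply ContinuousAt.sub _ continuousAt_const
        apply ContinuousAt.add
        · fun_prop
        · apply ContinuousAt.mul continuousAt_const
          apply tendsto_finsetSum
          intro s hs
          apply ContinuousAt.clog
          · unfold ew; fun_prop
          · right
            have := hy s hs
            simpa [ew] using this
      have := hca.tendsto
      rw [Complex.ofReal_zero] at this
      exact this.mono_left nhdsWithin_le_nhds
  exact tendsto_nhds_unique (tendsto_const_nhds.congr' (by
    filter_upwards [hcon] with τ h using h.symm)) hlim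

/-- the boundary value integrand -/
lemma eint_zero (k : ℂ) {y} (hy : ∀ s ∈ S, β s ⬝ᵥ y ≠ 0) : eint S β y0 k 0 y = 
    Complex.exp (2 * k * (Real.log |∏ s ∈ S, β s ⬝ᵥ y| : ℝ)) * (Real.exp (-(y ⬝ᵥ y)/2) : ℝ) * 
     Complex.exp (Complex.I * Real.pi * k * ((S.card : ℂ) - 2 * ((S.filter (fun s => β s ⬝ᵥ y < 0)).card : ℂ))) := by
  have h1 : ∀ s ∈ S, Complex.log (ew β y0 0 s y) = (Real.log |β s ⬝ᵥ y| : ℝ) + Complex.I * Real.pi / 2 * (1 - 2 * (if β s ⬝ᵥ y < 0 then 1 else 0)) := by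
    intro s hs
    have h := hy s hs
    have e : ew β y0 0 s y = ((β s ⬝ᵥ y : ℝ) : ℂ) * Complex.I := by unfold ew; ring
    rw [e]
    split_ifs with hlt
    · have e2 : ((β s ⬝ᵥ y : ℝ) : ℂ) * Complex.I = ((-(β s ⬝ᵥ y) : ℝ) : ℂ) * (-Complex.I) := by push_cast; ring
      rw [e2, Complex.log_ofReal_mul (by linarith) (by simp), abs_of_neg hlt, Complex.log_neg_I]
      ring
    · have hgt : 0 < β s ⬝ᵥ y := lt_of_le_of_ne (not_lt.1 hlt) h.symm
      rw [Complex.log_ofReal_mul hgt (by simp), abs_of_pos hgt, Complex.log_I]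
      ring
  unfold eint erest
  rw [Finset.sum_congr rfl h1, Finset.sum_add_distrib, ← Finset.mul_sum, Finset.sum_sub_distrib, ← Finset.mul_sum, Finset.sum_boole, Finset.sum_const]
  rw [Finset.abs_prod, Real.log_prod (fun s hs => abs_ne_zero.2 (hy s hs)), Complex.ofReal_exp, ← Complex.exp_add, ← Complex.exp_add]
  congr 1
  push_cast
  simp only [nsmul_eq_mul]
  ring

end

end

section
lemma orth_integrable {r : ℕ} {E : Type*} [NormedAddCommGroup E] (f : (Fin r → ℝ) →ₗ[ℝ] (Fin r → ℝ)) (hf : ∀ x y, f x ⬝ᵥ f y = x ⬝ᵥ y)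
    {φ : (Fin r → ℝ) → E} (h : Integrable φ) : Integrable fun x => φ (f x) := by
  have hm : MeasurePreserving f volume volume := ⟨f.continuous_of_finiteDimensional.measurable, (orth_mp f hf).1⟩
  exact hm.integrable_comp_of_integrable h

namespace RS
variable {r : ℕ} {G : Type} [Group G] (R : RS r G)

def dlt (x : Fin r → ℝ) : ℝ := ∏ s ∈ R.S, R.α s ⬝ᵥ x

def wgt (k : ℂ) (x : Fin r → ℝ) : ℂ := if R.dlt x = 0 then 0 else Complex.exp (2 * k * Real.log |R.dlt x|)

def fint (k : ℂ) (x : Fin r → ℝ) : ℂ := Real.exp (-(x ⬝ᵥ x) / 2) • R.wgt k x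

def FF (k : ℂ) : ℂ := (((2 * Real.pi) ^ (-(r : ℝ) / 2) : ℝ) : ℂ) * ∫ x, R.fint k x

lemma dlt_ne {x} : R.dlt x ≠ 0 ↔ R.Reg x := by
  unfold dlt Reg; rw [Finset.prod_ne_zero_iff]

lemma dlt_rho (g : G) (x) : |R.dlt (R.ρ g x)| = |R.dlt x| := by
  unfold dlt
  rw [Finset.abs_prod, Finset.abs_prod]
  symm
  refine Finset.prod_bij (fun s _ => g * s * g⁻¹) (fun s hs => R.conj_mem g s hs) ?_ ?_ ?_
  · intro a _ b _ h; simpa using h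
  · intro b hb; exact ⟨g⁻¹ * b * g, R.conj_mem' g hb, by group⟩
  · intro s hs
    rcases R.alpha_rho g hs with h | h <;> rw [h]
    rw [abs_neg]

lemma wgt_rho (k) (g : G) (x) : R.wgt k (R.ρ g x) = R.wgt k x := by
  unfold wgt
  have h : (R.dlt (R.ρ g x) = 0) = (R.dlt x = 0) := by
    rw [← abs_eq_zero, R.dlt_rho, abs_eq_zero]
  simp only [h, R.dlt_rho]

lemma fint_rho (k) (g : G) (x) : R.fint k (R.ρ g x) = R.fint k x := by
  unfold fint; rw [R.wgt_rho, R.orth]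

lemma dlt_cont : Continuous R.dlt := by
  unfold dlt dotProduct; fun_prop

lemma wgt_meas (k) : Measurable (R.wgt k) := by
  unfold wgt
  refine Measurable.ite (R.dlt_cont.measurable (measurableSet_singleton 0)) measurable_const ?_
  apply Complex.measurable_exp.comp
  apply Measurable.const_mul
  exact Complex.measurable_ofReal.comp (Real.measurable_log.comp (R.dlt_cont.abs.measurable))

lemma fint_meas (k) : Measurable (R.fint k) := by
  unfold fint
  have h : Measurable fun x : Fin r → ℝ => Real.exp (-(x ⬝ᵥ x) / 2) := by
    unfold dotProduct; fun_prop
  exact h.smul (R.wgt_meas k)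

lemma norm_wgt (k) (x) : ‖R.wgt k x‖ = if R.dlt x = 0 then 0 else Real.exp (2 * k.re * Real.log |R.dlt x|) := by
  unfold wgt
  split_ifs
  · simp
  · rw [Complex.norm_exp, Complex.re_mul_ofReal]
    simp

lemma log_dlt_le {x} (hx : R.Reg x) : Real.log |R.dlt x| ≤ (∑ s ∈ R.S, ∑ i, |R.α s i|) * ∑ i, |x i| := by
  unfold dlt
  rw [Finset.abs_prod, Real.log_prod (fun s hs => abs_ne_zero.2 (hx s hs)), Finset.sum_mul]
  exact Finset.sum_le_sum fun s hs => (Real.log_le_self (abs_nonneg _)).trans (abs_dot_le _ _)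

lemma wgt_bound {K : ℝ} {k : ℂ} (hk : 0 ≤ k.re) (hK : k.re ≤ K) (x) :
    ‖R.wgt k x‖ ≤ Real.exp ((2 * K * ∑ s ∈ R.S, ∑ i, |R.α s i|) * ∑ i, |x i|) := by
  rw [norm_wgt]
  split_ifs with h
  · positivity
  · rw [Real.exp_le_exp]
    have h1 := R.log_dlt_le (R.dlt_ne.1 h)
    have h2 : 0 ≤ (∑ s ∈ R.S, ∑ i, |R.α s i|) * ∑ i, |x i| := by positivity
    calc 2 * k.re * Real.log |R.dlt x| ≤ 2 * k.re * ((∑ s ∈ R.S, ∑ i, |R.α s i|) * ∑ i, |x i|) :=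
          mul_le_mul_of_nonneg_left h1 (by linarith)
      _ ≤ 2 * K * ((∑ s ∈ R.S, ∑ i, |R.α s i|) * ∑ i, |x i|) := mul_le_mul_of_nonneg_right (by linarith) h2
      _ = _ := by ring

lemma fint_bound {K : ℝ} {k : ℂ} (hk : 0 ≤ k.re) (hK : k.re ≤ K) (x) :
    ‖R.fint k x‖ ≤ Real.exp ((2 * K * ∑ s ∈ R.S, ∑ i, |R.α s i|) * ∑ i, |x i| - (1/2) * (x ⬝ᵥ x)) := by
  unfold fint
  rw [norm_smul, Real.norm_of_nonneg (Real.exp_pos _).le]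
  refine (mul_le_mul_of_nonneg_left (R.wgt_bound hk hK x) (Real.exp_pos _).le).trans ?_
  rw [← Real.exp_add, Real.exp_le_exp]
  linarith

lemma fint_integrable {k : ℂ} (hk : 0 ≤ k.re) : Integrable (R.fint k) :=
  (int_gauss _ (by norm_num)).mono' (R.fint_meas k).aestronglyMeasurable (Filter.Eventually.of_forall fun x => R.fint_bound hk le_rfl x)

lemma wgt_cont_k (x) : Continuous fun k => R.wgt k x := by
  unfold wgt; split_ifs <;> fun_prop

lemma FF_cont : ContinuousOn R.FF {k | 0 ≤ k.re} := by
  intro k hk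
  unfold FF
  apply ContinuousWithinAt.mul continuousWithinAt_const
  refine continuousWithinAt_of_dominated (bound := fun x => Real.exp ((2 * (k.re + 1) * ∑ s ∈ R.S, ∑ i, |R.α s i|) * ∑ i, |x i| - (1/2) * (x ⬝ᵥ x)))
    (Filter.Eventually.of_forall fun z => (R.fint_meas z).aestronglyMeasurable) ?_ (int_gauss _ (by norm_num)) ?_
  · have h1 : ∀ᶠ z : ℂ in nhdsWithin k {k | 0 ≤ k.re}, z.re < k.re + 1 :=
      (Complex.continuous_re.continuousAt.eventually_lt continuousAt_const (by simp)).filter_mono nhdsWithin_le_nhds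
    filter_upwards [h1, self_mem_nhdsWithin] with z h1 h2
    exact Filter.Eventually.of_forall fun x => R.fint_bound h2 h1.le x
  · refine Filter.Eventually.of_forall fun x => ?_
    unfold fint
    exact ((R.wgt_cont_k x).const_smul (Real.exp (-(x ⬝ᵥ x) / 2))).continuousWithinAt

lemma FF_diff {k : ℂ} (hk : 0 < k.re) : DifferentiableAt ℂ R.FF k := by
  unfold FF
  apply DifferentiableAt.const_mul
  have hre : ∀ z ∈ Metric.ball k k.re, 0 ≤ z.re ∧ z.re ≤ 2 * k.re := by
    intro z hz
    rw [Metric.mem_ball, dist_eq_norm] at hz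
    have := Complex.abs_re_le_norm (z - k)
    rw [Complex.sub_re] at this
    have := abs_le.1 (this.trans hz.le)
    constructor <;> linarith [this.1, this.2]
  refine diff_param hk (fun z _ => (R.fint_meas z).aestronglyMeasurable) (Filter.Eventually.of_forall fun x => ?_)
    (Filter.Eventually.of_forall fun x z hz => R.fint_bound (hre z hz).1 (hre z hz).2 x) (int_gauss _ (by norm_num))
  apply Differentiable.differentiableOn
  unfold fint
  have : Differentiable ℂ fun z => R.wgt z x := by
    unfold wgt; split_ifs <;> fun_prop
  exact this.const_smul (Real.exp (-(x ⬝ᵥ x) / 2))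

lemma ae_reg : ∀ᵐ y : Fin r → ℝ, R.Reg y := by
  unfold Reg
  rw [Filter.eventually_all_finset]
  intro s hs
  apply ae_ne_zero
  intro h
  have := R.nrm s hs
  rw [h, zero_dotProduct] at this
  norm_num at this

def Zt (p : Fin r → ℝ) [Fintype G] (k : ℂ) : ℂ :=
  ∑ g, Complex.exp (Complex.I * Real.pi * k * ((R.S.card : ℂ) - 2 * ((R.sep p (R.ρ g p) : ℕ) : ℂ)))

def EE (y0 : Fin r → ℝ) [Fintype G] (k : ℂ) : ℂ :=
  (Fintype.card G : ℂ) * (((2 * Real.pi) ^ (-(r : ℝ) / 2) : ℝ) : ℂ) * ∫ y, eint R.S (R.pos y0) y0 k 1 y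

lemma eint_fint {y0} (h0 : R.Reg y0) (k : ℂ) {y} (hy : R.Reg y) : eint R.S (R.pos y0) y0 k 0 y = 
    R.fint k y * Complex.exp (Complex.I * Real.pi * k * ((R.S.card : ℂ) - 2 * ((R.sep y0 y : ℕ) : ℂ))) := by
  have hy' : ∀ s ∈ R.S, R.pos y0 s ⬝ᵥ y ≠ 0 := by
    intro s hs
    rcases R.pos_eq y0 s with h | h <;> rw [h]
    · exact hy s hs
    · rw [neg_dotProduct]; exact neg_ne_zero.2 (hy s hs)
  rw [eint_zero _ _ _ _ hy']
  have h1 : |∏ s ∈ R.S, R.pos y0 s ⬝ᵥ y| = |R.dlt y| := by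
    unfold dlt
    rw [Finset.abs_prod, Finset.abs_prod]
    apply Finset.prod_congr rfl
    intro s _
    rcases R.pos_eq y0 s with h | h <;> rw [h]
    rw [neg_dotProduct, abs_neg]
  have h2 : (R.S.filter (fun s => R.pos y0 s ⬝ᵥ y < 0)).card = R.sep y0 y := by
    unfold sep
    congr 1
    apply Finset.filter_congr
    intro s hs
    rw [R.pos_sep h0 hs]
  rw [h1, h2]
  unfold fint wgt
  rw [if_neg (R.dlt_ne.2 hy), Complex.real_smul]
  ring

lemma EE_eq [Fintype G] {y0} (h0 : R.Reg y0) {k : ℂ} (hk : 0 ≤ k.re) : R.EE y0 k = R.FF k * R.Zt y0 k := by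
  have hb : ∀ s ∈ R.S, 0 < R.pos y0 s ⬝ᵥ y0 := fun s hs => R.pos_pos h0 hs
  unfold EE FF
  rw [E_right _ _ _ hb hk]
  have hi : Integrable (eint R.S (R.pos y0) y0 k 0) := by
    refine ((R.fint_integrable hk).norm.mul_const (Real.exp (Real.pi * ‖k‖ * R.S.card))).mono' (eint_meas _ _ _ _ _).aestronglyMeasurable ?_
    filter_upwards [R.ae_reg] with y hy
    rw [R.eint_fint h0 k hy, norm_mul]
    refine mul_le_mul_of_nonneg_left ?_ (norm_nonneg _)
    refine (Complex.norm_exp_le_exp_norm _).trans ?_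
    rw [Real.exp_le_exp, norm_mul, norm_mul, norm_mul, Complex.norm_I, one_mul, Complex.norm_real, Real.norm_of_nonneg Real.pi_pos.le]
    refine mul_le_mul_of_nonneg_left ?_ (by positivity)
    have h1 := R.sep_le y0 y
    have e : ((R.S.card : ℂ) - 2 * ((R.sep y0 y : ℕ) : ℂ)) = (((R.S.card : ℝ) - 2 * (R.sep y0 y : ℝ) : ℝ) : ℂ) := by push_cast; rfl
    rw [e, Complex.norm_real, Real.norm_eq_abs, abs_le]
    have h2 : (R.sep y0 y : ℝ) ≤ R.S.card := by exact_mod_cast h1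
    have h3 : (0:ℝ) ≤ R.sep y0 y := Nat.cast_nonneg _
    constructor <;> linarith
  have h1 : (Fintype.card G : ℂ) * ∫ y, eint R.S (R.pos y0) y0 k 0 y = (∫ y, R.fint k y) * R.Zt y0 k := by
    have e1 : ∀ g : G, ∫ y, eint R.S (R.pos y0) y0 k 0 (R.ρ g y) = ∫ y, eint R.S (R.pos y0) y0 k 0 y :=
      fun g => orth_integral (R.ρ g) (R.orth g) _
    have e2 : (Fintype.card G : ℂ) * ∫ y, eint R.S (R.pos y0) y0 k 0 y = ∑ g : G, ∫ y, eint R.S (R.pos y0) y0 k 0 (R.ρ g y) := by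
      simp only [e1, Finset.sum_const, Finset.card_univ, nsmul_eq_mul]
    rw [e2, ← integral_finsetSum _ (fun g _ => orth_integrable (R.ρ g) (R.orth g) hi), ← integral_mul_const]
    apply integral_congr_ae
    filter_upwards [R.ae_reg] with y hy
    have e3 : ∀ g : G, eint R.S (R.pos y0) y0 k 0 (R.ρ g y) = R.fint k y * Complex.exp (Complex.I * Real.pi * k * ((R.S.card : ℂ) - 2 * ((R.sep y0 (R.ρ g y) : ℕ) : ℂ))) := by
      intro g
      rw [R.eint_fint h0 k (R.reg_rho hy g), R.fint_rho]
    simp only [e3, ← Finset.mul_sum]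
    rw [R.sum_sep h0 h0 hy (fun n => Complex.exp (Complex.I * Real.pi * k * ((R.S.card : ℂ) - 2 * (n : ℂ))))]
    rfl
  linear_combination (((2 * Real.pi) ^ (-(r : ℝ) / 2) : ℝ) : ℂ) * h1

end RS

end

section
lemma one_sub_exp_sin (θ : ℂ) : 1 - Complex.exp (-2 * Complex.I * θ) = 2 * Complex.I * Complex.exp (-Complex.I * θ) * Complex.sin θ := by
  have h : Complex.exp (-2 * Complex.I * θ) = Complex.exp (-Complex.I * θ) * Complex.exp (-Complex.I * θ) := by
    rw [← Complex.exp_add]; ring_nf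
  have h1 : Complex.exp (-Complex.I * θ) * Complex.exp (θ * Complex.I) = 1 := by
    rw [← Complex.exp_add, ← Complex.exp_zero]; ring_nf
  rw [h, Complex.sin]
  have e : -θ * Complex.I = -Complex.I * θ := by ring
  rw [e]
  have h2 := Complex.I_sq
  linear_combination (-1)*h1 + (Complex.exp (-Complex.I * θ) * Complex.exp (θ * Complex.I) - Complex.exp (-Complex.I * θ) * Complex.exp (-Complex.I * θ)) * h2

lemma RInv.Zt_sin {r : ℕ} {G : Type} [Group G] [Fintype G] {R : RS r G} (I : RInv R) {y0} (h0 : R.Reg y0) (k : ℂ) :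
    R.Zt y0 k * Complex.sin (Real.pi * k) ^ r = ∏ i, Complex.sin (Real.pi * k * I.d i) := by
  obtain ⟨p, hp, hp2⟩ := R.exists_generic
  have e0 : R.Zt y0 k = R.Zt p k := by
    unfold RS.Zt
    exact R.sum_sep hp h0 h0 (fun n => Complex.exp (Complex.I * Real.pi * k * ((R.S.card : ℂ) - 2 * (n : ℂ))))
  rw [e0]
  have hP := I.poincare hp hp2 (Complex.exp (-2 * Complex.I * (Real.pi * k)))
  have e1 : R.Zt p k = Complex.exp (Complex.I * Real.pi * k * R.S.card) * ∑ g, (Complex.exp (-2 * Complex.I * (Real.pi * k))) ^ (R.sep p (R.ρ g p)) := by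
    unfold RS.Zt
    rw [Finset.mul_sum]
    apply Finset.sum_congr rfl
    intro g _
    rw [← Complex.exp_nat_mul, ← Complex.exp_add]
    congr 1; ring
  have e2 : ∀ i, 1 - Complex.exp (-2 * Complex.I * (Real.pi * k)) ^ (I.d i) = 2 * Complex.I * Complex.exp (-Complex.I * (Real.pi * k * I.d i)) * Complex.sin (Real.pi * k * I.d i) := by
    intro i
    rw [← one_sub_exp_sin, ← Complex.exp_nat_mul]
    congr 2; ring
  simp only [e2, one_sub_exp_sin] at hP
  rw [Finset.prod_mul_distrib, Finset.prod_mul_distrib, Finset.prod_const, Finset.card_univ, Fintype.card_fin, ← Complex.exp_sum, ← Finset.mul_sum, ← Finset.mul_sum,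
    mul_pow, mul_pow, ← Complex.exp_nat_mul] at hP
  have hs : ∑ i, (I.d i : ℂ) = R.S.card + r := by
    have := I.sum_d hp hp2
    exact_mod_cast this.symm
  rw [hs] at hP
  have h3 : (2 * Complex.I) ^ r ≠ 0 := pow_ne_zero _ (by simp)
  have e4 : Complex.exp (-Complex.I * (Real.pi * k * (R.S.card + r))) = Complex.exp (r * (-Complex.I * (Real.pi * k))) * Complex.exp (-Complex.I * Real.pi * k * R.S.card) := by
    rw [← Complex.exp_add]; congr 1; ring
  rw [e4] at hP
  have h5 : Complex.exp (r * (-Complex.I * (Real.pi * k))) ≠ 0 := Complex.exp_ne_zero _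
  have e6 : Complex.exp (Complex.I * Real.pi * k * R.S.card) * Complex.exp (-Complex.I * Real.pi * k * R.S.card) = 1 := by
    rw [← Complex.exp_add, ← Complex.exp_zero]; congr 1; ring
  rw [e1]
  apply mul_left_cancel₀ h3
  apply mul_left_cancel₀ h5
  linear_combination Complex.exp (Complex.I * Real.pi * k * R.S.card) * hP + (2 * Complex.I) ^ r * Complex.exp (r * (-Complex.I * (Real.pi * k))) * (∏ i, Complex.sin (Real.pi * k * I.d i)) * e6

namespace RS
variable {r : ℕ} {G : Type} [Group G] (R : RS r G)

lemma exists_max [Finite G] : ∃ y0, R.Reg y0 ∧ ∀ y, R.dlt y ^ 2 * Real.exp (-(y ⬝ᵥ y)/2) ≤ R.dlt y0 ^ 2 * Real.exp (-(y0 ⬝ᵥ y0)/2) := by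
  obtain ⟨p, hp, -⟩ := R.exists_generic
  set f : (Fin r → ℝ) → ℝ := fun y => R.dlt y ^ 2 * Real.exp (-(y ⬝ᵥ y)/2) with hf
  have hfc : Continuous f := by
    have := R.dlt_cont
    have h2 : Continuous fun y : Fin r → ℝ => Real.exp (-(y ⬝ᵥ y)/2) := by unfold dotProduct; fun_prop
    exact (this.pow 2).mul h2
  have hfp : 0 < f p := by
    have := R.dlt_ne.2 hp
    have : 0 < R.dlt p ^ 2 := by positivity
    exact mul_pos this (Real.exp_pos _)
  set C := 2 * ∑ s ∈ R.S, ∑ i, |R.α s i| with hC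
  have hbd : ∀ y, f p ≤ f y → y ⬝ᵥ y ≤ 4 * (r * C^2 - Real.log (f p)) := by
    intro y hy
    have hy0 : R.dlt y ≠ 0 := by
      intro h
      have : f y = 0 := by simp [hf, h]
      linarith
    have hyr := R.dlt_ne.1 hy0
    have h1 : Real.log (f p) ≤ Real.log (f y) := Real.log_le_log hfp hy
    have h2 : Real.log (f y) = 2 * Real.log |R.dlt y| - (y ⬝ᵥ y)/2 := by
      simp only [hf]
      rw [Real.log_mul (by positivity) (Real.exp_pos _).ne', Real.log_exp, Real.log_pow, Real.log_abs]
      push_cast; ring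
    have h3 := R.log_dlt_le hyr
    have h4 : C * ∑ i, |y i| ≤ r * C^2 + (y ⬝ᵥ y)/4 := by
      have : ∀ i ∈ Finset.univ, C * |y i| ≤ C^2 + (y i * y i)/4 := by
        intro i _
        have := sq_nonneg (C - |y i|/2)
        have h5 := sq_abs (y i)
        nlinarith
      have := Finset.sum_le_sum this
      rw [Finset.sum_add_distrib, ← Finset.mul_sum, ← Finset.sum_div] at this
      simpa [dotProduct] using this
    nlinarith
  set ρ := Real.sqrt (4 * (r * C^2 - Real.log (f p))) with hρ
  have hball : ∀ y, f p ≤ f y → y ∈ Metric.closedBall (0 : Fin r → ℝ) ρ := by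
    intro y hy
    rw [mem_closedBall_zero_iff, pi_norm_le_iff_of_nonneg (Real.sqrt_nonneg _)]
    intro i
    apply Real.le_sqrt_of_sq_le
    refine le_trans ?_ (hbd y hy)
    rw [Real.norm_eq_abs, sq_abs, sq]
    exact Finset.single_le_sum (f := fun i => y i * y i) (fun j _ => mul_self_nonneg _) (Finset.mem_univ i)
  obtain ⟨y0, hy0, hmax⟩ := (isCompact_closedBall (0 : Fin r → ℝ) ρ).exists_isMaxOn ⟨p, hball p le_rfl⟩ hfc.continuousOn
  have hp0 : f p ≤ f y0 := hmax (hball p le_rfl)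
  refine ⟨y0, ?_, fun y => ?_⟩
  · rw [← R.dlt_ne]
    intro h
    have : f y0 = 0 := by simp [hf, h]
    linarith
  · by_cases h : f p ≤ f y
    · exact hmax (hball y h)
    · exact (not_le.1 h).le.trans hp0

lemma dlt_pos (p y) : |R.dlt y| = |∏ s ∈ R.S, R.pos p s ⬝ᵥ y| := by
  unfold dlt
  rw [Finset.abs_prod, Finset.abs_prod]
  apply Finset.prod_congr rfl
  intro s _
  rcases R.pos_eq p s with h | h <;> rw [h]
  rw [neg_dotProduct, abs_neg]

lemma exists_crit [Finite G] : ∃ y0, R.Reg y0 ∧ ∀ v, ∑ s ∈ R.S, 2 * ((R.pos y0 s ⬝ᵥ v) / (R.pos y0 s ⬝ᵥ y0)) = y0 ⬝ᵥ v := by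
  obtain ⟨y0, h0, hmax⟩ := R.exists_max
  refine ⟨y0, h0, fun v => ?_⟩
  set h : ℝ → ℝ := fun t => ∑ s ∈ R.S, 2 * Real.log (R.pos y0 s ⬝ᵥ (y0 + t • v)) - ((y0 + t • v) ⬝ᵥ (y0 + t • v))/2 with hh
  have e : ∀ (a : Fin r → ℝ) (t : ℝ), a ⬝ᵥ (y0 + t • v) = a ⬝ᵥ y0 + t * (a ⬝ᵥ v) := by
    intro a t; rw [dotProduct_add, dotProduct_smul, smul_eq_mul]
  have hev : ∀ᶠ t : ℝ in nhds 0, ∀ s ∈ R.S, 0 < R.pos y0 s ⬝ᵥ (y0 + t • v) := by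
    rw [Filter.eventually_all_finset]
    intro s hs
    simp only [e]
    apply ContinuousAt.eventually_lt continuousAt_const (by fun_prop)
    simpa using R.pos_pos h0 hs
  have hval : ∀ t, (∀ s ∈ R.S, 0 < R.pos y0 s ⬝ᵥ (y0 + t • v)) → Real.exp (h t) = R.dlt (y0 + t • v) ^ 2 * Real.exp (-((y0 + t • v) ⬝ᵥ (y0 + t • v))/2) := by
    intro t ht
    simp only [hh]
    rw [sub_eq_add_neg, Real.exp_add, ← neg_div]
    congr 1
    rw [← sq_abs, R.dlt_pos y0, Finset.abs_prod, ← Finset.prod_pow, Real.exp_sum]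
    apply Finset.prod_congr rfl
    intro s hs
    rw [abs_of_pos (ht s hs), two_mul, Real.exp_add, Real.exp_log (ht s hs), sq]
  have hloc : IsLocalMax h 0 := by
    filter_upwards [hev] with t ht
    rw [← Real.exp_le_exp, hval t ht, hval 0 (by simpa using fun s hs => R.pos_pos h0 hs)]
    have := hmax (y0 + t • v)
    simpa using this
  have hder : HasDerivAt h (∑ s ∈ R.S, 2 * ((R.pos y0 s ⬝ᵥ v) / (R.pos y0 s ⬝ᵥ y0)) - y0 ⬝ᵥ v) 0 := by
    have d1 : ∀ a : Fin r → ℝ, HasDerivAt (fun t : ℝ => a ⬝ᵥ (y0 + t • v)) (a ⬝ᵥ v) 0 := by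
      intro a
      simp only [e]
      simpa using ((hasDerivAt_id (0:ℝ)).mul_const (a ⬝ᵥ v)).const_add (a ⬝ᵥ y0)
    have d2 : HasDerivAt (fun t : ℝ => ((y0 + t • v) ⬝ᵥ (y0 + t • v))/2) (y0 ⬝ᵥ v) 0 := by
      have e2 : ∀ t : ℝ, ((y0 + t • v) ⬝ᵥ (y0 + t • v))/2 = (y0 ⬝ᵥ y0)/2 + t * (y0 ⬝ᵥ v) + t^2 * ((v ⬝ᵥ v)/2) := by
        intro t
        rw [e, dotProduct_comm _ y0, dotProduct_comm _ v, e, e, dotProduct_comm v y0]; ring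
      simp only [e2]
      have := (((hasDerivAt_id (0:ℝ)).mul_const (y0 ⬝ᵥ v)).const_add ((y0 ⬝ᵥ y0)/2)).fun_add (((hasDerivAt_id (0:ℝ)).pow 2).mul_const ((v ⬝ᵥ v)/2))
      simpa using this
    refine HasDerivAt.sub (HasDerivAt.fun_sum fun s hs => ?_) d2
    refine HasDerivAt.const_mul 2 ?_
    have := (d1 (R.pos y0 s)).log (by simpa using (R.pos_pos h0 hs).ne')
    simpa using this
  have := hloc.hasDerivAt_eq_zero hder
  linarith

end RS

end

section
namespace RS
variable {r : ℕ} {G : Type} [Group G] (R : RS r G)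

lemma two_pi_cancel : (2 * Real.pi) ^ (-(r : ℝ) / 2) * (2 * Real.pi) ^ ((r : ℝ) / 2) = 1 := by
  rw [← Real.rpow_add (by positivity)]
  have : -(r : ℝ) / 2 + (r : ℝ) / 2 = 0 := by ring
  rw [this, Real.rpow_zero]

lemma norm_fint (k) (x) : ‖R.fint k x‖ = ‖R.fint (k.re : ℂ) x‖ := by
  unfold fint
  rw [norm_smul, norm_smul, norm_wgt, norm_wgt, Complex.ofReal_re]

lemma fint_cham {y0} (h0 : R.Reg y0) (hc : ∀ v, ∑ s ∈ R.S, 2 * ((R.pos y0 s ⬝ᵥ v) / (R.pos y0 s ⬝ᵥ y0)) = y0 ⬝ᵥ v)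
    {x : ℝ} (hx : 0 < x) {y} (hy : ∀ s ∈ R.S, 0 < R.pos y0 s ⬝ᵥ y) (hy2 : R.Reg y) :
    ‖R.fint x y‖ ≤ Real.exp (2 * x * ∑ s ∈ R.S, Real.log (√x * (R.pos y0 s ⬝ᵥ y0)) - x * (y0 ⬝ᵥ y0) / 2) * Real.exp (-((y - √x • y0) ⬝ᵥ (y - √x • y0))/2) := by
  have hsx : 0 < √x := Real.sqrt_pos.2 hx
  have hsq : √x * √x = x := Real.mul_self_sqrt hx.le
  unfold fint
  rw [norm_smul, norm_wgt, if_neg (R.dlt_ne.2 hy2), Real.norm_of_nonneg (Real.exp_pos _).le, ← Real.exp_add, ← Real.exp_add, Real.exp_le_exp, Complex.ofReal_re]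
  have h1 : Real.log |R.dlt y| ≤ ∑ s ∈ R.S, (Real.log (√x * (R.pos y0 s ⬝ᵥ y0)) + ((R.pos y0 s ⬝ᵥ y) / (√x * (R.pos y0 s ⬝ᵥ y0)) - 1)) := by
    rw [R.dlt_pos y0, Finset.abs_prod, Real.log_prod (fun s hs => abs_ne_zero.2 (hy s hs).ne')]
    apply Finset.sum_le_sum
    intro s hs
    have hp := R.pos_pos h0 hs
    have hp2 := hy s hs
    have h3 := Real.log_le_sub_one_of_pos (x := (R.pos y0 s ⬝ᵥ y) / (√x * (R.pos y0 s ⬝ᵥ y0))) (by positivity)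
    rw [Real.log_div hp2.ne' (by positivity)] at h3
    rw [abs_of_pos hp2]
    linarith
  have h2 : 2 * (x * ∑ s ∈ R.S, ((R.pos y0 s ⬝ᵥ y) / (√x * (R.pos y0 s ⬝ᵥ y0)) - 1)) = √x * (y0 ⬝ᵥ y) - x * (y0 ⬝ᵥ y0) := by
    rw [← hc y, ← hc y0, Finset.mul_sum, Finset.mul_sum, Finset.mul_sum, Finset.mul_sum, ← Finset.sum_sub_distrib]
    apply Finset.sum_congr rfl
    intro s hs
    have hp := R.pos_pos h0 hs
    rw [div_self hp.ne']
    field_simp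
    linear_combination -(R.pos y0 s ⬝ᵥ y) * hsq
  rw [Finset.sum_add_distrib] at h1
  have h3 : (y - √x • y0) ⬝ᵥ (y - √x • y0) = y ⬝ᵥ y - 2 * (√x * (y0 ⬝ᵥ y)) + x * (y0 ⬝ᵥ y0) := by
    rw [sub_dotProduct, dotProduct_sub, dotProduct_sub, dotProduct_smul, smul_dotProduct, smul_dotProduct, dotProduct_smul, dotProduct_comm y y0]
    simp only [smul_eq_mul]
    linear_combination (y0 ⬝ᵥ y0) * hsq
  rw [h3]
  have h4 := mul_le_mul_of_nonneg_left h1 (by linarith : (0:ℝ) ≤ 2 * x)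
  linarith

lemma FF_le [Fintype G] {y0} (h0 : R.Reg y0) (hc : ∀ v, ∑ s ∈ R.S, 2 * ((R.pos y0 s ⬝ᵥ v) / (R.pos y0 s ⬝ᵥ y0)) = y0 ⬝ᵥ v)
    {k : ℂ} (hk : 0 < k.re) : 
    ‖R.FF k‖ ≤ Fintype.card G * Real.exp (2 * k.re * ∑ s ∈ R.S, Real.log (√k.re * (R.pos y0 s ⬝ᵥ y0)) - k.re * (y0 ⬝ᵥ y0) / 2) := by
  set x := k.re with hx
  set B := Real.exp (2 * x * ∑ s ∈ R.S, Real.log (√x * (R.pos y0 s ⬝ᵥ y0)) - x * (y0 ⬝ᵥ y0) / 2) with hB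
  set gg : (Fin r → ℝ) → ℝ := fun y => Real.exp (-((y - √x • y0) ⬝ᵥ (y - √x • y0))/2) with hgg
  have hgi : Integrable gg := gauss_integrable_c _
  have hb : ∀ᵐ y, ‖R.fint k y‖ ≤ ∑ g : G, B * gg (R.ρ g y) := by
    filter_upwards [R.ae_reg] with y hy
    obtain ⟨g, hg⟩ := R.exists_sep_zero h0 _ y hy rfl
    have hy2 := R.reg_rho hy g
    have hpos : ∀ s ∈ R.S, 0 < R.pos y0 s ⬝ᵥ (R.ρ g y) := by
      intro s hs
      have h1 : ¬ ((R.α s ⬝ᵥ y0) * (R.α s ⬝ᵥ (R.ρ g y)) < 0) := by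
        intro h2
        unfold sep at hg
        rw [Finset.card_eq_zero, Finset.filter_eq_empty_iff] at hg
        exact hg hs h2
      rw [R.pos_sep h0 hs] at h1
      refine lt_of_le_of_ne (not_lt.1 h1) (Ne.symm ?_)
      rcases R.pos_eq y0 s with h | h <;> rw [h]
      · exact hy2 s hs
      · rw [neg_dotProduct]; exact neg_ne_zero.2 (hy2 s hs)
    rw [norm_fint, ← R.fint_rho _ g]
    refine (R.fint_cham h0 hc hk hpos hy2).trans ?_
    exact Finset.single_le_sum (f := fun g : G => B * gg (R.ρ g y)) (fun g _ => by positivity) (Finset.mem_univ g)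
  have hi : ∀ g : G, Integrable fun y => B * gg (R.ρ g y) := fun g => (orth_integrable (R.ρ g) (R.orth g) hgi).const_mul _
  have h1 : ∫ y, ‖R.fint k y‖ ≤ Fintype.card G * B * (2*Real.pi)^((r:ℝ)/2) := by
    refine (integral_mono_of_nonneg (Filter.Eventually.of_forall fun y => norm_nonneg _) (integrable_finsetSum _ fun g _ => hi g) hb).trans ?_
    rw [integral_finsetSum _ fun g _ => hi g]
    have : ∀ g : G, ∫ y, B * gg (R.ρ g y) = B * (2*Real.pi)^((r:ℝ)/2) := by
      intro g
      rw [integral_const_mul, orth_integral (R.ρ g) (R.orth g) gg, gauss_int_c]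
    simp only [this, Finset.sum_const, Finset.card_univ, nsmul_eq_mul]
    linarith
  unfold FF
  rw [norm_mul, Complex.norm_real, Real.norm_of_nonneg (by positivity)]
  calc _ ≤ (2 * Real.pi) ^ (-(r : ℝ) / 2) * (Fintype.card G * B * (2*Real.pi)^((r:ℝ)/2)) := 
        mul_le_mul_of_nonneg_left ((norm_integral_le_integral_norm _).trans h1) (by positivity)
    _ = Fintype.card G * B := by
        have := two_pi_cancel (r := r)
        linear_combination (Fintype.card G * B) * this

lemma crit_norm {y0} (h0 : R.Reg y0) (hc : ∀ v, ∑ s ∈ R.S, 2 * ((R.pos y0 s ⬝ᵥ v) / (R.pos y0 s ⬝ᵥ y0)) = y0 ⬝ᵥ v) : y0 ⬝ᵥ y0 = 2 * R.S.card := by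
  rw [← hc y0, Finset.sum_congr rfl (g := fun _ => (2:ℝ))]
  · simp; ring
  · intro s hs
    rw [div_self (R.pos_pos h0 hs).ne', mul_one]

lemma sum_log_eq {y0} (h0 : R.Reg y0) {x : ℝ} (hx : 0 < x) : 
    2 * ∑ s ∈ R.S, Real.log (√x * (R.pos y0 s ⬝ᵥ y0)) = 2 * ∑ s ∈ R.S, Real.log (R.pos y0 s ⬝ᵥ y0) + R.S.card * Real.log x := by
  have : ∀ s ∈ R.S, Real.log (√x * (R.pos y0 s ⬝ᵥ y0)) = Real.log (R.pos y0 s ⬝ᵥ y0) + Real.log x / 2 := by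
    intro s hs
    rw [Real.log_mul (Real.sqrt_pos.2 hx).ne' (R.pos_pos h0 hs).ne', Real.log_sqrt hx.le]; ring
  rw [Finset.sum_congr rfl this, Finset.sum_add_distrib, Finset.sum_const, nsmul_eq_mul]; ring

/-- collected bounds -/
theorem main_bounds [Fintype G] : ∃ y0, R.Reg y0 ∧ ∃ a : ℝ,
    (∀ k : ℂ, 0 < k.re → ‖R.FF k‖ ≤ Fintype.card G * Real.exp (k.re * (a + R.S.card * Real.log k.re))) ∧
    (∀ κ : ℝ, 0 < κ → ‖R.EE y0 (-κ)‖ ≤ Fintype.card G * Real.exp (-(κ * (a + R.S.card * Real.log κ)))) ∧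
    (∃ C c : ℝ, 0 < C ∧ 0 ≤ c ∧ ∀ k : ℂ, k.re ≤ 0 → ‖R.EE y0 k‖ ≤ C * Real.exp (c * ‖k‖)) ∧
    Differentiable ℂ (R.EE y0) := by
  obtain ⟨y0, h0, hc⟩ := R.exists_crit
  have hb : ∀ s ∈ R.S, 0 < R.pos y0 s ⬝ᵥ y0 := fun s hs => R.pos_pos h0 hs
  have hcard : (0:ℝ) < Fintype.card G := by exact_mod_cast Fintype.card_pos
  refine ⟨y0, h0, 2 * ∑ s ∈ R.S, Real.log (R.pos y0 s ⬝ᵥ y0) - R.S.card, ?_, ?_, ?_, ?_⟩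
  · intro k hk
    refine (R.FF_le h0 hc hk).trans_eq ?_
    congr 2
    rw [R.crit_norm h0 hc]
    linear_combination k.re * R.sum_log_eq h0 hk
  · intro κ hκ
    unfold EE
    rw [norm_mul, norm_mul, Complex.norm_real, Complex.norm_natCast, Real.norm_of_nonneg (by positivity), mul_assoc]
    refine mul_le_mul_of_nonneg_left ?_ hcard.le
    refine (mul_le_mul_of_nonneg_left (E_neg_bound R.S (R.pos y0) y0 hb hκ) (by positivity)).trans_eq ?_
    rw [mul_comm (Real.exp _), ← mul_assoc, two_pi_cancel, one_mul]
    congr 1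
    rw [R.crit_norm h0 hc]
    linear_combination -κ * R.sum_log_eq h0 hκ
  · obtain ⟨C, c, hC, hc0, h⟩ := E_left_bound R.S (R.pos y0) y0 hb
    refine ⟨(Fintype.card G : ℝ) * (2 * Real.pi) ^ (-(r : ℝ) / 2) * C, c, by positivity, hc0, fun k hk => ?_⟩
    unfold EE
    rw [norm_mul, norm_mul, Complex.norm_real, Complex.norm_natCast, Real.norm_of_nonneg (by positivity), mul_assoc _ C]
    exact mul_le_mul_of_nonneg_left (h k hk) (by positivity)
  · unfold EE
    exact (eint_diff_k R.S (R.pos y0) y0 hb (τ := 1) (by simp)).const_mul _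

lemma norm_wgt_le_one {k : ℂ} (hk : k.re = 0) (x) : ‖R.wgt k x‖ ≤ 1 := by
  rw [norm_wgt, hk]; split_ifs <;> simp

def gint (k z : ℂ) (x : Fin r → ℝ) : ℂ := Complex.exp (-z * ((x ⬝ᵥ x : ℝ) : ℂ) / 2) * R.wgt k x

lemma gint_meas (k z) : Measurable (R.gint k z) := by
  unfold gint
  refine Measurable.mul ?_ (R.wgt_meas k)
  apply Continuous.measurable
  unfold dotProduct
  fun_prop

lemma gint_bound {k : ℂ} (hk : k.re = 0) (z : ℂ) (x) : ‖R.gint k z x‖ ≤ Real.exp (0 * ∑ i, |x i| - (z.re/2) * (x ⬝ᵥ x)) := by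
  unfold gint
  rw [norm_mul]
  refine (mul_le_mul_of_nonneg_left (R.norm_wgt_le_one hk x) (norm_nonneg _)).trans ?_
  rw [mul_one, Complex.norm_exp, Real.exp_le_exp]
  have : -z * ((x ⬝ᵥ x : ℝ) : ℂ) / 2 = -z * ((x ⬝ᵥ x / 2 : ℝ) : ℂ) := by push_cast; ring
  rw [this, Complex.re_mul_ofReal, Complex.neg_re]
  linarith

lemma gint_diff {k : ℂ} (hk : k.re = 0) {z : ℂ} (hz : 0 < z.re) : DifferentiableAt ℂ (fun z => ∫ x, R.gint k z x) z := by
  refine diff_param (ρ := z.re/2) (bound := fun x => Real.exp (0 * ∑ i, |x i| - (z.re/4) * (x ⬝ᵥ x))) (by linarith) (fun w _ => (R.gint_meas k w).aestronglyMeasurable)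
    (Filter.Eventually.of_forall fun x => ?_) (Filter.Eventually.of_forall fun x w hw => (R.gint_bound hk w x).trans ?_) (int_gauss 0 (by linarith))
  · unfold gint; fun_prop
  · rw [Real.exp_le_exp]
    rw [Metric.mem_ball, dist_eq_norm] at hw
    have := Complex.abs_re_le_norm (w - z)
    rw [Complex.sub_re] at this
    have := (abs_le.1 (this.trans hw.le)).1
    have h2 := dot_self_nonneg x
    nlinarith

lemma wgt_smul (k : ℂ) {c : ℝ} (hc : 0 < c) (x) : R.wgt k (c • x) = Complex.exp (2 * k * R.S.card * Real.log c) * R.wgt k x := by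
  have h : R.dlt (c • x) = c ^ R.S.card * R.dlt x := by
    unfold dlt
    simp only [dotProduct_smul, smul_eq_mul, Finset.prod_mul_distrib, Finset.prod_const]
  unfold wgt
  by_cases h0 : R.dlt x = 0
  · rw [h, h0]; simp
  · have h1 : c ^ R.S.card * R.dlt x ≠ 0 := mul_ne_zero (pow_ne_zero _ hc.ne') h0
    rw [h, if_neg h1, if_neg h0, ← Complex.exp_add, abs_mul, Real.log_mul (by positivity) (abs_ne_zero.2 h0), abs_of_pos (by positivity), Real.log_pow]
    congr 1; push_cast; ring

lemma gint_scale (k : ℂ) {t : ℝ} (ht : 0 < t) : ∫ x, R.gint k t x = Complex.exp (-(r/2 + k * R.S.card) * Complex.log t) * ∫ x, R.gint k 1 x := by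
  have hs : 0 < √t := Real.sqrt_pos.2 ht
  have h1 := Measure.integral_comp_smul (volume : Measure (Fin r → ℝ)) (R.gint k 1) (√t)
  have h2 : ∀ x, R.gint k 1 (√t • x) = Complex.exp (k * R.S.card * Complex.log t) * R.gint k t x := by
    intro x
    unfold gint
    rw [R.wgt_smul k hs, dotProduct_smul, smul_dotProduct, smul_eq_mul, smul_eq_mul, ← mul_assoc (√t), Real.mul_self_sqrt ht.le, Real.log_sqrt ht.le, ← Complex.ofReal_log ht.le]
    have e : Complex.exp (2 * k * R.S.card * ((Real.log t / 2 : ℝ) : ℂ)) = Complex.exp (k * R.S.card * (Real.log t : ℝ)) := by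
      congr 1; push_cast; ring
    have e2 : -1 * ((t * (x ⬝ᵥ x) : ℝ) : ℂ) / 2 = - (t:ℂ) * ((x ⬝ᵥ x : ℝ) : ℂ) / 2 := by push_cast; ring
    rw [e, e2]; ring
  simp only [h2] at h1
  rw [integral_const_mul] at h1
  rw [Module.finrank_fin_fun, abs_of_pos (by positivity)] at h1
  have h3 : (((√t ^ r)⁻¹ : ℝ) : ℂ) = Complex.exp (-(r/2) * Complex.log t) := by
    rw [← Complex.ofReal_log ht.le]
    have : (√t ^ r)⁻¹ = Real.exp (-(r/2) * Real.log t) := by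
      have h4 : √t = Real.exp (Real.log t / 2) := by
        rw [← Real.log_sqrt ht.le, Real.exp_log hs]
      rw [h4, ← Real.exp_nat_mul, ← Real.exp_neg]; congr 1; ring
    rw [this]; push_cast; rfl
  rw [Complex.real_smul, h3] at h1
  have h5 : Complex.exp (-(r/2 + k * R.S.card) * Complex.log t) = Complex.exp (-(r/2) * Complex.log t) * Complex.exp (-(k * R.S.card * Complex.log t)) := by
    rw [← Complex.exp_add]; congr 1; ring
  have h6 : Complex.exp (k * R.S.card * Complex.log t) * Complex.exp (-(k * R.S.card * Complex.log t)) = 1 := by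
    rw [← Complex.exp_add, add_neg_cancel, Complex.exp_zero]
  rw [h5]
  linear_combination (Complex.exp (-(k * R.S.card * Complex.log t))) * h1 - (∫ x, R.gint k t x) * h6

lemma gint_scale_c {k : ℂ} (hk : k.re = 0) {z : ℂ} (hz : 0 < z.re) : ∫ x, R.gint k z x = Complex.exp (-(r/2 + k * R.S.card) * Complex.log z) * ∫ x, R.gint k 1 x := by
  have ho : IsOpen {z : ℂ | 0 < z.re} := Complex.isOpen_re_gt 0
  have hA : AnalyticOnNhd ℂ (fun z => ∫ x, R.gint k z x) {z : ℂ | 0 < z.re} :=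
    DifferentiableOn.analyticOnNhd (fun z hz => (R.gint_diff hk hz).differentiableWithinAt) ho
  have hB : AnalyticOnNhd ℂ (fun z => Complex.exp (-(r/2 + k * R.S.card) * Complex.log z) * ∫ x, R.gint k 1 x) {z : ℂ | 0 < z.re} := by
    refine DifferentiableOn.analyticOnNhd (fun z hz => DifferentiableAt.differentiableWithinAt ?_) ho
    apply DifferentiableAt.mul_const
    apply DifferentiableAt.cexp
    apply DifferentiableAt.const_mul
    exact Complex.differentiableAt_log (Or.inl hz)
  refine AnalyticOnNhd.eqOn_of_preconnected_of_frequently_eq hA hB (convex_halfSpace_re_gt 0).isPreconnected (z₀ := 1) (by simp) ?_ hz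
  have ht : Filter.Tendsto (fun n : ℕ => (((1 + 1/((n:ℝ)+1) : ℝ)) : ℂ)) Filter.atTop (nhdsWithin 1 {1}ᶜ) := by
    rw [tendsto_nhdsWithin_iff]
    constructor
    · have := (tendsto_one_div_add_atTop_nhds_zero_nat (𝕜 := ℝ)).const_add 1
      have := (Complex.continuous_ofReal.tendsto _).comp this
      rw [add_zero, Complex.ofReal_one] at this
      exact this
    · refine Filter.Eventually.of_forall fun n => ?_
      simp only [Set.mem_compl_iff, Set.mem_singleton_iff]
      intro h
      have h2 : (1 + 1/((n:ℝ)+1) : ℝ) = 1 := by exact_mod_cast h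
      have : 0 < 1/((n:ℝ)+1) := by positivity
      linarith
  refine ht.frequently (Filter.Eventually.frequently (Filter.Eventually.of_forall fun n => ?_))
  exact R.gint_scale k (by positivity)

/-- decay on the imaginary axis -/
theorem FF_imag {φ : ℝ} (h0 : 0 ≤ φ) (h1 : φ < Real.pi / 2) : ∃ C : ℝ, 0 < C ∧ ∀ t : ℝ, ‖R.FF (t * Complex.I)‖ ≤ C * Real.exp (-(φ * R.S.card * |t|)) := by
  have hcos : 0 < Real.cos φ := Real.cos_pos_of_mem_Ioo ⟨by linarith [Real.pi_pos], h1⟩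
  set M := ∫ x : Fin r → ℝ, Real.exp (0 * ∑ i, |x i| - (Real.cos φ/2) * (x ⬝ᵥ x)) with hM
  have hM0 : 0 ≤ M := integral_nonneg fun x => (Real.exp_pos _).le
  refine ⟨(2 * Real.pi) ^ (-(r : ℝ) / 2) * (M + 1), by positivity, fun t => ?_⟩
  have hk : ((t:ℂ) * Complex.I).re = 0 := by simp
  obtain ⟨ψ, hψ, hψ2⟩ : ∃ ψ : ℝ, |ψ| = φ ∧ t * ψ = φ * |t| := by
    rcases le_total 0 t with h | h
    · exact ⟨φ, abs_of_nonneg h0, by rw [abs_of_nonneg h]; ring⟩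
    · exact ⟨-φ, by rw [abs_neg, abs_of_nonneg h0], by rw [abs_of_nonpos h]; ring⟩
  have hcψ : Real.cos ψ = Real.cos φ := by rw [← hψ, Real.cos_abs]
  set z := Complex.exp (ψ * Complex.I) with hz
  have hzre : z.re = Real.cos φ := by rw [hz, Complex.exp_ofReal_mul_I_re, hcψ]
  have hlog : Complex.log z = ψ * Complex.I := by
    rw [hz, Complex.log_exp]
    · have := (abs_lt.1 (hψ.trans_lt h1)).1
      simp; linarith [Real.pi_pos]
    · have := (abs_lt.1 (hψ.trans_lt h1)).2
      simp; linarith [Real.pi_pos]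
  have hs := R.gint_scale_c hk (z := z) (by rw [hzre]; exact hcos)
  rw [hlog] at hs
  have hn : ‖∫ x, R.gint (t * Complex.I) z x‖ ≤ M := by
    refine norm_integral_le_of_norm_le (int_gauss 0 (by linarith)) (Filter.Eventually.of_forall fun x => ?_)
    have := R.gint_bound hk z x
    rwa [hzre] at this
  rw [hs, norm_mul, Complex.norm_exp] at hn
  have e : (-((r:ℂ)/2 + t * Complex.I * R.S.card) * (ψ * Complex.I)).re = φ * R.S.card * |t| := by
    have : (-((r:ℂ)/2 + t * Complex.I * R.S.card) * (ψ * Complex.I)) = ((t * ψ * R.S.card : ℝ) : ℂ) + ((-(r/2 * ψ) : ℝ) : ℂ) * Complex.I := by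
      push_cast
      linear_combination -(t * ψ * R.S.card : ℂ) * Complex.I_sq
    rw [this, Complex.add_re, Complex.ofReal_re, Complex.re_ofReal_mul, Complex.I_re, hψ2]; ring
  rw [e] at hn
  have hf : ∫ x, R.gint (t * Complex.I) 1 x = ∫ x, R.fint (t * Complex.I) x := by
    congr 1; ext x
    unfold gint fint
    rw [Complex.real_smul]
    push_cast
    congr 2; ring
  rw [hf] at hn
  unfold FF
  rw [norm_mul, Complex.norm_real, Real.norm_of_nonneg (by positivity), mul_assoc]
  refine mul_le_mul_of_nonneg_left ?_ (by positivity)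
  rw [Real.exp_neg, ← div_eq_mul_inv, le_div_iff₀ (Real.exp_pos _)]
  linarith

end RS

end

section
lemma norm_Gamma_le {z : ℂ} (hz : 0 < z.re) : ‖Complex.Gamma z‖ ≤ Real.Gamma z.re := by
  rw [Complex.Gamma_eq_integral hz, Real.Gamma_eq_integral hz, Complex.GammaIntegral]
  refine (norm_integral_le_integral_norm _).trans (le_of_eq ?_)
  refine setIntegral_congr_fun measurableSet_Ioi fun x hx => ?_
  simp only [norm_mul, Complex.norm_real, Real.norm_eq_abs, Real.abs_exp]
  rw [Complex.norm_cpow_eq_rpow_re_of_pos hx]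
  simp

lemma norm_Gamma_ge {x y : ℝ} (hx : 1 ≤ x) :
    Real.Gamma x * ‖Complex.Gamma (1 + y * Complex.I)‖ ≤ ‖Complex.Gamma (x + y * Complex.I)‖ := by
  have h1 := (Complex.GammaSeq_tendsto_Gamma (x + y * Complex.I)).norm
  have h2 := (Complex.GammaSeq_tendsto_Gamma (1 + y * Complex.I)).norm
  have h3 := Real.GammaSeq_tendsto_Gamma x
  refine le_of_tendsto_of_tendsto (h3.mul h2) h1 ?_
  filter_upwards [Filter.eventually_gt_atTop 0] with n hn
  have hn' : (0:ℝ) < n := by exact_mod_cast hn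
  have hcp : ∀ z : ℂ, ‖(n:ℂ) ^ z‖ = (n:ℝ) ^ z.re := fun z => by
    have := Complex.norm_cpow_eq_rpow_re_of_pos hn' z
    simpa using this
  unfold Real.GammaSeq Complex.GammaSeq
  simp only [norm_div, norm_mul, norm_prod, hcp, Complex.norm_natCast]
  have e1 : (1 + y * Complex.I : ℂ).re = 1 := by simp
  have e2 : (x + y * Complex.I : ℂ).re = x := by simp
  rw [e1, e2, Real.rpow_one]
  have hA : ∀ j : ℕ, 0 < ‖(1 + y * Complex.I + j : ℂ)‖ := fun j => by
    rw [norm_pos_iff]; intro h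
    have := congrArg Complex.re h
    simp at this
    have : (0:ℝ) < 1 + j := by positivity
    linarith
  have hB : ∀ j : ℕ, 0 < ‖(x + y * Complex.I + j : ℂ)‖ := fun j => by
    rw [norm_pos_iff]; intro h
    have := congrArg Complex.re h
    simp at this
    have : (0:ℝ) < x + j := by positivity
    linarith
  have hC : ∀ j : ℕ, (0:ℝ) < x + j := fun j => by positivity
  have key : ∀ j : ℕ, ‖(x + y * Complex.I + j : ℂ)‖ * (1 + j) ≤ (x + j) * ‖(1 + y * Complex.I + j : ℂ)‖ := by
    intro j
    have hj : (0:ℝ) ≤ j := by positivity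
    refine le_of_sq_le_sq ?_ (by have := hC j; positivity) 
    rw [mul_pow, mul_pow, Complex.sq_norm, Complex.sq_norm, Complex.normSq_apply, Complex.normSq_apply]
    simp
    nlinarith [mul_nonneg (sub_nonneg.2 hx) hj, mul_self_nonneg y, mul_nonneg (mul_self_nonneg y) (by nlinarith [mul_nonneg (sub_nonneg.2 hx) hj] : 0 ≤ (x+j)^2 - (1+j)^2)]
  have hprod := Finset.prod_le_prod (s := Finset.range (n+1)) (f := fun j : ℕ => ‖(x + y * Complex.I + j : ℂ)‖ * (1 + j))
    (g := fun j : ℕ => (x + j) * ‖(1 + y * Complex.I + j : ℂ)‖) (fun j _ => by have := hB j; positivity) (fun j _ => key j)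
  rw [Finset.prod_mul_distrib, Finset.prod_mul_distrib] at hprod
  have hfac : ∏ j ∈ Finset.range (n+1), (1 + (j:ℝ)) = (n+1).factorial := by
    rw [← Finset.prod_range_add_one_eq_factorial]; push_cast
    exact Finset.prod_congr rfl fun _ _ => by ring
  rw [hfac] at hprod
  set PA := ∏ j ∈ Finset.range (n+1), ‖(1 + y * Complex.I + j : ℂ)‖
  set PB := ∏ j ∈ Finset.range (n+1), ‖(x + y * Complex.I + j : ℂ)‖
  set PC := ∏ j ∈ Finset.range (n+1), (x + (j:ℝ))
  have hPA : 0 < PA := Finset.prod_pos fun j _ => hA j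
  have hPB : 0 < PB := Finset.prod_pos fun j _ => hB j
  have hPC : 0 < PC := Finset.prod_pos fun j _ => hC j
  rw [div_mul_div_comm, div_le_div_iff₀ (by positivity) hPB]
  have hf : (0:ℝ) < n.factorial := by positivity
  have hle : (n:ℝ) * n.factorial ≤ (n+1).factorial := by
    rw [Nat.factorial_succ]; push_cast; nlinarith
  have hnx : (0:ℝ) < (n:ℝ)^x := by positivity
  calc (n:ℝ)^x * n.factorial * (n * n.factorial) * PB = (n:ℝ)^x * n.factorial * (PB * (n * n.factorial)) := by ring
    _ ≤ (n:ℝ)^x * n.factorial * (PB * (n+1).factorial) := by gcongr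
    _ ≤ (n:ℝ)^x * n.factorial * (PC * PA) := by gcongr

lemma norm_Gamma_imag (y : ℝ) :
    ‖Complex.Gamma (1 + y * Complex.I)‖ ^ 2 * Real.sinh (Real.pi * y) = Real.pi * y := by
  by_cases hy : y = 0
  · simp [hy]
  have h := Complex.Gamma_mul_Gamma_one_sub (y * Complex.I)
  have hyI : (y * Complex.I : ℂ) ≠ 0 := by simp [hy]
  have h2 := Complex.Gamma_add_one _ hyI
  have hc : Complex.Gamma (1 - y * Complex.I) = (starRingEnd ℂ) (Complex.Gamma (1 + y * Complex.I)) := by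
    rw [← Complex.Gamma_conj]; congr 1; simp; ring
  have h3 : Complex.Gamma (1 + y * Complex.I) * (starRingEnd ℂ) (Complex.Gamma (1 + y * Complex.I))
      * Complex.sin (Real.pi * (y * Complex.I)) = y * Complex.I * Real.pi := by
    have hs : Complex.sin (Real.pi * (y * Complex.I)) ≠ 0 := by
      rw [← mul_assoc, Complex.sin_mul_I, ← Complex.ofReal_mul, ← Complex.ofReal_sinh]
      refine mul_ne_zero (Complex.ofReal_ne_zero.2 ?_) Complex.I_ne_zero
      rw [Ne, Real.sinh_eq_zero]; exact mul_ne_zero Real.pi_ne_zero hy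
    rw [← hc, add_comm, h2, mul_assoc (y * Complex.I : ℂ), h, mul_assoc, div_mul_cancel₀ _ hs]
  rw [Complex.mul_conj, ← mul_assoc, Complex.sin_mul_I, ← Complex.ofReal_mul, ← Complex.ofReal_sinh] at h3
  have h4 : ((Complex.normSq (Complex.Gamma (1 + y * Complex.I)) * Real.sinh (Real.pi * y) : ℝ) : ℂ) * Complex.I
     = ((Real.pi * y : ℝ) : ℂ) * Complex.I := by
    push_cast at h3 ⊢; linear_combination h3
  have h5 := mul_right_cancel₀ Complex.I_ne_zero h4
  rw [Complex.sq_norm]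
  exact_mod_cast h5

lemma sinh_le {u : ℝ} (hu : 0 ≤ u) : Real.sinh u ≤ u * Real.exp u := by
  have h1 := Real.add_one_le_exp (-(2*u))
  have h2 : Real.exp (-u) = Real.exp u * Real.exp (-(2*u)) := by rw [← Real.exp_add]; ring_nf
  rw [Real.sinh_eq, h2]
  nlinarith [Real.exp_pos u]

lemma norm_Gamma_even (y : ℝ) : ‖Complex.Gamma (1 + y * Complex.I)‖ = ‖Complex.Gamma (1 + |y| * Complex.I)‖ := by
  rcases abs_choice y with h | h <;> rw [h]
  rw [← Complex.norm_conj, ← Complex.Gamma_conj]; congr 2; simp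

lemma norm_Gamma_imag_ge (y : ℝ) :
    Real.exp (-(Real.pi * |y| / 2)) ≤ ‖Complex.Gamma (1 + y * Complex.I)‖ := by
  rw [norm_Gamma_even]
  by_cases hy : y = 0
  · simp [hy]
  have hy' : 0 < |y| := abs_pos.2 hy
  have h := norm_Gamma_imag |y|
  have hu : 0 < Real.pi * |y| := by positivity
  have hs := sinh_le hu.le
  refine le_of_sq_le_sq ?_ (norm_nonneg _)
  rw [← Real.exp_nat_mul]
  have : ((2:ℕ):ℝ) * -(Real.pi * |y| / 2) = - (Real.pi * |y|) := by push_cast; ring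
  rw [this, Real.exp_neg, inv_le_iff_one_le_mul₀ (Real.exp_pos _)]
  have h1 : Real.pi * |y| ≤ ‖Complex.Gamma (1 + |y| * Complex.I)‖ ^ 2 * ((Real.pi * |y|) * Real.exp (Real.pi * |y|)) := by
    nth_rw 1 [← h]; gcongr
  have h2 : (Real.pi * |y|) * 1 ≤ (Real.pi * |y|) * (‖Complex.Gamma (1 + |y| * Complex.I)‖ ^ 2 * Real.exp (Real.pi * |y|)) := by
    linarith
  exact le_of_mul_le_mul_left h2 hu

lemma sinh_mul_le {u : ℝ} (hu : 0 ≤ u) (d : ℕ) :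
    Real.sinh ((d+1 : ℕ) * u) ≤ (d + 1 : ℕ) * Real.exp (d * u) * Real.sinh u := by
  have hs := Real.sinh_nonneg_iff.2 hu
  induction d with
  | zero => simp
  | succ d ih =>
    have : ((d+1+1 : ℕ):ℝ) * u = (d+1:ℕ) * u + u := by push_cast; ring
    rw [this, Real.sinh_add]
    have hc : Real.cosh u ≤ Real.exp u := by rw [← Real.cosh_add_sinh]; linarith
    have hc' : Real.cosh ((d+1:ℕ) * u) ≤ Real.exp ((d+1:ℕ) * u) := by
      rw [← Real.cosh_add_sinh]
      have := Real.sinh_nonneg_iff.2 (by positivity : 0 ≤ ((d+1:ℕ):ℝ) * u)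
      linarith
    have h1 : Real.sinh ((d+1:ℕ)*u) * Real.cosh u ≤ (d + 1 : ℕ) * Real.exp (d * u) * Real.sinh u * Real.exp u := by
      gcongr
    have h2 : Real.exp ((d+1:ℕ) * u) = Real.exp (d*u) * Real.exp u := by rw [← Real.exp_add]; push_cast; ring_nf
    have h3 := mul_le_mul_of_nonneg_right hc' hs
    rw [h2] at h3 ⊢
    push_cast at h1 h3 ⊢
    linarith

lemma Gamma_imag_ratio (y : ℝ) (d : ℕ) (hd : 1 ≤ d) :
    ‖Complex.Gamma (1 + y * Complex.I)‖ ≤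
      Real.exp (Real.pi / 2 * ((d - 1 : ℝ) * |y|)) * ‖Complex.Gamma (1 + (y * d : ℝ) * Complex.I)‖ := by
  rw [norm_Gamma_even y, norm_Gamma_even (y*d)]
  by_cases hy : y = 0
  · simp [hy]
  have hy' : 0 < |y| := abs_pos.2 hy
  have hd' : (0:ℝ) < d := by positivity
  have h1 := norm_Gamma_imag |y|
  have h2 := norm_Gamma_imag |y * d|
  have hu : 0 < Real.pi * |y| := by positivity
  obtain ⟨e, rfl⟩ : ∃ e, d = e + 1 := ⟨d-1, by omega⟩
  have h3 := sinh_mul_le hu.le e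
  have ha : |y * (e+1:ℕ)| = |y| * (e+1:ℕ) := by rw [abs_mul, abs_of_pos hd']
  rw [ha] at h2 ⊢
  have hs1 : 0 < Real.sinh (Real.pi * |y|) := Real.sinh_pos_iff.2 hu
  have hA : Real.pi * (|y| * (e+1:ℕ)) = (e+1:ℕ) * (Real.pi * |y|) := by ring
  rw [hA] at h2
  refine le_of_sq_le_sq ?_ (by positivity)
  rw [mul_pow, ← Real.exp_nat_mul]
  have hB : ((2:ℕ):ℝ) * (Real.pi / 2 * (((e+1:ℕ) - 1 : ℝ) * |y|)) = e * (Real.pi * |y|) := by push_cast; ring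
  rw [hB]
  set g1 := ‖Complex.Gamma (1 + |y| * Complex.I)‖ ^ 2
  set g2 := ‖Complex.Gamma (1 + (|y| * (e+1:ℕ) : ℝ) * Complex.I)‖ ^ 2
  have hg2 : 0 ≤ g2 := by positivity
  have h4 := mul_le_mul_of_nonneg_left h3 hg2
  have hde : (0:ℝ) < (e+1:ℕ) := hd'
  have h5 : ((e+1:ℕ) * Real.sinh (Real.pi * |y|)) * g1 ≤ ((e+1:ℕ) * Real.sinh (Real.pi * |y|)) * (Real.exp (e * (Real.pi * |y|)) * g2) := by
    calc _ = (e+1:ℕ) * (g1 * Real.sinh (Real.pi * |y|)) := by ring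
      _ = g2 * Real.sinh ((e+1:ℕ) * (Real.pi * |y|)) := by rw [h1, h2]
      _ ≤ _ := h4
      _ = _ := by ring
  exact le_of_mul_le_mul_left h5 (by positivity)

/-- real Stirling -/
def hst (x : ℝ) : ℝ := x * Real.log x - x + Real.log x / 2

lemma stirling_nat : ∃ C, ∀ n : ℕ, 1 ≤ n → |Real.log (Real.Gamma (1 + n)) - hst n| ≤ C := by
  obtain ⟨c, hc⟩ : ∃ c, ∀ n : ℕ, c ≤ Real.log (Stirling.stirlingSeq (n + 1)) :=
    ⟨_, Stirling.log_stirlingSeq_bounded_by_constant⟩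
  have hanti := Stirling.log_stirlingSeq'_antitone
  refine ⟨|c| + |Real.log (Stirling.stirlingSeq 1)| + Real.log 2, fun n hn => ?_⟩
  obtain ⟨m, rfl⟩ : ∃ m, n = m + 1 := ⟨n-1, by omega⟩
  have h1 := hc m
  have h2 : Real.log (Stirling.stirlingSeq (m+1)) ≤ Real.log (Stirling.stirlingSeq 1) := hanti (Nat.zero_le m)
  have h3 := Stirling.log_stirlingSeq_formula (m+1)
  have hpos : (0:ℝ) < (m+1:ℕ) := by positivity
  rw [add_comm (1:ℝ), Real.Gamma_nat_eq_factorial, hst]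
  rw [Real.log_div hpos.ne' (Real.exp_pos 1).ne', Real.log_exp, Real.log_mul (by norm_num) hpos.ne'] at h3
  have hl2 : 0 < Real.log 2 := Real.log_pos (by norm_num)
  have := neg_abs_le c
  have := le_abs_self (Real.log (Stirling.stirlingSeq 1))
  have := abs_nonneg c
  have := abs_nonneg (Real.log (Stirling.stirlingSeq 1))
  rw [abs_le]; constructor <;> nlinarith

lemma stirling : ∃ C, ∀ x : ℝ, 1 ≤ x → |Real.log (Real.Gamma (1 + x)) - hst x| ≤ C := by
  obtain ⟨C, hC⟩ := stirling_nat
  refine ⟨C + 3, fun x hx => ?_⟩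
  set n := ⌊x⌋₊
  have hn : 1 ≤ n := Nat.one_le_floor_iff x |>.2 hx
  have hnx : (n:ℝ) ≤ x := Nat.floor_le (by linarith)
  have hxn : x < n + 1 := Nat.lt_floor_add_one x
  have hb := hC n hn
  have hn1 : (1:ℝ) ≤ n := by exact_mod_cast hn
  by_cases hxe : x = n
  · rw [hxe]; linarith
  have ht : 0 < x - n := sub_pos.2 (lt_of_le_of_ne hnx (Ne.symm hxe))
  have hfeq : ∀ {y : ℝ}, 0 < y → (Real.log ∘ Real.Gamma) (y + 1) = (Real.log ∘ Real.Gamma) y + Real.log y := by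
    intro y hy
    simp only [Function.comp_apply]
    rw [Real.Gamma_add_one hy.ne', Real.log_mul hy.ne' (Real.Gamma_pos_of_pos hy).ne', add_comm]
  have hle := Real.BohrMollerup.f_add_nat_le Real.convexOn_log_Gamma hfeq (n := n+1) (by omega) ht (by linarith)
  have hge := Real.BohrMollerup.f_add_nat_ge Real.convexOn_log_Gamma hfeq (n := n+1) (by omega) ht
  simp only [Function.comp_apply] at hle hge
  have e1 : ((n+1:ℕ):ℝ) + (x - n) = 1 + x := by push_cast; ring
  have e2 : ((n+1:ℕ):ℝ) = 1 + n := by push_cast; ring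
  have e3 : (1 + n : ℝ) - 1 = n := by ring
  rw [e1, e2] at hle hge
  rw [e3] at hge
  have hx0 : 0 < x := by linarith
  have hn0 : (0:ℝ) < n := by linarith
  have hl1 : Real.log (1 + n) ≤ Real.log n + 1 := by
    have := Real.log_le_sub_one_of_pos (x := (1+n)/n) (by positivity)
    rw [Real.log_div (by positivity) (by positivity)] at this
    have h : (1 + (n:ℝ))/n - 1 ≤ 1 := by rw [sub_le_iff_le_add, div_le_iff₀ hn0]; linarith
    linarith
  have hl2 : Real.log n ≤ Real.log x := Real.log_le_log hn0 hnx
  have hl3 : Real.log x ≤ Real.log n + 1 := by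
    have := Real.log_le_log hx0 (by linarith : x ≤ 1 + n)
    linarith
  -- convexity of x log x - x
  have c1 : x * (Real.log x - Real.log n) ≥ x - n := by
    have := Real.log_le_sub_one_of_pos (x := n/x) (by positivity)
    rw [Real.log_div hn0.ne' hx0.ne'] at this
    have h : x * (Real.log n - Real.log x) ≤ x * (n / x - 1) := by gcongr
    have h' : x * (n / x - 1) = n - x := by field_simp
    linarith
  have c2 : n * (Real.log x - Real.log n) ≤ x - n := by
    have := Real.log_le_sub_one_of_pos (x := x/n) (by positivity)
    rw [Real.log_div hx0.ne' hn0.ne'] at this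
    have h : n * (Real.log x - Real.log n) ≤ n * (x / n - 1) := by gcongr
    have h' : n * (x / n - 1) = x - n := by field_simp
    linarith
  have ht1 : x - n ≤ 1 := by linarith
  have c3 : (x - n) * Real.log (1+n) ≤ (x-n) * Real.log n + 1 := by nlinarith
  have c4 : (x - n) * Real.log x ≤ (x-n) * Real.log n + 1 := by nlinarith
  rw [abs_le] at hb ⊢
  unfold hst at *
  constructor <;> nlinarith [hb.1, hb.2]

lemma Gamma_ge_pos : ∃ c > 0, ∀ x : ℝ, 1 ≤ x → c ≤ Real.Gamma x := by
  refine ⟨Real.Gamma 1 * 0 + 1/2, by norm_num, fun x hx => ?_⟩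
  by_cases h2 : 2 ≤ x
  · have := Real.Gamma_strictMonoOn_Ici.monotoneOn (Set.mem_Ici.2 le_rfl) (Set.mem_Ici.2 h2) h2
    simp [Real.Gamma_two] at this ⊢; linarith
  · have h : 2 ≤ x + 1 := by linarith
    have := Real.Gamma_strictMonoOn_Ici.monotoneOn (Set.mem_Ici.2 le_rfl) (Set.mem_Ici.2 h) h
    rw [Real.Gamma_two, Real.Gamma_add_one (by linarith)] at this
    have hp := Real.Gamma_pos_of_pos (by linarith : 0 < x)
    nlinarith

end

section
def gr (n : ℝ) : ℝ := 1 + n ^ (3/2 : ℝ)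

lemma gr_one {n : ℝ} (hn : 0 ≤ n) : 1 ≤ gr n := by
  have := Real.rpow_nonneg hn (3/2); unfold gr; linarith

lemma gr_mono {m n : ℝ} (hm : 0 ≤ m) (hn : m ≤ n) : gr m ≤ gr n := by
  unfold gr; gcongr

lemma gr_self {n : ℝ} (hn : 0 ≤ n) : n ≤ gr n := by
  unfold gr
  by_cases h : n ≤ 1
  · have := Real.rpow_nonneg hn (3/2); linarith
  · have := Real.rpow_le_rpow_of_exponent_le (not_le.1 h).le (by norm_num : (1:ℝ) ≤ 3/2)
    rw [Real.rpow_one] at this; linarith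

lemma gr_log {x : ℝ} (hx : 0 < x) : x * Real.log x ≤ 2 * gr x := by
  have h := Real.log_le_rpow_div hx.le (by norm_num : (0:ℝ) < 1/2)
  have h2 : x * (x ^ (1/2:ℝ) / (1/2)) = 2 * x ^ (3/2:ℝ) := by
    have : x ^ (3/2:ℝ) = x * x ^ (1/2:ℝ) := by
      rw [show (3/2:ℝ) = 1 + 1/2 by norm_num, Real.rpow_add hx, Real.rpow_one]
    rw [this]; ring
  have := mul_le_mul_of_nonneg_left h hx.le
  unfold gr; linarith

lemma gr_mul {n : ℝ} (hn : 0 ≤ n) {d : ℕ} (hd : 1 ≤ d) : gr (n * d) ≤ d ^ 2 * gr n := by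
  have hd' : (1:ℝ) ≤ d := by exact_mod_cast hd
  have h1 : (d:ℝ) ^ (3/2:ℝ) ≤ d ^ 2 := by
    rw [← Real.rpow_natCast]; exact Real.rpow_le_rpow_of_exponent_le hd' (by norm_num)
  unfold gr
  rw [Real.mul_rpow hn (by positivity)]
  have := Real.rpow_nonneg hn (3/2)
  nlinarith

lemma pl_half {f : ℂ → ℂ} (hf : Differentiable ℂ f) {C B : ℝ} (hx : ∀ y : ℝ, ‖f (y * Complex.I)‖ ≤ C)
    (hy : ∀ ε > 0, ∃ C' : ℝ, ∀ x : ℝ, 0 ≤ x → ‖f x‖ ≤ C' * Real.exp (ε * x))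
    (hg : ∀ k, ‖f k‖ ≤ Real.exp (B * gr ‖k‖)) (z : ℂ) (hz : 0 ≤ z.re) : ‖f z‖ ≤ C := by
  have key : ∀ ε : ℝ, 0 < ε → ‖f z * Complex.exp (-(ε * z))‖ ≤ C := by
    intro ε hε
    have hd : Differentiable ℂ (fun z => f z * Complex.exp (-(ε * z))) := by fun_prop
    refine PhragmenLindelof.right_half_plane_of_bounded_on_real (f := fun z => f z * Complex.exp (-(ε * z)))
      hd.diffContOnCl ⟨3/2, by norm_num, B, ?_⟩ ?_ ?_ hz
    · refine Asymptotics.IsBigO.of_bound (Real.exp B) ?_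
      refine Filter.Eventually.filter_mono inf_le_right ?_
      rw [Filter.eventually_principal]
      intro w hw
      rw [norm_mul, Complex.norm_exp, Real.norm_eq_abs, Real.abs_exp, ← Real.exp_add]
      have h1 : Real.exp (-(ε * w)).re ≤ 1 := by
        rw [Real.exp_le_one_iff]; simp; exact (mul_pos hε hw).le
      calc _ ≤ Real.exp (B * gr ‖w‖) * 1 := by gcongr; exact hg w
        _ = _ := by unfold gr; rw [mul_one]; ring_nf
    · obtain ⟨C', hC'⟩ := hy ε hε
      refine ⟨C', ?_⟩
      rw [Filter.eventually_map]
      filter_upwards [Filter.eventually_ge_atTop 0] with x hx0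
      rw [norm_mul, Complex.norm_exp]
      have := hC' x hx0
      have e : (-(ε * (x:ℂ))).re = -(ε * x) := by simp
      rw [e, Real.exp_neg, mul_inv_le_iff₀ (Real.exp_pos _)]
      exact this
    · intro y
      rw [norm_mul, Complex.norm_exp]
      simpa using hx y
  have ht : Filter.Tendsto (fun ε : ℝ => ‖f z * Complex.exp (-(ε * z))‖) (nhdsWithin 0 (Set.Ioi 0)) (nhds ‖f z‖) := by
    have hc : Continuous (fun ε : ℝ => ‖f z * Complex.exp (-(ε * z))‖) := by fun_prop
    have := (hc.tendsto 0).mono_left (nhdsWithin_le_nhds (s := Set.Ioi 0))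
    simpa using this
  refine le_of_tendsto ht ?_
  filter_upwards [self_mem_nhdsWithin] with ε hε using key ε hε

lemma pl_const {Q : ℂ → ℂ} (hf : Differentiable ℂ Q) {C B : ℝ} (hx : ∀ x : ℝ, ‖Q x‖ ≤ C)
    (hy : ∀ ε > 0, ∃ C' : ℝ, ∀ y : ℝ, ‖Q (y * Complex.I)‖ ≤ C' * Real.exp (ε * |y|))
    (hg : ∀ k, ‖Q k‖ ≤ Real.exp (B * gr ‖k‖)) (z : ℂ) : Q z = Q 0 := by
  apply hf.apply_eq_apply_of_bounded
  refine (isBounded_iff_forall_norm_le).2 ⟨C, ?_⟩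
  rintro _ ⟨w, rfl⟩
  have hI : ∀ z : ℂ, z = Complex.I * (-Complex.I * z) := fun z => by
    rw [← mul_assoc, mul_neg, Complex.I_mul_I]; ring
  have hI' : ∀ z : ℂ, z = -Complex.I * (Complex.I * z) := fun z => by
    rw [← mul_assoc, neg_mul, Complex.I_mul_I]; ring
  rcases le_total 0 w.im with h | h
  · rw [hI w]
    refine pl_half (f := fun z => Q (Complex.I * z)) (by fun_prop) (B := B) ?_ ?_ ?_ _ (by simpa using h)
    · intro y
      have : Complex.I * (y * Complex.I) = ((-y : ℝ) : ℂ) := by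
        rw [mul_comm (y:ℂ), ← mul_assoc, Complex.I_mul_I]; simp
      simp only [this]; exact hx _
    · intro ε hε
      obtain ⟨C', h'⟩ := hy ε hε
      refine ⟨C', fun x hx0 => ?_⟩
      have := h' x
      rwa [abs_of_nonneg hx0, mul_comm] at this
    · intro k
      have := hg (Complex.I * k); simpa using this
  · rw [hI' w]
    refine pl_half (f := fun z => Q (-Complex.I * z)) (by fun_prop) (B := B) ?_ ?_ ?_ _ (by simpa using h)
    · intro y
      have : -Complex.I * (y * Complex.I) = ((y : ℝ) : ℂ) := by
        rw [mul_comm (y:ℂ), ← mul_assoc, neg_mul, Complex.I_mul_I]; simp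
      simp only [this]; exact hx _
    · intro ε hε
      obtain ⟨C', h'⟩ := hy ε hε
      refine ⟨C', fun x hx0 => ?_⟩
      have := h' (-x)
      rw [abs_neg, abs_of_nonneg hx0] at this
      convert this using 3
      push_cast; ring
    · intro k
      have := hg (-Complex.I * k); simpa using this

lemma Gamma_real_ub : ∃ B, 0 ≤ B ∧ ∀ x : ℝ, 0 ≤ x → Real.Gamma (1 + x) ≤ Real.exp (B * gr x) := by
  obtain ⟨C, hC⟩ := stirling
  refine ⟨|C| + 3, by positivity, fun x hx => ?_⟩
  by_cases h : x ≤ 1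
  · have h1 := Real.convexOn_Gamma.le_max_of_mem_Icc (x := 1) (y := 2) (z := 1 + x) (by simp) (by simp)
      ⟨by linarith, by linarith⟩
    rw [Real.Gamma_one, Real.Gamma_two, max_self] at h1
    refine h1.trans (Real.one_le_exp ?_)
    have := gr_one hx
    positivity
  · have h1 := (not_le.1 h).le
    have h2 := (abs_le.1 (hC x h1)).2
    have hx0 : 0 < x := by linarith
    rw [← Real.log_le_iff_le_exp (Real.Gamma_pos_of_pos (by linarith))]
    have h3 := gr_log hx0
    have h4 := gr_one hx
    have h5 := Real.log_le_sub_one_of_pos hx0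
    have h6 := le_abs_self C
    have h7 := gr_self hx
    have h8 := abs_nonneg C
    unfold hst at h2
    nlinarith

lemma Gamma_cub : ∃ B, 0 ≤ B ∧ ∀ k : ℂ, 0 ≤ k.re → ∀ d : ℕ, 1 ≤ d →
    ‖Complex.Gamma (1 + k * d)‖ ≤ Real.exp (B * d ^ 2 * gr ‖k‖) ∧
    ‖Complex.Gamma (1 + k * d)‖⁻¹ ≤ Real.exp (B * d ^ 2 * gr ‖k‖) := by
  obtain ⟨B, hB, hU⟩ := Gamma_real_ub
  obtain ⟨c, hc, hL⟩ := Gamma_ge_pos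
  refine ⟨B + 2 + |Real.log c|, by positivity, fun k hk d hd => ?_⟩
  have hd1 : (1:ℝ) ≤ d := by exact_mod_cast hd
  have hre : (1 + k * d : ℂ).re = 1 + k.re * d := by simp
  have hkd : 0 ≤ k.re * d := by positivity
  have hg1 := gr_one (norm_nonneg k)
  have habs := abs_nonneg (Real.log c)
  constructor
  · refine (norm_Gamma_le (by rw [hre]; linarith)).trans ?_
    rw [hre]
    refine (hU _ hkd).trans (Real.exp_le_exp.2 ?_)
    have h1 := gr_mul hk hd
    have h2 := gr_mono hk (Complex.re_le_norm k)
    calc B * gr (k.re * d) ≤ B * (d^2 * gr ‖k‖) := by gcongr; exact h1.trans (by gcongr)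
      _ ≤ _ := by rw [mul_assoc]; gcongr; linarith
  · have h1 := norm_Gamma_ge (x := 1 + k.re * d) (y := k.im * d) (by linarith)
    have h2 := norm_Gamma_imag_ge (k.im * d)
    have h3 := hL (1 + k.re * d) (by linarith)
    have e : ((1 + k.re * d : ℝ) : ℂ) + ((k.im * d : ℝ) : ℂ) * Complex.I = 1 + k * d := by
      apply Complex.ext <;> simp
    rw [e] at h1
    have h4 : c * Real.exp (-(Real.pi * |k.im * d| / 2)) ≤ ‖Complex.Gamma (1 + k * d)‖ :=
      le_trans (by gcongr) h1
    have hpos : 0 < c * Real.exp (-(Real.pi * |k.im * d| / 2)) := by positivity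
    refine (inv_anti₀ hpos h4).trans ?_
    rw [mul_inv, Real.exp_neg, inv_inv]
    have h5 : c⁻¹ ≤ Real.exp |Real.log c| := by
      rw [← Real.exp_log (inv_pos.2 hc), Real.log_inv]; exact Real.exp_le_exp.2 (neg_le_abs _)
    refine (mul_le_mul_of_nonneg_right h5 (Real.exp_pos _).le).trans ?_
    rw [← Real.exp_add]
    refine Real.exp_le_exp.2 ?_
    have h6 : |k.im * d| ≤ ‖k‖ * d := by
      rw [abs_mul, abs_of_pos (by linarith : (0:ℝ) < d)]; gcongr; exact Complex.abs_im_le_norm k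
    have h7 := gr_self (norm_nonneg k)
    have h8 : ‖k‖ * d ≤ gr ‖k‖ * d^2 := by
      have : (d:ℝ) ≤ d^2 := by nlinarith
      gcongr
    have h9 : Real.pi * |k.im * d| / 2 ≤ 2 * (d^2 * gr ‖k‖) := by
      have := Real.pi_le_four
      have := abs_nonneg (k.im * d)
      nlinarith
    have h10 : 1 ≤ d^2 * gr ‖k‖ := by nlinarith
    nlinarith

end

section
def tf (d : ℕ) (k : ℂ) : ℂ := Complex.Gamma (1 + k * d) / Complex.Gamma (1 + k)

lemma Gamma_ne {k : ℂ} (h : 0 < 1 + k.re) : Complex.Gamma (1 + k) ≠ 0 :=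
  Complex.Gamma_ne_zero_of_re_pos (by simpa using h)

lemma tf_ne {d : ℕ} {k : ℂ} (hk : 0 ≤ k.re) : tf d k ≠ 0 := by
  refine div_ne_zero (Gamma_ne ?_) (Gamma_ne (by linarith))
  have : (k * d).re = k.re * d := by simp
  rw [this]; positivity

lemma tf_diff {d : ℕ} {k : ℂ} (hk : 0 < 1 + k.re * d) : DifferentiableAt ℂ (tf d) k := by
  have h1 : DifferentiableAt ℂ (fun k : ℂ => (Complex.Gamma (1 + k))⁻¹) k :=
    (Complex.differentiable_one_div_Gamma (1+k)).comp k (by fun_prop)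
  have h2 : DifferentiableAt ℂ (fun k : ℂ => Complex.Gamma (1 + k * d)) k := by
    refine DifferentiableAt.comp (g := Complex.Gamma) k (Complex.differentiableAt_Gamma _ fun m hm => ?_) (by fun_prop)
    have := congrArg Complex.re hm
    simp at this
    have h : (0:ℝ) ≤ m := by positivity
    linarith
  exact (h2.mul h1).congr_of_eventuallyEq (Filter.Eventually.of_forall fun k => by
    simp [tf, div_eq_mul_inv])

lemma Gamma_refl {k : ℂ} (hk : k ≠ 0) (h1 : k.re < 1) (h0 : 0 < k.re) :
    Complex.Gamma (1 + k) * Complex.Gamma (1 - k) * Complex.sin (Real.pi * k) = Real.pi * k := by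
  have h := Complex.Gamma_mul_Gamma_one_sub k
  have h2 := Complex.Gamma_add_one _ hk
  have hs : Complex.sin (Real.pi * k) ≠ 0 := by
    intro hs
    rw [hs, div_zero] at h
    have := mul_ne_zero (Complex.Gamma_ne_zero_of_re_pos h0) (Complex.Gamma_ne_zero_of_re_pos (s := 1 - k) (by simpa using h1))
    exact this h
  rw [add_comm, h2, mul_assoc k, h, mul_assoc, div_mul_cancel₀ _ hs]
  ring

lemma tf_refl {d : ℕ} (hd : 1 ≤ d) {k : ℂ} (h0 : 0 < k.re) (h1 : k.re * d < 1) :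
    tf d k * tf d (-k) * Complex.sin (Real.pi * k * d) = d * Complex.sin (Real.pi * k) ∧
      Complex.sin (Real.pi * k) ≠ 0 := by
  have hd1 : (1:ℝ) ≤ d := by exact_mod_cast hd
  have hk1 : k.re < 1 := by nlinarith
  have hk : k ≠ 0 := by rintro rfl; simp at h0
  have hdC : (d:ℂ) ≠ 0 := by exact_mod_cast (by omega : d ≠ 0)
  have a1 := Gamma_refl hk hk1 h0
  have a2 := Gamma_refl (k := k * d) (mul_ne_zero hk hdC) (by simpa using h1) (by simp; positivity)
  have b1 : Complex.Gamma (1 + k) ≠ 0 := Gamma_ne (by linarith)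
  have b2 : Complex.Gamma (1 - k) ≠ 0 := by rw [sub_eq_add_neg]; exact Gamma_ne (by simp; linarith)
  have hp : (Real.pi : ℂ) ≠ 0 := by exact_mod_cast Real.pi_ne_zero
  have hs : Complex.sin (Real.pi * k) ≠ 0 := by
    intro hs; rw [hs, mul_zero] at a1; exact mul_ne_zero hp hk a1.symm
  refine ⟨?_, hs⟩
  unfold tf
  rw [neg_mul, ← sub_eq_add_neg, ← sub_eq_add_neg, div_mul_div_comm, div_mul_eq_mul_div,
    div_eq_iff (mul_ne_zero b1 b2), mul_assoc (Real.pi : ℂ), a2]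
  linear_combination -(d:ℂ) * a1

lemma tf_real {d : ℕ} (hd : 1 ≤ d) : ∃ C, ∀ x : ℝ, 1 ≤ x →
    |Real.log ‖tf d x‖ - x * ((d - 1 : ℝ) * Real.log x + (d * Real.log d - (d - 1)))| ≤ C := by
  obtain ⟨C, hC⟩ := stirling
  have hd1 : (1:ℝ) ≤ d := by exact_mod_cast hd
  have hl : 0 ≤ Real.log d := Real.log_nonneg hd1
  refine ⟨2 * C + Real.log d, fun x hx => ?_⟩
  have hxd : 1 ≤ x * d := by nlinarith
  have h1 := abs_le.1 (hC x hx)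
  have h2 := abs_le.1 (hC (x * d) hxd)
  have hx0 : 0 < x := by linarith
  have e : ‖tf d x‖ = Real.Gamma (1 + x * d) / Real.Gamma (1 + x) := by
    have : tf d x = ((Real.Gamma (1 + x * d) / Real.Gamma (1 + x) : ℝ) : ℂ) := by
      unfold tf; push_cast [← Complex.Gamma_ofReal]; rfl
    rw [this, Complex.norm_real, Real.norm_eq_abs, abs_of_pos]
    exact div_pos (Real.Gamma_pos_of_pos (by linarith)) (Real.Gamma_pos_of_pos (by linarith))
  rw [e, Real.log_div (Real.Gamma_pos_of_pos (by linarith)).ne' (Real.Gamma_pos_of_pos (by linarith)).ne']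
  unfold hst at h1 h2
  rw [Real.log_mul hx0.ne' (by linarith)] at h2
  rw [abs_le]; constructor <;> nlinarith [h1.1, h1.2, h2.1, h2.2]

lemma tf_imag {d : ℕ} (hd : 1 ≤ d) (y : ℝ) :
    ‖tf d (y * Complex.I)‖⁻¹ ≤ Real.exp (Real.pi / 2 * ((d - 1 : ℝ) * |y|)) := by
  have h := Gamma_imag_ratio y d hd
  have e : (1 + (y * Complex.I) * d : ℂ) = 1 + (y * d : ℝ) * Complex.I := by push_cast; ring
  unfold tf
  rw [e, norm_div, inv_div, div_le_iff₀]
  · exact h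
  · exact norm_pos_iff.2 (Gamma_ne (by simp))

def TT {r : ℕ} (d : Fin r → ℕ) (k : ℂ) : ℂ := ∏ i, tf (d i) k

variable {r : ℕ} {d : Fin r → ℕ}

lemma TT_ne {k : ℂ} (hk : 0 ≤ k.re) : TT d k ≠ 0 := Finset.prod_ne_zero_iff.2 fun _ _ => tf_ne hk

lemma TT_diff {k : ℂ} (hk : ∀ i, 0 < 1 + k.re * d i) : DifferentiableAt ℂ (TT d) k := by
  have := DifferentiableAt.fun_finsetProd (u := Finset.univ) (f := fun i => tf (d i)) (x := k) (𝕜 := ℂ)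
    (fun i _ => tf_diff (hk i))
  exact this

lemma TT_diff' {k : ℂ} (hk : 0 ≤ k.re) : DifferentiableAt ℂ (TT d) k :=
  TT_diff fun _ => by positivity

lemma TT_zero : TT d 0 = 1 := by simp [TT, tf]

lemma TT_growth (hd : ∀ i, 1 ≤ d i) : ∃ B, 0 ≤ B ∧ ∀ k : ℂ, 0 ≤ k.re →
    ‖TT d k‖ ≤ Real.exp (B * gr ‖k‖) ∧ ‖TT d k‖⁻¹ ≤ Real.exp (B * gr ‖k‖) := by
  obtain ⟨B, hB, h⟩ := Gamma_cub
  refine ⟨∑ i, B * ((d i:ℝ) ^ 2 + 1), by positivity, fun k hk => ?_⟩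
  have h1 := h k hk 1 le_rfl
  simp only [Nat.cast_one, mul_one, one_pow] at h1
  rw [Finset.sum_mul, Real.exp_sum, TT, norm_prod, ← Finset.prod_inv_distrib]
  constructor
  · refine Finset.prod_le_prod (fun _ _ => norm_nonneg _) fun i _ => ?_
    rw [tf, norm_div, div_eq_mul_inv, mul_add, add_mul, Real.exp_add, mul_one]
    exact mul_le_mul (h k hk (d i) (hd i)).1 h1.2 (by positivity) (by positivity)
  · refine Finset.prod_le_prod (fun _ _ => by positivity) fun i _ => ?_
    rw [tf, norm_div, inv_div, div_eq_mul_inv, mul_add, add_mul, Real.exp_add, mul_one, mul_comm]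
    exact mul_le_mul (h k hk (d i) (hd i)).2 h1.1 (by positivity) (by positivity)

lemma TT_real (hd : ∀ i, 1 ≤ d i) {N : ℕ} (hN : N + r = ∑ i, d i) : ∃ C D, ∀ x : ℝ, 1 ≤ x →
    |Real.log ‖TT d x‖ - x * (N * Real.log x + D)| ≤ C := by
  choose C hC using fun i => tf_real (hd i)
  refine ⟨∑ i, C i, ∑ i, (d i * Real.log (d i) - (d i - 1)), fun x hx => ?_⟩
  have hN' : (N:ℝ) = ∑ i, ((d i : ℝ) - 1) := by
    have : (N:ℝ) + r = ∑ i, (d i : ℝ) := by exact_mod_cast hN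
    simp; linarith
  have e : Real.log ‖TT d x‖ - x * (N * Real.log x + ∑ i, (d i * Real.log (d i) - (d i - 1))) =
      ∑ i, (Real.log ‖tf (d i) x‖ - x * ((d i - 1 : ℝ) * Real.log x + (d i * Real.log (d i) - (d i - 1)))) := by
    rw [TT, norm_prod, Real.log_prod (fun i _ => norm_ne_zero_iff.2 (tf_ne (by simp; linarith))), hN', Finset.sum_mul,
      ← Finset.sum_add_distrib, Finset.mul_sum, ← Finset.sum_sub_distrib]
  rw [e]
  exact (Finset.abs_sum_le_sum_abs _ _).trans (Finset.sum_le_sum fun i _ => hC i x hx)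

lemma TT_imag (hd : ∀ i, 1 ≤ d i) {N : ℕ} (hN : N + r = ∑ i, d i) (y : ℝ) :
    ‖TT d (y * Complex.I)‖⁻¹ ≤ Real.exp (Real.pi / 2 * (N * |y|)) := by
  have hN' : (N:ℝ) = ∑ i, ((d i : ℝ) - 1) := by
    have : (N:ℝ) + r = ∑ i, (d i : ℝ) := by exact_mod_cast hN
    simp; linarith
  rw [hN', Finset.sum_mul, Finset.mul_sum, Real.exp_sum, TT, norm_prod, ← Finset.prod_inv_distrib]
  exact Finset.prod_le_prod (fun _ _ => by positivity) fun i _ => tf_imag (hd i) y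

section
variable {F E Z : ℂ → ℂ}

def RR (d : Fin r → ℕ) (F E : ℂ → ℂ) (k : ℂ) : ℂ :=
  if 0 < k.re then F k / TT d k else E k * TT d (-k) / ∏ i, (d i : ℂ)

lemma RR_agree (hd : ∀ i, 1 ≤ d i) (hEF : ∀ k : ℂ, 0 ≤ k.re → E k = F k * Z k)
    (hZ : ∀ k, Z k * Complex.sin (Real.pi * k) ^ r = ∏ i, Complex.sin (Real.pi * k * d i))
    {k : ℂ} (hk : ∀ i, k.re * d i < 1) : RR d F E k = E k * TT d (-k) / ∏ i, (d i : ℂ) := by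
  unfold RR
  split_ifs with h0
  swap
  · rfl
  have hdp : (∏ i, (d i : ℂ)) ≠ 0 := Finset.prod_ne_zero_iff.2 fun i _ => by
    have := hd i; exact_mod_cast (by omega : d i ≠ 0)
  rw [div_eq_div_iff (TT_ne h0.le) hdp, hEF k h0.le]
  suffices hz : Z k * (TT d k * TT d (-k)) = ∏ i, (d i : ℂ) by
    rw [← hz]; ring
  have hs : ∏ i : Fin r, Complex.sin (Real.pi * k) ≠ 0 := Finset.prod_ne_zero_iff.2 fun i _ =>
    (tf_refl (hd i) h0 (hk i)).2
  refine mul_right_cancel₀ hs ?_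
  have hz := hZ k
  calc Z k * (TT d k * TT d (-k)) * ∏ i : Fin r, Complex.sin (Real.pi * k)
      = (Z k * Complex.sin (Real.pi * k) ^ r) * (TT d k * TT d (-k)) := by simp; ring
    _ = ∏ i, (tf (d i) k * tf (d i) (-k) * Complex.sin (Real.pi * k * d i)) := by
        rw [hz]; simp only [TT, Finset.prod_mul_distrib]; ring
    _ = ∏ i, ((d i : ℂ) * Complex.sin (Real.pi * k)) :=
        Finset.prod_congr rfl fun i _ => (tf_refl (hd i) h0 (hk i)).1
    _ = _ := Finset.prod_mul_distrib

lemma RR_diff (hd : ∀ i, 1 ≤ d i) (hEF : ∀ k : ℂ, 0 ≤ k.re → E k = F k * Z k)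
    (hZ : ∀ k, Z k * Complex.sin (Real.pi * k) ^ r = ∏ i, Complex.sin (Real.pi * k * d i))
    (hFd : ∀ k : ℂ, 0 < k.re → DifferentiableAt ℂ F k) (hE : Differentiable ℂ E) :
    Differentiable ℂ (RR d F E) := by
  intro k
  by_cases h0 : 0 < k.re
  · have h : DifferentiableAt ℂ (fun k => F k / TT d k) k := (hFd k h0).div (TT_diff' h0.le) (TT_ne h0.le)
    refine h.congr_of_eventuallyEq ?_
    filter_upwards [(isOpen_lt continuous_const Complex.continuous_re).mem_nhds h0] with z hz
    exact if_pos hz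
  · have hk : ∀ i, k.re * d i < 1 := fun i => by
      have : k.re * d i ≤ 0 := mul_nonpos_of_nonpos_of_nonneg (not_lt.1 h0) (by positivity)
      linarith
    have h1 : DifferentiableAt ℂ (fun k => TT d (-k)) k :=
      DifferentiableAt.comp (g := TT d) k (TT_diff fun i => by simp; linarith [hk i]) (by fun_prop)
    have h : DifferentiableAt ℂ (fun k => E k * TT d (-k) / ∏ i, (d i : ℂ)) k := (hE.differentiableAt.mul h1).div_const _
    refine h.congr_of_eventuallyEq ?_
    have : ∀ᶠ z : ℂ in nhds k, ∀ i, z.re * (d i : ℝ) < 1 := Filter.eventually_all.2 fun i =>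
      (isOpen_lt (f := fun z : ℂ => z.re * (d i : ℝ)) (by fun_prop) continuous_const).mem_nhds (hk i)
    filter_upwards [this] with z hz
    exact RR_agree hd hEF hZ hz

lemma RR_eq (hRd : Differentiable ℂ (RR d F E)) (hFc : ContinuousOn F {k | 0 ≤ k.re}) {k : ℂ} (hk : 0 ≤ k.re) :
    RR d F E k = F k / TT d k := by
  have hp : Filter.Tendsto (fun t : ℝ => k + t) (nhdsWithin 0 (Set.Ioi 0)) (nhdsWithin k {k | 0 ≤ k.re}) := by
    refine tendsto_nhdsWithin_of_tendsto_nhds_of_eventually_within _ ?_ ?_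
    · have hc : Continuous (fun t : ℝ => k + (t:ℂ)) := by fun_prop
      have := (hc.tendsto 0).mono_left (nhdsWithin_le_nhds (s := Set.Ioi 0))
      simpa using this
    · filter_upwards [self_mem_nhdsWithin] with t ht
      have : (0:ℝ) < t := ht
      simp; linarith
  have h1 := (hRd.continuous.continuousAt.continuousWithinAt (s := {k | 0 ≤ k.re}) (x := k)).tendsto.comp hp
  have h2 := ((hFc k hk).div (TT_diff' (d := d) hk).continuousAt.continuousWithinAt (TT_ne hk)).tendsto.comp hp
  refine tendsto_nhds_unique h1 (h2.congr' ?_)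
  filter_upwards [self_mem_nhdsWithin] with t ht
  have ht' : (0:ℝ) < t := ht
  have : 0 < (k + t).re := by simp; linarith
  simp only [RR, Function.comp_apply, if_pos this, Pi.div_apply]
end

end

section
theorem abs_main {r : ℕ} {d : Fin r → ℕ} {F E Z : ℂ → ℂ} (hd : ∀ i, 1 ≤ d i) {N : ℕ} (hN : N + r = ∑ i, d i) {A a : ℝ} (hA : 0 ≤ A)
    (hFc : ContinuousOn F {k | 0 ≤ k.re}) (hFd : ∀ k : ℂ, 0 < k.re → DifferentiableAt ℂ F k)
    (hE : Differentiable ℂ E) (hEF : ∀ k : ℂ, 0 ≤ k.re → E k = F k * Z k)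
    (hZ : ∀ k, Z k * Complex.sin (Real.pi * k) ^ r = ∏ i, Complex.sin (Real.pi * k * d i))
    (hF1 : ∀ k : ℂ, 0 < k.re → ‖F k‖ ≤ A * Real.exp (k.re * (a + N * Real.log k.re)))
    (hE1 : ∀ κ : ℝ, 0 < κ → ‖E (-κ)‖ ≤ A * Real.exp (-(κ * (a + N * Real.log κ))))
    (hE2 : ∃ C c : ℝ, 0 < C ∧ 0 ≤ c ∧ ∀ k : ℂ, k.re ≤ 0 → ‖E k‖ ≤ C * Real.exp (c * ‖k‖))
    (hFi : ∀ φ : ℝ, 0 ≤ φ → φ < Real.pi / 2 → ∃ C > 0, ∀ t : ℝ, ‖F (t * Complex.I)‖ ≤ C * Real.exp (-(φ * N * |t|)))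
    (hF0 : F 0 = 1) : ∃ c : ℝ, ∀ k : ℂ, 0 < k.re → F k = Complex.exp (c * k) * TT d k := by
  have hRd := RR_diff hd hEF hZ hFd hE
  have hReq := fun {k} => RR_eq hRd hFc (k := k)
  obtain ⟨C, D, hTr⟩ := TT_real hd hN
  obtain ⟨B, hB, hTg⟩ := TT_growth hd
  have hdp : 1 ≤ ∏ i, (d i : ℝ) := by
    have : 1 ≤ ∏ i, d i := Finset.one_le_prod' fun i _ => hd i
    exact_mod_cast this
  have hdn : ‖∏ i, (d i : ℂ)‖ = ∏ i, (d i : ℝ) := by simp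
  have hR' : ∀ k : ℂ, k.re ≤ 0 → ‖RR d F E k‖ ≤ ‖E k‖ * ‖TT d (-k)‖ := fun k hk => by
    rw [RR, if_neg (not_lt.2 hk), norm_div, norm_mul, hdn]
    exact div_le_self (by positivity) hdp
  set c := a - D with hc
  refine ⟨c, fun k hk => ?_⟩
  set Q : ℂ → ℂ := fun k => RR d F E k * Complex.exp (-(c * k)) with hQ
  have hQd : Differentiable ℂ Q := by
    have : Differentiable ℂ fun k : ℂ => Complex.exp (-(c * k)) := by fun_prop
    exact hRd.mul this
  have hQn : ∀ k, ‖Q k‖ = ‖RR d F E k‖ * Real.exp (-(c * k.re)) := fun k => by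
    rw [hQ]; simp only [norm_mul, Complex.norm_exp]; simp
  have hTpos : ∀ x : ℝ, 1 ≤ x → 0 < ‖TT d x‖ := fun x hx => norm_pos_iff.2 (TT_ne (by simp; linarith))
  -- real axis
  obtain ⟨C0, hC0⟩ := (isCompact_Icc (a := (-1:ℝ)) (b := 1)).exists_bound_of_continuousOn
    (f := fun x : ℝ => Q x) (hQd.continuous.comp Complex.continuous_ofReal).continuousOn
  have hx : ∀ x : ℝ, ‖Q x‖ ≤ max C0 (A * Real.exp C) := by
    intro x
    by_cases h1 : 1 ≤ x
    · refine le_trans ?_ (le_max_right _ _)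
      have hx0 : 0 < ((x:ℂ)).re := by simp; linarith
      have h2 := hF1 x hx0
      have h3 := abs_le.1 (hTr x h1)
      rw [hQn, hReq hx0.le, norm_div]
      simp only [Complex.ofReal_re] at *
      have h4 : ‖TT d x‖⁻¹ ≤ Real.exp (C - x * (N * Real.log x + D)) := by
        rw [← Real.exp_log (inv_pos.2 (hTpos x h1)), Real.log_inv]
        exact Real.exp_le_exp.2 (by linarith [h3.1])
      calc _ ≤ A * Real.exp (x * (a + N * Real.log x)) * Real.exp (C - x * (N * Real.log x + D)) * Real.exp (-(c * x)) := by
            rw [div_eq_mul_inv]; gcongr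
        _ = A * Real.exp C := by
            rw [mul_assoc, mul_assoc, ← Real.exp_add, ← Real.exp_add]; congr 2; rw [hc]; ring
    by_cases h2 : x ≤ -1
    · refine le_trans ?_ (le_max_right _ _)
      have hx1 : 1 ≤ -x := by linarith
      have h3 := hE1 (-x) (by linarith)
      have h4 := abs_le.1 (hTr (-x) hx1)
      have h5 := hR' x (by simp; linarith)
      have h6 : ‖TT d (-x : ℝ)‖ ≤ Real.exp (C + -x * (N * Real.log (-x) + D)) := by
        rw [← Real.exp_log (hTpos (-x) hx1)]
        exact Real.exp_le_exp.2 (by linarith [h4.2])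
      rw [hQn]
      push_cast at h3 h6
      rw [neg_neg] at h3
      simp only [Complex.ofReal_re]
      calc _ ≤ (A * Real.exp (-(-x * (a + N * Real.log (-x))))) * Real.exp (C + -x * (N * Real.log (-x) + D)) * Real.exp (-(c * x)) := by
            gcongr; exact h5.trans (by gcongr)
        _ = A * Real.exp C := by
            rw [mul_assoc, mul_assoc, ← Real.exp_add, ← Real.exp_add]; congr 2; rw [hc]; ring
    · exact (hC0 x ⟨by linarith, by linarith⟩).trans (le_max_left _ _)
  have hy : ∀ ε > 0, ∃ C' : ℝ, ∀ y : ℝ, ‖Q (y * Complex.I)‖ ≤ C' * Real.exp (ε * |y|) := by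
    intro ε hε
    have hN1 : (0:ℝ) < N + 1 := by positivity
    have hpi := Real.pi_pos
    obtain ⟨C', hC', h⟩ := hFi (Real.pi / 2 - min (ε / (N+1)) (Real.pi/2)) (by linarith [min_le_right (ε / (N+1)) (Real.pi/2)])
      (by have : 0 < min (ε / (N+1)) (Real.pi/2) := lt_min (by positivity) (by positivity)
          linarith)
    refine ⟨C', fun y => ?_⟩
    rw [hQn, hReq (by simp), norm_div, div_eq_mul_inv]
    have h1 := h y
    have h2 := TT_imag hd hN y
    have e : ((y:ℂ) * Complex.I).re = 0 := by simp
    rw [e, mul_zero, neg_zero, Real.exp_zero, mul_one]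
    refine (mul_le_mul h1 h2 (by positivity) (by positivity)).trans ?_
    rw [mul_assoc, ← Real.exp_add]
    gcongr
    have h3 : min (ε / (N+1)) (Real.pi/2) * N ≤ ε := by
      calc _ ≤ (ε / (N+1)) * N := by gcongr; exact min_le_left _ _
        _ ≤ (ε / (N+1)) * (N+1) := by gcongr; linarith
        _ = ε := by field_simp
    have := mul_le_mul_of_nonneg_right h3 (abs_nonneg y)
    linarith
  obtain ⟨C1, c1, hC1, hc1, hE2⟩ := hE2
  have hg : ∀ k, ‖Q k‖ ≤ Real.exp ((A + |a| + 2 * N + B + |c| + C1 + c1) * gr ‖k‖) := by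
    intro k
    have g1 := gr_one (norm_nonneg k)
    have g2 := gr_self (norm_nonneg k)
    have ha := abs_nonneg a
    have hca := abs_nonneg c
    have hc' : Real.exp (-(c * k.re)) ≤ Real.exp (|c| * gr ‖k‖) := by
      refine Real.exp_le_exp.2 ?_
      calc -(c * k.re) ≤ |c * k.re| := neg_le_abs _
        _ = |c| * |k.re| := abs_mul _ _
        _ ≤ _ := by gcongr; exact (Complex.abs_re_le_norm k).trans g2
    have hself : ∀ t : ℝ, 0 ≤ t → t ≤ Real.exp (t * gr ‖k‖) := fun t ht => by
      have := Real.add_one_le_exp (t * gr ‖k‖); nlinarith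
    rw [hQn]
    by_cases h0 : 0 < k.re
    · rw [hReq h0.le, norm_div, div_eq_mul_inv]
      have hlog : k.re * (a + N * Real.log k.re) ≤ (|a| + 2 * N) * gr ‖k‖ := by
        have h1 : k.re * a ≤ |a| * gr ‖k‖ := by
          calc k.re * a ≤ k.re * |a| := by gcongr; exact le_abs_self a
            _ ≤ gr ‖k‖ * |a| := by gcongr; exact (Complex.re_le_norm k).trans g2
            _ = _ := mul_comm _ _
        have h2 : k.re * Real.log k.re ≤ 2 * gr ‖k‖ :=
          (gr_log h0).trans (by gcongr; exact gr_mono h0.le (Complex.re_le_norm k))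
        have h3 : N * (k.re * Real.log k.re) ≤ N * (2 * gr ‖k‖) := by gcongr
        linarith
      calc _ ≤ (Real.exp (A * gr ‖k‖) * Real.exp ((|a| + 2 * N) * gr ‖k‖)) * Real.exp (B * gr ‖k‖) * Real.exp (|c| * gr ‖k‖) := by
            gcongr
            · refine (hF1 k h0).trans ?_
              gcongr
              exact hself A hA
            · exact (hTg k h0.le).2
        _ ≤ _ := by
            rw [← Real.exp_add, ← Real.exp_add, ← Real.exp_add]
            refine Real.exp_le_exp.2 ?_
            nlinarith [mul_nonneg hC1.le (zero_le_one.trans g1), mul_nonneg hc1 (zero_le_one.trans g1)]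
    · have h0' := not_lt.1 h0
      calc _ ≤ (Real.exp (C1 * gr ‖k‖) * Real.exp (c1 * gr ‖k‖)) * Real.exp (B * gr ‖k‖) * Real.exp (|c| * gr ‖k‖) := by
            gcongr
            refine (hR' k h0').trans ?_
            gcongr
            · refine (hE2 k h0').trans ?_
              gcongr
              exact hself C1 hC1.le
            · have := (hTg (-k) (by simpa using h0')).1
              rwa [norm_neg] at this
        _ ≤ _ := by
            rw [← Real.exp_add, ← Real.exp_add, ← Real.exp_add]
            refine Real.exp_le_exp.2 ?_
            have hg0 := zero_le_one.trans g1
            have : 0 ≤ (A + |a| + 2 * N) * gr ‖k‖ := by positivity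
            nlinarith
  have hfin := pl_const hQd hx hy hg k
  have h0 : Q 0 = 1 := by
    simp only [hQ]
    rw [hReq (by simp), hF0, TT_zero]; simp
  rw [h0] at hfin
  simp only [hQ] at hfin
  rw [hReq hk.le, Complex.exp_neg, ← div_eq_mul_inv, div_div, div_eq_one_iff_eq] at hfin
  · rw [hfin, mul_comm]
  · exact mul_ne_zero (TT_ne hk.le) (Complex.exp_ne_zero _)

end

section
lemma householder {r : ℕ} (i0 : Fin r) {a : Fin r → ℝ} (ha : a ⬝ᵥ a = 2) :
    ∃ f : (Fin r → ℝ) →ₗ[ℝ] (Fin r → ℝ), (∀ x y, f x ⬝ᵥ f y = x ⬝ᵥ y) ∧ ∀ x, a ⬝ᵥ f x = Real.sqrt 2 * x i0 := by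
  set e : Fin r → ℝ := Pi.single i0 (Real.sqrt 2) with he
  have hex : ∀ x, e ⬝ᵥ x = Real.sqrt 2 * x i0 := fun x => by rw [he, single_dotProduct]
  have hee : e ⬝ᵥ e = 2 := by rw [hex, he, Pi.single_eq_same, Real.mul_self_sqrt (by norm_num)]
  by_cases hae : a = e
  · exact ⟨LinearMap.id, fun x y => rfl, fun x => by rw [hae, ← hex]; rfl⟩
  have hv : 0 < (a - e) ⬝ᵥ (a - e) := dot_self_pos (sub_ne_zero.2 hae)
  have hvv : (a - e) ⬝ᵥ (a - e) = 2 * (a ⬝ᵥ (a - e)) := by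
    simp only [sub_dotProduct, dotProduct_sub, ha, hee, dotProduct_comm e a]; ring
  set v := a - e with hvdef
  refine ⟨LinearMap.id - (2 / (v ⬝ᵥ v)) • (dotProductBilin ℝ ℝ v).smulRight v, fun x y => ?_, fun x => ?_⟩
  · simp only [LinearMap.sub_apply, LinearMap.id_apply, LinearMap.smul_apply, LinearMap.smulRight_apply, dotProductBilin_apply_apply,
      sub_dotProduct, dotProduct_sub, smul_dotProduct, dotProduct_smul, smul_eq_mul, dotProduct_comm x v]
    field_simp; ring
  · simp only [LinearMap.sub_apply, LinearMap.id_apply, LinearMap.smul_apply, LinearMap.smulRight_apply, dotProductBilin_apply_apply,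
      dotProduct_sub, dotProduct_smul, smul_eq_mul]
    rw [← hex]
    have h1 : a ⬝ᵥ x = v ⬝ᵥ x + e ⬝ᵥ x := by rw [hvdef, sub_dotProduct]; ring
    rw [h1, hvv]
    have h2 : a ⬝ᵥ v ≠ 0 := by intro h; rw [h] at hvv; linarith
    field_simp; ring

lemma mom1 {t : ℝ} (ht : -(1/2) < t) :
    ∫ x : ℝ, Real.exp (-(x * x) / 2) * |Real.sqrt 2 * x| ^ (2 * t) =
      Real.sqrt (2 * Real.pi) * (Real.Gamma (1 + 2 * t) / Real.Gamma (1 + t)) := by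
  have h1 := integral_comp_abs (f := fun x : ℝ => Real.exp (-(x * x) / 2) * (Real.sqrt 2 * x) ^ (2 * t))
  have e1 : ∀ x : ℝ, Real.exp (-(|x| * |x|) / 2) * (Real.sqrt 2 * |x|) ^ (2 * t) = Real.exp (-(x * x) / 2) * |Real.sqrt 2 * x| ^ (2 * t) := by
    intro x; rw [abs_mul_abs_self, abs_mul, abs_of_nonneg (Real.sqrt_nonneg 2)]
  simp only [e1] at h1
  rw [h1]
  have h2 := integral_rpow_mul_exp_neg_mul_rpow (p := 2) (q := 2 * t) (b := 1/2) (by norm_num) (by linarith) (by norm_num)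
  have h3 : ∫ x in Set.Ioi (0:ℝ), Real.exp (-(x * x) / 2) * (Real.sqrt 2 * x) ^ (2 * t) =
      (2:ℝ)^t * ∫ x in Set.Ioi (0:ℝ), x ^ (2*t) * Real.exp (-(1/2) * x ^ (2:ℝ)) := by
    rw [← integral_const_mul]
    refine setIntegral_congr_fun measurableSet_Ioi fun x hx => ?_
    have hx' : (0:ℝ) < x := hx
    rw [Real.mul_rpow (Real.sqrt_nonneg 2) hx'.le, Real.rpow_mul (Real.sqrt_nonneg 2), Real.rpow_two, Real.rpow_two, Real.sq_sqrt (by norm_num)]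
    have : -(x*x)/2 = -(1/2) * x^2 := by ring
    rw [this]; ring
  rw [h3, h2]
  have h4 := Real.Gamma_mul_Gamma_add_half (t + 1/2)
  have e2 : t + 1/2 + 1/2 = 1 + t := by ring
  have e3 : 2 * (t + 1/2) = 1 + 2 * t := by ring
  have e4 : (2 * t + 1)/2 = t + 1/2 := by ring
  have e5 : 1 - (1 + 2 * t) = - (2*t) := by ring
  rw [e2, e3, e5] at h4
  have hG : Real.Gamma (1 + t) ≠ 0 := (Real.Gamma_pos_of_pos (by linarith)).ne'
  have h5 : Real.Gamma (t + 1/2) = Real.Gamma (1 + 2 * t) * 2 ^ (-(2*t)) * Real.sqrt Real.pi / Real.Gamma (1 + t) := by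
    rw [eq_div_iff hG, h4]
  rw [neg_div, e4, h5, Real.sqrt_mul (by norm_num), Real.sqrt_eq_rpow 2]
  have e6 : (1/2:ℝ) ^ (-(t+1/2)) = 2 ^ (t + 1/2) := by
    rw [one_div, Real.inv_rpow (by norm_num), ← Real.rpow_neg (by norm_num), neg_neg]
  rw [e6]
  have e7 : (2:ℝ) ^ t * 2 ^ (t+1/2) * 2 ^ (-(2*t)) = 2 ^ (1/2:ℝ) := by
    rw [← Real.rpow_add (by norm_num), ← Real.rpow_add (by norm_num)]; congr 1; ring
  rw [← e7]; field_simp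

lemma mom {r : ℕ} (hr : 1 ≤ r) {a : Fin r → ℝ} (ha : a ⬝ᵥ a = 2) {t : ℝ} (ht : -(1/2) < t) :
    (2 * Real.pi) ^ (-(r : ℝ) / 2) * ∫ x : Fin r → ℝ, Real.exp (-(x ⬝ᵥ x) / 2) * |a ⬝ᵥ x| ^ (2 * t) =
      Real.Gamma (1 + 2 * t) / Real.Gamma (1 + t) := by
  let i0 : Fin r := ⟨0, hr⟩
  obtain ⟨f, hf, hfa⟩ := householder i0 ha
  rw [← orth_integral f hf]
  simp only [hf, hfa]
  set g : Fin r → ℝ → ℝ := fun i x => Real.exp (-(x * x) / 2) * if i = i0 then |Real.sqrt 2 * x| ^ (2 * t) else 1 with hg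
  have e1 : ∀ x : Fin r → ℝ, Real.exp (-(x ⬝ᵥ x) / 2) * |Real.sqrt 2 * x i0| ^ (2 * t) = ∏ i, g i (x i) := by
    intro x
    simp only [hg]
    rw [Finset.prod_mul_distrib, ← Real.exp_sum, Finset.prod_ite_eq' Finset.univ i0 (fun i => |Real.sqrt 2 * x i| ^ (2*t)), if_pos (Finset.mem_univ _),
      ← Finset.sum_div, Finset.sum_neg_distrib]
    rfl
  simp only [e1]
  rw [integral_fintype_prod_volume_eq_prod]
  have e2 : ∀ i, ∫ x, g i x = Real.sqrt (2 * Real.pi) * if i = i0 then (Real.Gamma (1 + 2 * t) / Real.Gamma (1 + t)) else 1 := by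
    intro i
    simp only [hg]
    split_ifs with h
    · exact mom1 ht
    · have := integral_gaussian (1/2)
      simp only [mul_one]
      rw [show (2 * Real.pi) = Real.pi / (1/2) by ring, ← this]
      congr 1; ext x; congr 1; ring
  simp only [e2]
  rw [Finset.prod_mul_distrib, Finset.prod_ite_eq' Finset.univ i0 (fun i => Real.Gamma (1 + 2 * t) / Real.Gamma (1 + t)), if_pos (Finset.mem_univ _)]
  have e3 : (2 * Real.pi) ^ (-(r : ℝ) / 2) * ∏ _i : Fin r, Real.sqrt (2 * Real.pi) = 1 := by
    rw [Finset.prod_const, Finset.card_univ, Fintype.card_fin, Real.sqrt_eq_rpow, ← Real.rpow_natCast, ← Real.rpow_mul (by positivity),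
      ← Real.rpow_add (by positivity)]
    rw [show -(r:ℝ)/2 + 1/2 * r = 0 by ring, Real.rpow_zero]
  rw [← mul_assoc, e3, one_mul]

lemma deriv_cmp {u g : ℝ → ℝ} {u' g' : ℝ} (hu : HasDerivAt u u' 0) (hg : HasDerivAt g g' 0) (h0 : u 0 = g 0)
    (h : ∀ᶠ t in nhdsWithin (0:ℝ) (Set.Ioi 0), g t ≤ u t) : g' ≤ u' := by
  have h1 := (hasDerivAt_iff_tendsto_slope.1 (hu.sub hg)).mono_left (nhdsWithin_mono (0:ℝ) (fun x (hx : x ∈ Set.Ioi (0:ℝ)) => (ne_of_gt hx : x ≠ 0)))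
  have := ge_of_tendsto (b := 0) h1 (by
    filter_upwards [h, self_mem_nhdsWithin] with t ht ht0
    have ht0' : (0:ℝ) < t := ht0
    rw [slope_def_field]
    simp only [Pi.sub_apply, h0, sub_self, sub_zero]
    exact div_nonneg (sub_nonneg.2 ht) ht0'.le)
  linarith

lemma tf_deriv (d : ℕ) : HasDerivAt (tf d) (((d:ℂ) - 1) * deriv Complex.Gamma 1) 0 := by
  have hG : HasDerivAt Complex.Gamma (deriv Complex.Gamma 1) 1 :=
    (Complex.differentiableAt_Gamma_one).hasDerivAt
  have h1 : HasDerivAt (fun k : ℂ => Complex.Gamma (1 + k * d)) (deriv Complex.Gamma 1 * d) 0 := by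
    have e : HasDerivAt (fun k : ℂ => 1 + k * d) (d:ℂ) 0 := by
      simpa using ((hasDerivAt_id (0:ℂ)).mul_const (d:ℂ)).const_add 1
    exact HasDerivAt.comp (0:ℂ) (h₂ := Complex.Gamma) (by simpa using hG) e
  have h2 : HasDerivAt (fun k : ℂ => Complex.Gamma (1 + k)) (deriv Complex.Gamma 1) 0 := by
    have e : HasDerivAt (fun k : ℂ => 1 + k) (1:ℂ) 0 := (hasDerivAt_id (0:ℂ)).const_add 1
    exact (HasDerivAt.comp (0:ℂ) (h₂ := Complex.Gamma) (by simpa using hG) e).congr_deriv (mul_one _)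
  have := h1.div h2 (by simp)
  exact this.congr_deriv (by simp; ring)

lemma TT_deriv {r : ℕ} {d : Fin r → ℕ} {N : ℕ} (hN : N + r = ∑ i, d i) :
    HasDerivAt (TT d) (N * deriv Complex.Gamma 1) 0 := by
  have := HasDerivAt.fun_finsetProd (u := Finset.univ) (f := fun i => tf (d i)) (x := (0:ℂ)) (fun i _ => tf_deriv (d i))
  have e0 : ∀ i, tf (d i) 0 = 1 := fun i => by simp [tf]
  have hN' : (N:ℂ) + r = ∑ i, (d i : ℂ) := by exact_mod_cast hN
  refine HasDerivAt.congr_deriv (f := TT d) this ?_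
  simp only [e0, Finset.prod_const_one, one_smul, ← Finset.sum_mul]
  congr 1
  simp; linear_combination -hN'

lemma c_zero {r : ℕ} {d : Fin r → ℕ} {N : ℕ} (hN : N + r = ∑ i, d i) {c : ℝ} {f : ℝ → ℝ}
    (hf : ∀ t : ℝ, 0 < t → (f t : ℂ) = Complex.exp (c * t) * TT d t)
    (hb : ∀ t : ℝ, 0 < t → N * t < 1/2 → f t ≤ (tf 2 (N * t)).re ∧ 2 - (tf 2 (-(N * t))).re ≤ f t) : c = 0 := by
  set γ := deriv Complex.Gamma 1
  have e0 : tf 2 0 = 1 := by simp [tf]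
  have hU : HasDerivAt (fun z : ℂ => tf 2 (N * z)) (γ * N) ((0:ℝ):ℂ) := by
    have e : HasDerivAt (fun k : ℂ => N * k) (N:ℂ) 0 := by simpa using (hasDerivAt_id (0:ℂ)).const_mul (N:ℂ)
    have h2 : HasDerivAt (tf 2) γ ((N:ℂ) * 0) := by
      rw [mul_zero]; exact (tf_deriv 2).congr_deriv (by push_cast; ring)
    exact HasDerivAt.comp (0:ℂ) (h₂ := tf 2) h2 e
  have hL : HasDerivAt (fun z : ℂ => 2 - tf 2 (-(N * z))) (γ * N) ((0:ℝ):ℂ) := by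
    have e : HasDerivAt (fun k : ℂ => -(N * k)) (-N:ℂ) 0 := ((hasDerivAt_id (0:ℂ)).const_mul (N:ℂ)).neg.congr_deriv (by simp)
    have h2 : HasDerivAt (tf 2) γ (-((N:ℂ) * 0)) := by
      rw [mul_zero, neg_zero]; exact (tf_deriv 2).congr_deriv (by push_cast; ring)
    have := (HasDerivAt.comp (0:ℂ) (h₂ := tf 2) h2 e).const_sub 2
    exact this.congr_deriv (by ring)
  have hM : HasDerivAt (fun z : ℂ => Complex.exp (c * z) * TT d z) (c + γ * N) ((0:ℝ):ℂ) := by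
    have e : HasDerivAt (fun k : ℂ => (c:ℂ) * k) (c:ℂ) 0 := by simpa using (hasDerivAt_id (0:ℂ)).const_mul (c:ℂ)
    have := e.cexp.mul (TT_deriv hN)
    exact this.congr_deriv (by simp [TT_zero]; ring)
  have hU' := hU.real_of_complex
  have hL' := hL.real_of_complex
  have hM' := hM.real_of_complex
  have hsmall : ∀ᶠ t : ℝ in nhdsWithin (0:ℝ) (Set.Ioi 0), N * t < 1/2 :=
    nhdsWithin_le_nhds ((isOpen_lt (f := fun t : ℝ => N * t) (by fun_prop) continuous_const).mem_nhds (by simp))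
  have hfe : ∀ t : ℝ, 0 < t → (Complex.exp (c * t) * TT d t).re = f t := fun t ht => by rw [← hf t ht]; simp
  have h1 := deriv_cmp hU' hM' (by simp [e0, TT_zero]) (by
    filter_upwards [hsmall, self_mem_nhdsWithin] with t ht ht0
    rw [hfe t ht0]; exact_mod_cast (hb t ht0 ht).1)
  have h2 := deriv_cmp hM' hL' (by simp [e0, TT_zero]; norm_num) (by
    filter_upwards [hsmall, self_mem_nhdsWithin] with t ht ht0
    rw [hfe t ht0]
    have := (hb t ht0 ht).2
    simpa using this)
  simp only [Complex.add_re, Complex.ofReal_re] at h1 h2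
  linarith

end

section
lemma gauss_integrable0 {r : ℕ} : Integrable fun y : Fin r → ℝ => Real.exp (-(y ⬝ᵥ y) / 2) := by
  simpa using gauss_integrable_c (r := r) 0

lemma tf_two_re (u : ℝ) : (tf 2 (u : ℂ)).re = Real.Gamma (1 + 2 * u) / Real.Gamma (1 + u) := by
  have h1 : (1 : ℂ) + u * ((2 : ℕ) : ℂ) = ((1 + 2 * u : ℝ) : ℂ) := by push_cast; ring
  have h2 : (1 : ℂ) + u = ((1 + u : ℝ) : ℂ) := by push_cast; ring
  rw [tf, h1, h2, Complex.Gamma_ofReal, Complex.Gamma_ofReal, ← Complex.ofReal_div, Complex.ofReal_re]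

namespace RS
variable {r : ℕ} {G : Type} [Group G] (R : RS r G)

lemma FF_zero : R.FF 0 = 1 := by
  unfold FF
  have h : (fun x => R.fint 0 x) =ᵐ[volume] fun x => ((Real.exp (-(x ⬝ᵥ x) / 2) : ℝ) : ℂ) := by
    filter_upwards [R.ae_reg] with x hx
    simp only [fint, wgt]
    rw [if_neg (R.dlt_ne.2 hx)]
    simp
  rw [integral_congr_ae h, integral_complex_ofReal, gauss_int, ← Complex.ofReal_mul, two_pi_cancel, Complex.ofReal_one]

def fr (t : ℝ) (x : Fin r → ℝ) : ℝ := Real.exp (-(x ⬝ᵥ x) / 2) * Real.exp (2 * t * Real.log |R.dlt x|)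

def ff (t : ℝ) : ℝ := (2 * Real.pi) ^ (-(r : ℝ) / 2) * ∫ x, R.fr t x

lemma fint_fr (t : ℝ) : (fun x => R.fint t x) =ᵐ[volume] fun x => ((R.fr t x : ℝ) : ℂ) := by
  filter_upwards [R.ae_reg] with x hx
  simp only [fint, wgt, fr]
  rw [if_neg (R.dlt_ne.2 hx), Complex.real_smul]
  push_cast
  rfl

lemma ff_eq (t : ℝ) : ((R.ff t : ℝ) : ℂ) = R.FF t := by
  unfold FF ff
  rw [integral_congr_ae (R.fint_fr t), integral_complex_ofReal, Complex.ofReal_mul]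

lemma fr_integrable {t : ℝ} (ht : 0 ≤ t) : Integrable (R.fr t) := by
  have h := (R.fint_integrable (k := t) (by simpa using ht)).congr (R.fint_fr t)
  exact h.re

def am (t : ℝ) (x : Fin r → ℝ) : ℝ :=
  ∑ s ∈ R.S, (1 / (R.S.card : ℝ)) * (Real.exp (-(x ⬝ᵥ x) / 2) * |R.α s ⬝ᵥ x| ^ (2 * (R.S.card * t)))

lemma jensen (hN : 0 < R.S.card) (t : ℝ) {x : Fin r → ℝ} (hx : R.Reg x) :
    R.fr t x ≤ R.am t x := by
  have hN' : (0:ℝ) < R.S.card := by exact_mod_cast hN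
  have hl : Real.log |R.dlt x| = ∑ s ∈ R.S, Real.log |R.α s ⬝ᵥ x| := by
    unfold dlt
    rw [Finset.abs_prod, Real.log_prod (fun s hs => abs_ne_zero.2 (hx s hs))]
  have h := convexOn_exp.map_sum_le (t := R.S) (w := fun _ => 1 / (R.S.card : ℝ))
    (p := fun s => 2 * (R.S.card * t) * Real.log |R.α s ⬝ᵥ x|) (fun _ _ => by positivity)
    (by simp [hN'.ne']) (fun _ _ => Set.mem_univ _)
  simp only [smul_eq_mul] at h
  have e1 : ∑ s ∈ R.S, 1 / (R.S.card : ℝ) * (2 * (R.S.card * t) * Real.log |R.α s ⬝ᵥ x|) = 2 * t * Real.log |R.dlt x| := by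
    rw [hl, Finset.mul_sum]
    refine Finset.sum_congr rfl fun s _ => ?_
    field_simp
  rw [e1] at h
  unfold fr am
  refine (mul_le_mul_of_nonneg_left h (Real.exp_pos _).le).trans_eq ?_
  rw [Finset.mul_sum]
  refine Finset.sum_congr rfl fun s hs => ?_
  rw [Real.rpow_def_of_pos (abs_pos.2 (hx s hs)), mul_comm (Real.log _)]
  ring

lemma mom_integrable (hr : 1 ≤ r) {a : Fin r → ℝ} (ha : a ⬝ᵥ a = 2) {t : ℝ} (ht : -(1/2) < t) :
    Integrable fun x : Fin r → ℝ => Real.exp (-(x ⬝ᵥ x) / 2) * |a ⬝ᵥ x| ^ (2 * t) := by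
  apply Integrable.of_integral_ne_zero
  intro h
  have h2 := mom hr ha ht
  rw [h, mul_zero] at h2
  have h3 : 0 < Real.Gamma (1 + 2 * t) / Real.Gamma (1 + t) :=
    div_pos (Real.Gamma_pos_of_pos (by linarith)) (Real.Gamma_pos_of_pos (by linarith))
  linarith

lemma am_integrable (hr : 1 ≤ r) {t : ℝ} (ht : -(1/2) < R.S.card * t) : Integrable (R.am t) :=
  integrable_finsetSum _ fun s hs => (mom_integrable hr (R.nrm s hs) ht).const_mul _

lemma am_int (hr : 1 ≤ r) (hN : 0 < R.S.card) {t : ℝ} (ht : -(1/2) < R.S.card * t) :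
    (2 * Real.pi) ^ (-(r : ℝ) / 2) * ∫ x, R.am t x = (tf 2 ((R.S.card * t : ℝ) : ℂ)).re := by
  have hN' : (0:ℝ) < R.S.card := by exact_mod_cast hN
  unfold am
  rw [integral_finsetSum _ fun s hs => (mom_integrable hr (R.nrm s hs) ht).const_mul _, Finset.mul_sum, tf_two_re]
  have : ∀ s ∈ R.S, (2 * Real.pi) ^ (-(r : ℝ) / 2) * ∫ x : Fin r → ℝ, (1 / (R.S.card : ℝ)) * (Real.exp (-(x ⬝ᵥ x) / 2) * |R.α s ⬝ᵥ x| ^ (2 * (R.S.card * t)))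
      = (1 / (R.S.card : ℝ)) * (Real.Gamma (1 + 2 * (R.S.card * t)) / Real.Gamma (1 + R.S.card * t)) := fun s hs => by
    rw [integral_const_mul, mul_left_comm, mom hr (R.nrm s hs) ht]
  rw [Finset.sum_congr rfl this, Finset.sum_const, nsmul_eq_mul, ← mul_assoc, mul_one_div_cancel hN'.ne', one_mul]

lemma ff_bounds (hr : 1 ≤ r) {t : ℝ} (ht : 0 < t) (hNt : R.S.card * t < 1/2) :
    R.ff t ≤ (tf 2 (R.S.card * t)).re ∧ 2 - (tf 2 (-(R.S.card * t))).re ≤ R.ff t := by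
  have hp : (0:ℝ) < (2 * Real.pi) ^ (-(r : ℝ) / 2) := by positivity
  rcases Nat.eq_zero_or_pos R.S.card with h0 | hN
  · have e : R.ff t = 1 := by
      have hS : R.S = ∅ := Finset.card_eq_zero.1 h0
      unfold ff fr dlt
      rw [hS]
      simp [gauss_int, two_pi_cancel]
    rw [h0, e]
    norm_num [tf]
  have hnn : (0:ℝ) ≤ R.S.card * t := by positivity
  have e1 := R.am_int hr hN (t := t) (by linarith)
  have e2 := R.am_int hr hN (t := -t) (by linarith)
  have i1 := R.am_integrable hr (t := t) (by linarith)
  have i2 := R.am_integrable hr (t := -t) (by linarith)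
  have c1 : ((R.S.card : ℂ) * (t : ℂ)) = ((R.S.card * t : ℝ) : ℂ) := by push_cast; rfl
  have c2 : (-((R.S.card : ℂ) * (t : ℂ))) = ((R.S.card * -t : ℝ) : ℂ) := by push_cast; ring
  rw [c2, c1, ← e1, ← e2]
  constructor
  · refine mul_le_mul_of_nonneg_left (integral_mono_ae (R.fr_integrable ht.le) i1 ?_) hp.le
    filter_upwards [R.ae_reg] with x hx using R.jensen hN t hx
  · have hi : Integrable fun x : Fin r → ℝ => 2 * Real.exp (-(x ⬝ᵥ x) / 2) - R.am (-t) x := (gauss_integrable0.const_mul 2).sub i2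
    have h3 : ∫ x : Fin r → ℝ, (2 * Real.exp (-(x ⬝ᵥ x) / 2) - R.am (-t) x) ≤ ∫ x, R.fr t x := by
      refine integral_mono_ae hi (R.fr_integrable ht.le) ?_
      filter_upwards [R.ae_reg] with x hx
      have hj := R.jensen hN (-t) hx
      unfold fr at hj ⊢
      set u := 2 * t * Real.log |R.dlt x|
      have hu : 2 * -t * Real.log |R.dlt x| = -u := by simp only [u]; ring
      rw [hu] at hj
      have h4 : 2 ≤ Real.exp u + Real.exp (-u) := by
        have := Real.add_one_le_exp u
        have := Real.add_one_le_exp (-u)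
        linarith
      have h5 := mul_le_mul_of_nonneg_left h4 (Real.exp_pos (-(x ⬝ᵥ x) / 2)).le
      linarith
    rw [integral_sub (gauss_integrable0.const_mul 2) i2, integral_const_mul, gauss_int] at h3
    have h6 := mul_le_mul_of_nonneg_left h3 hp.le
    have h7 := two_pi_cancel (r := r)
    unfold ff
    linear_combination h6 - 2 * h7

end RS

theorem RInv.main {r : ℕ} (hr : 1 ≤ r) {G : Type} [Group G] [Fintype G] {R : RS r G} (I : RInv R) {k : ℂ} (hk : 0 ≤ k.re) :
    R.FF k = TT I.d k := by
  obtain ⟨p, hp, hp2⟩ := R.exists_generic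
  have hN := I.sum_d hp hp2
  obtain ⟨y0, h0, a, hF1, hE1, hE2, hE⟩ := R.main_bounds
  obtain ⟨c, hc⟩ := abs_main I.d_pos hN (Nat.cast_nonneg (Fintype.card G)) R.FF_cont (fun k hk => R.FF_diff hk) hE
    (fun k hk => R.EE_eq h0 hk) (fun k => I.Zt_sin h0 k) hF1 hE1 hE2 (fun φ h h' => R.FF_imag h h') R.FF_zero
  have hc0 : c = 0 := c_zero hN (f := R.ff) (fun t ht => by rw [R.ff_eq]; exact hc t (by simpa using ht))
    (fun t ht hNt => R.ff_bounds hr ht hNt)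
  have hpos : ∀ k : ℂ, 0 < k.re → R.FF k = TT I.d k := fun k hk => by
    rw [hc k hk, hc0]; simp
  have hq : Filter.Tendsto (fun t : ℝ => k + t) (nhdsWithin 0 (Set.Ioi 0)) (nhdsWithin k {k | 0 ≤ k.re}) := by
    refine tendsto_nhdsWithin_of_tendsto_nhds_of_eventually_within _ ?_ ?_
    · have hc : Continuous (fun t : ℝ => k + (t:ℂ)) := by fun_prop
      have := (hc.tendsto 0).mono_left (nhdsWithin_le_nhds (s := Set.Ioi 0))
      simpa using this
    · filter_upwards [self_mem_nhdsWithin] with t ht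
      have : (0:ℝ) < t := ht
      simp; linarith
  have h1 := (R.FF_cont k hk).tendsto.comp hq
  have h2 := ((TT_diff' (d := I.d) hk).continuousAt.continuousWithinAt (s := {k | 0 ≤ k.re})).tendsto.comp hq
  refine tendsto_nhds_unique h1 (h2.congr' ?_)
  filter_upwards [self_mem_nhdsWithin] with t ht
  have ht' : (0:ℝ) < t := ht
  exact (hpos _ (by simp; linarith)).symm

end

lemma rank_conj_le {r : ℕ} (A B M : Matrix (Fin r) (Fin r) ℝ) : (A * M * B).rank ≤ M.rank :=
  (Matrix.rank_mul_le_left _ _).trans (Matrix.rank_mul_le_right _ _)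

lemma rank_conj {r : ℕ} (A B M : Matrix (Fin r) (Fin r) ℝ) (h : A * B = 1) : (A * M * B).rank = M.rank := by
  refine le_antisymm (rank_conj_le _ _ _) ?_
  have h' : B * A = 1 := mul_eq_one_comm.1 h
  have e : B * (A * M * B) * A = M := by
    calc B * (A * M * B) * A = (B * A) * M * (B * A) := by simp only [mul_assoc]
      _ = M := by rw [h']; simp
  calc M.rank = (B * (A * M * B) * A).rank := by rw [e]
    _ ≤ _ := rank_conj_le _ _ _

lemma matOfR_mul {r : ℕ} {W : Subgroup (Matrix.GeneralLinearGroup (Fin r) ℝ)} (a b : W) :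
    matOfR (a * b) = matOfR a * matOfR b := rfl

lemma matOfR_one {r : ℕ} {W : Subgroup (Matrix.GeneralLinearGroup (Fin r) ℝ)} :
    matOfR (1 : W) = 1 := rfl

/-- The reflection system attached to the data of the theorem. -/
def mkRS (r : ℕ)
    (W : Subgroup (Matrix.GeneralLinearGroup (Fin r) ℝ))
    (hOrth : ∀ w : W, (Matrix.transpose (matOfR w)) * matOfR w = 1)
    (S : Finset W)
    (hS : ∀ s : W, s ∈ S ↔
      Matrix.rank ((1 : Matrix (Fin r) (Fin r) ℝ) - matOfR s) = 1)
    (hgen : Subgroup.closure (S : Set W) = (⊤ : Subgroup W))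
    (α : W → Fin r → ℝ)
    (hnorm : ∀ s ∈ S, ∑ i, α s i * α s i = 2)
    (hrefl : ∀ s ∈ S, ∀ v : Fin r → ℝ,
      Matrix.mulVec (matOfR s) v = v - (∑ i, α s i * v i) • α s) : RS r W where
  ρ := { toFun := fun w => (matOfR w).mulVecLin
         map_one' := by rw [matOfR_one, Matrix.mulVecLin_one]; rfl
         map_mul' := fun a b => by rw [matOfR_mul, Matrix.mulVecLin_mul]; rfl }
  orth := fun g x y => by
    change (matOfR g).mulVec x ⬝ᵥ (matOfR g).mulVec y = _
    rw [Matrix.dotProduct_mulVec, ← Matrix.mulVec_transpose, Matrix.mulVec_mulVec, hOrth, Matrix.one_mulVec]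
  inj := fun a b h => by
    have h' : (matOfR a).mulVecLin = (matOfR b).mulVecLin := h
    have h2 : matOfR a = matOfR b := Matrix.toLin'.injective h'
    exact Subtype.ext (Units.ext h2)
  S := S
  α := α
  nrm := hnorm
  refl := hrefl
  conj_mem := fun g s hs => by
    rw [hS] at hs ⊢
    have h1 : matOfR g * matOfR g⁻¹ = 1 := by rw [← matOfR_mul, mul_inv_cancel, matOfR_one]
    rw [← rank_conj (matOfR g) (matOfR g⁻¹) _ h1] at hs
    rw [mul_sub, sub_mul, mul_one, h1] at hs
    exact hs
  gen := hgen

/-- **The Macdonald–Mehta integral (Opdam; uniform proof by Etingof).**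
Let `W ⊆ O(ℝ^r)` be a finite real reflection group with set of reflections `S`, roots
`α_s` normalized by `(α_s, α_s) = 2`, and discriminant `δ(x) = ∏_{s∈S} (α_s, x)`.  Let
`P₁,…,P_r` be algebraically independent homogeneous generators of the invariant algebra
`ℝ[x₁,…,x_r]^W`, of degrees `d₁,…,d_r`.  Then for every `k ∈ ℂ` with `Re k ≥ 0`:
`(2π)^{−r/2} ∫_{ℝ^r} e^{−(x,x)/2} |δ(x)|^{2k} dx = ∏ᵢ Γ(1 + k dᵢ)/Γ(1 + k)`,
where `|δ(x)|^{2k} = exp(2k log|δ(x)|)` (interpreted as `0` when `δ(x) = 0`). -/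
theorem macdonald_mehta_integral (r : ℕ) (hr : 1 ≤ r)
    (W : Subgroup (Matrix.GeneralLinearGroup (Fin r) ℝ)) [Finite W]
    (hOrth : ∀ w : W, (Matrix.transpose (matOfR w)) * matOfR w = 1)
    (S : Finset W)
    (hS : ∀ s : W, s ∈ S ↔
      Matrix.rank ((1 : Matrix (Fin r) (Fin r) ℝ) - matOfR s) = 1)
    (hgen : Subgroup.closure (S : Set W) = (⊤ : Subgroup W))
    (α : W → Fin r → ℝ)
    (hnorm : ∀ s ∈ S, ∑ i, α s i * α s i = 2)
    (hrefl : ∀ s ∈ S, ∀ v : Fin r → ℝ,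
      Matrix.mulVec (matOfR s) v = v - (∑ i, α s i * v i) • α s)
    (P : Fin r → MvPolynomial (Fin r) ℝ) (d : Fin r → ℕ)
    (hPalg : AlgebraicIndependent ℝ P)
    (hPhom : ∀ i, (P i).IsHomogeneous (d i))
    (hPgen : ∀ p : MvPolynomial (Fin r) ℝ,
      p ∈ Algebra.adjoin ℝ (Set.range P) ↔
        ∀ w : W, MvPolynomial.aeval
            (fun i => ∑ j, MvPolynomial.C (matOfR w⁻¹ i j) * MvPolynomial.X j) p = p)
    (k : ℂ) (hk : 0 ≤ k.re) :
    (((2 * Real.pi) ^ (-(r : ℝ) / 2) : ℝ) : ℂ) *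
        ∫ x : Fin r → ℝ,
          Real.exp (-(∑ i, x i * x i) / 2) •
            (if (∏ s ∈ S, ∑ i, α s i * x i) = 0 then (0 : ℂ)
             else Complex.exp (2 * k * Real.log |∏ s ∈ S, ∑ i, α s i * x i|))
      = ∏ i, Complex.Gamma (1 + k * (d i : ℂ)) / Complex.Gamma (1 + k) := by
  have _ := Fintype.ofFinite W
  let R := mkRS r W hOrth S hS hgen α hnorm hrefl
  have hact : ∀ (w : W) (p : MvPolynomial (Fin r) ℝ), R.act w p = MvPolynomial.aeval
      (fun i => ∑ j, MvPolynomial.C (matOfR w⁻¹ i j) * MvPolynomial.X j) p := fun w p => by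
    unfold RS.act LF
    have e : ∀ i j, R.ρ w⁻¹ (Pi.single j 1) i = matOfR w⁻¹ i j := fun i j => by
      change (matOfR w⁻¹).mulVec (Pi.single j 1) i = _
      rw [Matrix.mulVec_single_one]; rfl
    simp only [e]
  let I : RInv R := ⟨P, d, hPalg, hPhom, fun f => by rw [hPgen]; simp only [hact]⟩
  have h := I.main hr hk
  refine Eq.trans ?_ h
  unfold RS.FF RS.fint RS.wgt
  rfl

end
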